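/- Under the standing assumptions, ∫_Ω (|∇u_λ|² + u_λ²) dx → 0 as λ → −λ₁(Ω) from the right (i.e. u_λ → 0 in H¹₀(Ω) as λ → −λ₁(Ω)⁺). -/

import Mathlib

open MeasureTheory Set Filter Topology

noncomputable section

/-- `N`-dimensional Euclidean space. -/
abbrev Euc (N : ℕ) := EuclideanSpace ℝ (Fin N)

/-- The Laplacian of a real-valued function on Euclidean space, defined as the
sum of the pure second partial derivatives in the coordinate directions. -/
def lap {N : ℕ} (u : Euc N → ℝ) (x : Euc N) : ℝ :=
  ∑ i : Fin N,
    fderiv ℝ (fun y => fderiv ℝ u y (EuclideanSpace.single i 1)) x (EuclideanSpace.single i 1)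

/-- The first Dirichlet eigenvalue of `-Δ` on `Ω`, defined as the infimum of
Rayleigh quotients of nonzero smooth functions with compact support contained in `Ω`. -/
def firstEig {N : ℕ} (Ω : Set (Euc N)) : ℝ :=
  sInf { r : ℝ | ∃ φ : Euc N → ℝ, ContDiff ℝ (⊤ : ℕ∞) φ ∧ HasCompactSupport φ ∧
    tsupport φ ⊆ Ω ∧ φ ≠ 0 ∧
    r = (∫ x, ‖fderiv ℝ φ x‖ ^ 2) / (∫ x, (φ x) ^ 2) }

/-- `u` is a (classical) positive solution of `-Δ u + lam • u = f(x, u)` in `Ω`,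
vanishing on the boundary: `u ∈ C²(Ω) ∩ C(closure Ω)`, `u > 0` in `Ω`, `u = 0` on `∂Ω`. -/
def IsPosSolution {N : ℕ} (Ω : Set (Euc N)) (f : Euc N → ℝ → ℝ) (lam : ℝ)
    (u : Euc N → ℝ) : Prop :=
  ContDiffOn ℝ 2 u Ω ∧ ContinuousOn u (closure Ω) ∧ (∀ x ∈ Ω, 0 < u x) ∧
    (∀ x ∈ frontier Ω, u x = 0) ∧ ∀ x ∈ Ω, - lap u x + lam * u x = f x (u x)

/-- The standing assumptions of the paper: `Ω ⊆ ℝ^N` is a bounded domain with `C¹`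
boundary, convex in every coordinate direction and invariant under a blockwise
orthogonal group `G = O(m₁) × ⋯ × O(m_ℓ)` with every `m_i ≥ 2`; the nonlinearity
`f` satisfies (f1), (f2), (f3) with splitting `f(x,t) = d(x)|t|^{p-2} t + g(x,t)`;
and for every `λ > -λ₁(Ω)` the problem has exactly one positive solution `u λ`. -/
structure Standing (N : ℕ) (Ω : Set (Euc N)) (f : Euc N → ℝ → ℝ)
    (d : Euc N → ℝ) (g : Euc N → ℝ → ℝ) (p : ℝ) (u : ℝ → Euc N → ℝ) : Prop where
  dim : 2 ≤ N
  isOpen : IsOpen Ω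
  conn : IsConnected Ω
  bdd : Bornology.IsBounded Ω
  c1bdry : ∀ x ∈ frontier Ω, ∃ U : Set (Euc N), IsOpen U ∧ x ∈ U ∧
      ∃ F : Euc N → ℝ, ContDiff ℝ 1 F ∧ (∀ y ∈ U, fderiv ℝ F y ≠ 0) ∧
        Ω ∩ U = {y ∈ U | F y < 0}
  conv : ∀ i : Fin N, ∀ x ∈ Ω, ∀ y ∈ Ω, (∀ j, j ≠ i → x j = y j) → segment ℝ x y ⊆ Ω
  symm : ∃ ℓ : ℕ, 1 ≤ ℓ ∧ ∃ β : Fin N → Fin ℓ, Monotone β ∧ Function.Surjective β ∧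
      (∀ j, 2 ≤ (Finset.univ.filter (fun i => β i = j)).card) ∧
      ∀ e : Euc N ≃ₗᵢ[ℝ] Euc N,
        (∀ j : Fin ℓ, ∀ x : Euc N, (∀ i, β i ≠ j → x i = 0) → ∀ i, β i ≠ j → e x i = 0) →
          e '' Ω = Ω ∧ (∀ x t, f (e x) t = f x t) ∧ ∀ x, d (e x) = d x
  f_c1 : ContDiffOn ℝ 1 (Function.uncurry f) (Ω ×ˢ (univ : Set ℝ))
  f_zero : ∀ x ∈ Ω, f x 0 = 0 ∧ deriv (f x) 0 = 0
  f_ar : ∃ a b : ℝ, 2 < a ∧ a ≤ b ∧ (3 ≤ N → b < 2 * N / ((N : ℝ) - 2)) ∧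
      ∀ᵐ x ∂(volume : Measure (Euc N)).restrict Ω, ∀ t : ℝ, t ≠ 0 →
        0 < (a - 1) * f x t * t ∧ (a - 1) * f x t * t ≤ deriv (f x) t * t ^ 2 ∧
          deriv (f x) t * t ^ 2 ≤ (b - 1) * f x t * t
  f_bdd : ∃ M : ℝ, 0 < M ∧ ∀ x ∈ Ω, |f x 1| < M ∧ |f x (-1)| < M
  hp : 2 < p ∧ (3 ≤ N → p < 2 * N / ((N : ℝ) - 2))
  f_split : ∀ x t, f x t = d x * |t| ^ (p - 2) * t + g x t
  d_c1 : ContDiffOn ℝ 1 d (closure Ω)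
  d_bdd : ∃ C : ℝ, ∀ x ∈ Ω, |d x| ≤ C
  d_nonneg : ∀ x ∈ closure Ω, 0 ≤ d x
  d_zero : d 0 = 1
  g_top : ∀ x ∈ Ω, Tendsto (fun t : ℝ => g x t / t ^ (p - 1)) atTop (𝓝 0)
  g_zero : ∀ x ∈ Ω, Tendsto (fun t : ℝ => g x t / t) (𝓝[≠] (0 : ℝ)) (𝓝 0)
  mono : ∀ i : Fin N, ∀ x ∈ Ω, ∀ y ∈ Ω, (∀ j, j ≠ i → x j = y j) → |x i| ≤ |y i| →
      (∀ t, f y t ≤ f x t) ∧ d y ≤ d x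
  sol : ∀ lam : ℝ, - firstEig Ω < lam →
      IsPosSolution Ω f lam (u lam) ∧
        ∀ v, IsPosSolution Ω f lam v → EqOn v (u lam) (closure Ω)

theorem ContDiffAt.fderiv_apply_const {N : ℕ} {u : Euc N → ℝ} {x : Euc N}
    (hu : ContDiffAt ℝ 2 u x) (v : Euc N) :
    ContDiffAt ℝ 1 (fun y => fderiv ℝ u y v) x :=
  (hu.fderiv_right (m := 1) (by norm_num)).clm_apply contDiffAt_const

theorem ContDiffAt.eventually_differentiableAt_two {N : ℕ} {u : Euc N → ℝ} {x : Euc N}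
    (hu : ContDiffAt ℝ 2 u x) : ∀ᶠ y in 𝓝 x, DifferentiableAt ℝ u y := by
  filter_upwards [hu.eventually (by simp)] with y hy using hy.differentiableAt (by norm_num)

theorem lap_congr {N : ℕ} {u v : Euc N → ℝ} {x : Euc N} (h : u =ᶠ[𝓝 x] v) :
    lap u x = lap v x := by
  unfold lap
  refine Finset.sum_congr rfl fun i _ => ?_
  have : (fun y => fderiv ℝ u y (EuclideanSpace.single i 1)) =ᶠ[𝓝 x]
      (fun y => fderiv ℝ v y (EuclideanSpace.single i 1)) := by
    filter_upwards [h.fderiv (𝕜 := ℝ)] with y hy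
    rw [hy]
  rw [this.fderiv_eq]

theorem lap_sub {N : ℕ} {u v : Euc N → ℝ} {x : Euc N} (hu : ContDiffAt ℝ 2 u x)
    (hv : ContDiffAt ℝ 2 v x) : lap (fun y => u y - v y) x = lap u x - lap v x := by
  unfold lap
  rw [← Finset.sum_sub_distrib]
  refine Finset.sum_congr rfl fun i _ => ?_
  have : (fun y => fderiv ℝ (fun y => u y - v y) y (EuclideanSpace.single i 1)) =ᶠ[𝓝 x]
      (fun y => fderiv ℝ u y (EuclideanSpace.single i 1)
        - fderiv ℝ v y (EuclideanSpace.single i 1)) := by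
    filter_upwards [hu.eventually_differentiableAt_two, hv.eventually_differentiableAt_two]
      with y h1 h2
    rw [fderiv_fun_sub h1 h2]; rfl
  rw [this.fderiv_eq, fderiv_fun_sub]
  · rfl
  · exact (hu.fderiv_apply_const _).differentiableAt (by norm_num)
  · exact (hv.fderiv_apply_const _).differentiableAt (by norm_num)

theorem lap_add {N : ℕ} {u v : Euc N → ℝ} {x : Euc N} (hu : ContDiffAt ℝ 2 u x)
    (hv : ContDiffAt ℝ 2 v x) : lap (fun y => u y + v y) x = lap u x + lap v x := by
  unfold lap
  rw [← Finset.sum_add_distrib]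
  refine Finset.sum_congr rfl fun i _ => ?_
  have : (fun y => fderiv ℝ (fun y => u y + v y) y (EuclideanSpace.single i 1)) =ᶠ[𝓝 x]
      (fun y => fderiv ℝ u y (EuclideanSpace.single i 1)
        + fderiv ℝ v y (EuclideanSpace.single i 1)) := by
    filter_upwards [hu.eventually_differentiableAt_two, hv.eventually_differentiableAt_two]
      with y h1 h2
    rw [fderiv_fun_add h1 h2]; rfl
  rw [this.fderiv_eq, fderiv_fun_add]
  · rfl
  · exact (hu.fderiv_apply_const _).differentiableAt (by norm_num)
  · exact (hv.fderiv_apply_const _).differentiableAt (by norm_num)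

theorem lap_const {N : ℕ} (c : ℝ) (x : Euc N) : lap (fun _ => c) x = 0 := by
  simp [lap]

theorem lap_const_mul {N : ℕ} {u : Euc N → ℝ} {x : Euc N} (c : ℝ) (hu : ContDiffAt ℝ 2 u x) :
    lap (fun y => c * u y) x = c * lap u x := by
  unfold lap
  rw [Finset.mul_sum]
  refine Finset.sum_congr rfl fun i _ => ?_
  have : (fun y => fderiv ℝ (fun y => c * u y) y (EuclideanSpace.single i 1)) =ᶠ[𝓝 x]
      (fun y => c * fderiv ℝ u y (EuclideanSpace.single i 1)) := by
    filter_upwards [hu.eventually_differentiableAt_two] with y h1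
    rw [fderiv_const_mul h1]; rfl
  rw [this.fderiv_eq, fderiv_const_mul]
  · rfl
  · exact (hu.fderiv_apply_const _).differentiableAt (by norm_num)

/-- The Laplacian is nonnegative at an interior local minimum. -/
theorem lap_nonneg_of_isLocalMin {N : ℕ} {u : Euc N → ℝ} {x : Euc N} (hu : ContDiffAt ℝ 2 u x)
    (hmin : IsLocalMin u x) : 0 ≤ lap u x := by
  refine Finset.sum_nonneg fun i _ => ?_
  set e : Euc N := EuclideanSpace.single i 1
  by_contra! hneg
  set k : ℝ → ℝ := fun t => u (x + t • e)
  have hline : ∀ t : ℝ, HasDerivAt (fun t : ℝ => x + t • e) e t := fun t => by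
    simpa using ((hasDerivAt_id t).smul_const e).const_add x
  have hcont : Continuous fun t : ℝ => x + t • e := by fun_prop
  have ht0 : Tendsto (fun t : ℝ => x + t • e) (𝓝 0) (𝓝 x) := by
    simpa using hcont.tendsto 0
  have hd : deriv k =ᶠ[𝓝 0] fun t => fderiv ℝ u (x + t • e) e := by
    filter_upwards [ht0.eventually hu.eventually_differentiableAt_two] with t ht
    exact (ht.hasFDerivAt.comp_hasDerivAt t (hline t)).deriv
  have hmin' : IsLocalMin k 0 := by
    have := ht0.eventually hmin
    filter_upwards [this] with t ht
    simpa [k] using ht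
  have hdd : deriv (deriv k) 0 = fderiv ℝ (fun y => fderiv ℝ u y e) x e := by
    rw [hd.deriv_eq]
    have h1 : HasFDerivAt (fun y => fderiv ℝ u y e)
        (fderiv ℝ (fun y => fderiv ℝ u y e) x) (x + (0 : ℝ) • e) := by
      simpa using ((hu.fderiv_apply_const e).differentiableAt (by norm_num)).hasFDerivAt
    exact (h1.comp_hasDerivAt 0 (hline 0)).deriv
  have hkc : ContinuousAt k 0 := by
    refine ContinuousAt.comp (f := fun t : ℝ => x + t • e) (g := u) ?_ hcont.continuousAt
    simpa using hu.continuousAt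
  have hmax : IsLocalMin (-k) 0 := by
    refine isLocalMin_of_deriv_deriv_pos ?_ ?_ hkc.neg
    · have : deriv (-k) = - deriv k := by ext t; exact deriv.neg
      rw [this, show deriv (-deriv k) 0 = - deriv (deriv k) 0 from deriv.neg, hdd]
      linarith
    · rw [show deriv (-k) 0 = - deriv k 0 from deriv.neg, hmin'.deriv_eq_zero, neg_zero]
  have hc : k =ᶠ[𝓝 0] fun _ => k 0 := by
    filter_upwards [hmin', hmax] with t h1 h2
    simp only [Pi.neg_apply] at h2
    linarith
  have h0 : deriv (deriv k) 0 = 0 := by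
    rw [hc.deriv.deriv_eq]; simp
  rw [hdd] at h0
  linarith

theorem hasFDerivAt_norm_sub_sq {N : ℕ} (x₀ y : Euc N) :
    HasFDerivAt (fun y : Euc N => ‖y - x₀‖ ^ 2) (2 • innerSL ℝ (y - x₀)) y := by
  simpa using ((hasFDerivAt_id y).sub_const x₀).norm_sq

/-- The Laplacian of a radial function, written as a function of the squared radius. -/
theorem lap_radial {N : ℕ} {F F' : ℝ → ℝ} {F'' : ℝ} {x₀ x : Euc N}
    (h1 : ∀ᶠ r in 𝓝 (‖x - x₀‖ ^ 2), HasDerivAt F (F' r) r)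
    (h2 : HasDerivAt F' F'' (‖x - x₀‖ ^ 2)) :
    lap (fun y => F (‖y - x₀‖ ^ 2)) x
      = 4 * ‖x - x₀‖ ^ 2 * F'' + 2 * N * F' (‖x - x₀‖ ^ 2) := by
  have hg : ∀ y, HasFDerivAt (fun y : Euc N => ‖y - x₀‖ ^ 2) (2 • innerSL ℝ (y - x₀)) y :=
    hasFDerivAt_norm_sub_sq x₀
  have hgt : Tendsto (fun y : Euc N => ‖y - x₀‖ ^ 2) (𝓝 x) (𝓝 (‖x - x₀‖ ^ 2)) :=
    (hg x).continuousAt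
  have key : ∀ i : Fin N,
      fderiv ℝ (fun y => fderiv ℝ (fun y => F (‖y - x₀‖ ^ 2)) y (EuclideanSpace.single i 1)) x
        (EuclideanSpace.single i 1)
      = 4 * (x - x₀) i ^ 2 * F'' + 2 * F' (‖x - x₀‖ ^ 2) := by
    intro i
    have e1 : (fun y => fderiv ℝ (fun y => F (‖y - x₀‖ ^ 2)) y (EuclideanSpace.single i 1))
        =ᶠ[𝓝 x] fun y => F' (‖y - x₀‖ ^ 2) * (2 * (y - x₀) i) := by
      filter_upwards [hgt.eventually h1] with y hy
      have := (hy.comp_hasFDerivAt y (hg y)).fderiv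
      rw [show (fun y => F (‖y - x₀‖ ^ 2)) = F ∘ fun y => ‖y - x₀‖ ^ 2 from rfl, this]
      simp [EuclideanSpace.inner_single_right]
    rw [e1.fderiv_eq]
    have h3 : HasFDerivAt (fun y : Euc N => 2 * (y - x₀) i)
        ((2 : ℝ) • (EuclideanSpace.proj i : Euc N →L[ℝ] ℝ)) x := by
      have := (((EuclideanSpace.proj i : Euc N →L[ℝ] ℝ).hasFDerivAt (x := x)).sub_const
        (x₀ i)).const_mul 2
      simpa using this
    have h4 := (h2.comp_hasFDerivAt x (hg x)).mul h3
    have h5 : HasFDerivAt (fun y => F' (‖y - x₀‖ ^ 2) * (2 * (y - x₀) i)) _ x := h4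
    rw [h5.fderiv]
    simp [EuclideanSpace.inner_single_right]
    ring
  unfold lap
  rw [Finset.sum_congr rfl fun i _ => key i, Finset.sum_add_distrib, ← Finset.sum_mul,
    ← Finset.mul_sum, EuclideanSpace.norm_sq_eq]
  simp
  ring

/-- The Laplacian of a function of one coordinate. -/
theorem lap_coord {N : ℕ} {q q' : ℝ → ℝ} {q'' : ℝ} {x₀ x : Euc N} (i : Fin N)
    (h1 : ∀ r, HasDerivAt q (q' r) r) (h2 : HasDerivAt q' q'' ((x - x₀) i)) :
    lap (fun y => q ((y - x₀) i)) x = q'' := by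
  have hg : ∀ y, HasFDerivAt (fun y : Euc N => (y - x₀) i)
      (EuclideanSpace.proj i : Euc N →L[ℝ] ℝ) y := fun y => by
    simpa using ((EuclideanSpace.proj i : Euc N →L[ℝ] ℝ).hasFDerivAt (x := y)).sub_const (x₀ i)
  have key : ∀ j : Fin N,
      fderiv ℝ (fun y => fderiv ℝ (fun y => q ((y - x₀) i)) y (EuclideanSpace.single j 1)) x
        (EuclideanSpace.single j 1) = if i = j then q'' else 0 := by
    intro j
    have e1 : (fun y => fderiv ℝ (fun y => q ((y - x₀) i)) y (EuclideanSpace.single j 1))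
        = fun y => q' ((y - x₀) i) * (if i = j then 1 else 0) := by
      funext y
      have := ((h1 _).comp_hasFDerivAt y (hg y)).fderiv
      rw [show (fun y => q ((y - x₀) i)) = q ∘ fun y : Euc N => (y - x₀) i from rfl, this]
      simp
    rw [e1]
    have h5 : HasFDerivAt (fun y : Euc N => q' ((y - x₀) i) * (if i = j then (1 : ℝ) else 0)) _ x :=
      (h2.comp_hasFDerivAt x (hg x)).mul_const (if i = j then (1 : ℝ) else 0)
    rw [h5.fderiv]
    by_cases h : i = j <;> simp [h]
  unfold lap
  rw [Finset.sum_congr rfl fun i _ => key i]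
  simp

/-- Reflection of the `i`-th coordinate at `x₀`. -/
def coordReflect {N : ℕ} (x₀ : Euc N) (i : Fin N) (y : Euc N) : Euc N :=
  y - (2 * (y - x₀) i) • EuclideanSpace.single i (1 : ℝ)

theorem coordReflect_apply_same {N : ℕ} (x₀ : Euc N) (i : Fin N) (y : Euc N) :
    (coordReflect x₀ i y - x₀) i = -(y - x₀) i := by
  simp [coordReflect]; ring

theorem norm_coordReflect_sub {N : ℕ} (x₀ : Euc N) (i : Fin N) (y : Euc N) :
    ‖coordReflect x₀ i y - x₀‖ = ‖y - x₀‖ := by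
  rw [EuclideanSpace.norm_eq, EuclideanSpace.norm_eq]
  congr 1
  refine Finset.sum_congr rfl fun j _ => ?_
  by_cases h : j = i
  · subst h
    rw [coordReflect_apply_same, norm_neg]
  · simp [coordReflect, h]

theorem hasFDerivAt_coordReflect {N : ℕ} (x₀ : Euc N) (i : Fin N) (y : Euc N) :
    HasFDerivAt (coordReflect x₀ i) (ContinuousLinearMap.id ℝ (Euc N) -
      ((2 : ℝ) • (EuclideanSpace.proj i : Euc N →L[ℝ] ℝ)).smulRight
        (EuclideanSpace.single i (1 : ℝ))) y := by
  have h : HasFDerivAt (fun y : Euc N => 2 * (y - x₀) i)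
      ((2 : ℝ) • (EuclideanSpace.proj i : Euc N →L[ℝ] ℝ)) y := by
    have := (((EuclideanSpace.proj i : Euc N →L[ℝ] ℝ).hasFDerivAt (x := y)).sub_const
      (x₀ i)).const_mul 2
    simpa using this
  exact (hasFDerivAt_id y).sub (h.smul_const _)

theorem contDiff_coordReflect {N : ℕ} (x₀ : Euc N) (i : Fin N) :
    ContDiff ℝ 2 (coordReflect x₀ i) := by
  unfold coordReflect
  have : ContDiff ℝ 2 fun y : Euc N => (y - x₀) i :=
    (EuclideanSpace.proj i : Euc N →L[ℝ] ℝ).contDiff.comp (contDiff_id.sub contDiff_const)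
  exact contDiff_id.sub ((contDiff_const.mul this).smul contDiff_const)

theorem lap_comp_coordReflect {N : ℕ} {u : Euc N → ℝ} {x₀ x : Euc N} (i : Fin N)
    (hu : ContDiffAt ℝ 2 u (coordReflect x₀ i x)) :
    lap (fun y => u (coordReflect x₀ i y)) x = lap u (coordReflect x₀ i x) := by
  unfold lap
  refine Finset.sum_congr rfl fun j _ => ?_
  set e : Euc N := EuclideanSpace.single j 1
  set σ : ℝ := if i = j then -1 else 1 with hσ
  have hσ2 : σ * σ = 1 := by rw [hσ]; split_ifs <;> norm_num
  have hL : (ContinuousLinearMap.id ℝ (Euc N) -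
      ((2 : ℝ) • (EuclideanSpace.proj i : Euc N →L[ℝ] ℝ)).smulRight
        (EuclideanSpace.single i (1 : ℝ))) e = σ • e := by
    by_cases h : i = j
    · subst h
      ext k
      by_cases hk : k = i
      · simp [σ, e, hk]; norm_num
      · simp [σ, e, hk]
    · simp [σ, e, h]
  have hcont : Tendsto (coordReflect x₀ i) (𝓝 x) (𝓝 (coordReflect x₀ i x)) :=
    (hasFDerivAt_coordReflect x₀ i x).continuousAt
  have e1 : (fun y => fderiv ℝ (fun y => u (coordReflect x₀ i y)) y e) =ᶠ[𝓝 x]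
      fun y => σ * (fun z => fderiv ℝ u z e) (coordReflect x₀ i y) := by
    filter_upwards [hcont.eventually hu.eventually_differentiableAt_two] with y hy
    have := (hy.hasFDerivAt.comp y (hasFDerivAt_coordReflect x₀ i y)).fderiv
    rw [show (fun y => u (coordReflect x₀ i y)) = u ∘ coordReflect x₀ i from rfl, this,
      ContinuousLinearMap.comp_apply, hL]
    simp
  rw [e1.fderiv_eq]
  have h4 : HasFDerivAt ((fun z => fderiv ℝ u z e) ∘ coordReflect x₀ i) _ x :=
    ((hu.fderiv_apply_const e).differentiableAt (by norm_num)).hasFDerivAt.comp x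
    (hasFDerivAt_coordReflect x₀ i x)
  have h5 := (h4.const_mul σ).fderiv
  simp only [Function.comp_def] at h5
  rw [h5, _root_.smul_apply, ContinuousLinearMap.comp_apply, hL, map_smul, smul_smul,
    hσ2, one_smul]

/-- Interior gradient estimate for the Poisson equation, one-sided form. -/
theorem fderiv_single_le {N : ℕ} {u : Euc N → ℝ} {x₀ : Euc N} {d M F : ℝ} (hd : 0 < d)
    (hu : ∀ x ∈ Metric.closedBall x₀ d, ContDiffAt ℝ 2 u x)
    (hM : ∀ x ∈ Metric.closedBall x₀ d, |u x| ≤ M)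
    (hF : ∀ x ∈ Metric.closedBall x₀ d, |lap u x| ≤ F) (i : Fin N) :
    fderiv ℝ u x₀ (EuclideanSpace.single i 1) ≤ N * M / d + F * d / 2 := by
  have hx₀ : x₀ ∈ Metric.closedBall x₀ d := Metric.mem_closedBall_self hd.le
  have hM0 : 0 ≤ M := (abs_nonneg _).trans (hM _ hx₀)
  have hF0 : 0 ≤ F := (abs_nonneg _).trans (hF _ hx₀)
  suffices h : ∀ F', F < F' →
      fderiv ℝ u x₀ (EuclideanSpace.single i 1) ≤ N * M / d + F' * d / 2 by
    refine le_of_forall_pos_le_add fun η hη => ?_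
    have := h (F + 2 * η / d) (by have : 0 < 2 * η / d := by positivity
                                  linarith)
    refine this.trans (le_of_eq ?_)
    field_simp
    ring
  intro F' hF'
  set R := coordReflect x₀ i
  set A : ℝ := N * M / d ^ 2 + F' / 2
  have hF'0 : 0 ≤ F' := hF0.trans hF'.le
  have hA : 0 ≤ A := by positivity
  set φ : Euc N → ℝ := fun y => (1 / 2) * (u y - u (R y))
  set ψ : Euc N → ℝ := fun y => M / d ^ 2 * ‖y - x₀‖ ^ 2 + A * ((y - x₀) i * (d - (y - x₀) i))
  have hRmem : ∀ y ∈ Metric.closedBall x₀ d, R y ∈ Metric.closedBall x₀ d := by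
    intro y hy
    rw [mem_closedBall_iff_norm] at hy ⊢
    rwa [norm_coordReflect_sub]
  have huR : ∀ y ∈ Metric.closedBall x₀ d, ContDiffAt ℝ 2 (fun y => u (R y)) y := fun y hy =>
    (hu _ (hRmem y hy)).comp y (contDiff_coordReflect x₀ i).contDiffAt
  have hci : ContDiff ℝ 2 fun y : Euc N => (y - x₀) i :=
    (EuclideanSpace.proj i : Euc N →L[ℝ] ℝ).contDiff.comp (contDiff_id.sub contDiff_const)
  have hφc : ∀ y ∈ Metric.closedBall x₀ d, ContDiffAt ℝ 2 φ y := fun y hy =>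
    contDiffAt_const.mul ((hu y hy).sub (huR y hy))
  have hψ1 : ContDiff ℝ 2 fun y : Euc N => ‖y - x₀‖ ^ 2 :=
    (contDiff_id.sub contDiff_const).norm_sq ℝ
  have hψ2 : ContDiff ℝ 2 fun y : Euc N => (y - x₀) i * (d - (y - x₀) i) :=
    hci.mul (contDiff_const.sub hci)
  have hψc : ContDiff ℝ 2 ψ := (contDiff_const.mul hψ1).add (contDiff_const.mul hψ2)
  have hlapφ : ∀ y ∈ Metric.closedBall x₀ d, -F ≤ lap φ y := by
    intro y hy
    rw [lap_const_mul _ ((hu y hy).sub (huR y hy)), lap_sub (hu y hy) (huR y hy),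
      lap_comp_coordReflect i (hu _ (hRmem y hy))]
    have h1 := abs_le.1 (hF y hy)
    have h2 := abs_le.1 (hF _ (hRmem y hy))
    have : -(2 * F) ≤ lap u y - lap u (R y) := by linarith [h1.1, h2.2]
    linarith
  have hlapψ : ∀ y, lap ψ y = -F' := by
    intro y
    rw [lap_add (contDiff_const.mul hψ1).contDiffAt (contDiff_const.mul hψ2).contDiffAt,
      lap_const_mul _ hψ1.contDiffAt, lap_const_mul _ hψ2.contDiffAt,
      lap_radial (F := fun r => r) (F' := fun _ => 1) (F'' := 0)
        (Eventually.of_forall fun r => hasDerivAt_id r) (hasDerivAt_const _ _),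
      lap_coord (q := fun s => s * (d - s)) (q' := fun s => d - 2 * s) (q'' := -2) i]
    · simp only [A]; field_simp; ring
    · intro r
      have := (hasDerivAt_id r).mul ((hasDerivAt_id r).const_sub d)
      refine this.congr_deriv ?_
      simp; ring
    · have := ((hasDerivAt_id ((y - x₀) i)).const_mul 2).const_sub d
      refine this.congr_deriv ?_
      simp
  set K : Set (Euc N) := Metric.closedBall x₀ d ∩ {y | 0 ≤ (y - x₀) i}
  have hKc : IsCompact K :=
    (isCompact_closedBall x₀ d).inter_right (isClosed_le continuous_const hci.continuous)
  have hcont : ContinuousOn (fun y => ψ y - φ y) K := fun y hy =>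
    (hψc.continuous.continuousAt.sub (hφc y hy.1).continuousAt).continuousWithinAt
  have hK : ∀ y ∈ K, φ y ≤ ψ y := by
    obtain ⟨z, hz, hzmin⟩ := hKc.exists_isMinOn ⟨x₀, hx₀, by simp⟩ hcont
    have hz0 : 0 ≤ ψ z - φ z := by
      have hzi : (z - x₀) i ≤ d := by
        have h1 := PiLp.norm_apply_le (z - x₀) i
        have h2 := mem_closedBall_iff_norm.1 hz.1
        exact (le_abs_self _).trans (h1.trans h2)
      have hzi0 : 0 ≤ (z - x₀) i := hz.2
      have hA1 : 0 ≤ A * ((z - x₀) i * (d - (z - x₀) i)) :=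
        mul_nonneg hA (mul_nonneg hzi0 (by linarith))
      rcases hzi0.eq_or_lt with h0 | h0
      · have hRz : R z = z := by
          simp only [R, coordReflect]; rw [← h0]; simp
        have : φ z = 0 := by simp [φ, hRz]
        rw [this, sub_zero]
        exact add_nonneg (by positivity) hA1
      rcases (mem_closedBall_iff_norm.1 hz.1).eq_or_lt with h1 | h1
      · have hφM : φ z ≤ M := by
          have h1 := abs_le.1 (hM z hz.1)
          have h2 := abs_le.1 (hM _ (hRmem z hz.1))
          simp only [φ]; linarith [h1.2, h2.1]
        have : ψ z = M + A * ((z - x₀) i * (d - (z - x₀) i)) := by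
          simp only [ψ]; rw [h1]; field_simp
        linarith
      · exfalso
        have hloc : IsLocalMin (fun y => ψ y - φ y) z := by
          refine hzmin.isLocalMin ?_
          refine inter_mem (Metric.closedBall_mem_nhds_of_mem (mem_ball_iff_norm.2 h1)) ?_
          filter_upwards [hci.continuous.continuousAt.eventually (lt_mem_nhds h0)] with y hy
            using le_of_lt hy
        have h3 := lap_nonneg_of_isLocalMin (hψc.contDiffAt.sub (hφc z hz.1)) hloc
        rw [lap_sub hψc.contDiffAt (hφc z hz.1), hlapψ] at h3
        linarith [hlapφ z hz.1]
    intro y hy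
    have : ψ z - φ z ≤ ψ y - φ y := hzmin hy
    linarith
  -- compare the derivatives at `x₀` in direction `e_i`
  set e : Euc N := EuclideanSpace.single i 1
  have hline : HasDerivAt (fun t : ℝ => x₀ + t • e) e 0 := by
    simpa using ((hasDerivAt_id (0 : ℝ)).smul_const e).const_add x₀
  have hRline : ∀ t : ℝ, R (x₀ + t • e) = x₀ + (-t) • e := by
    intro t
    simp only [R, coordReflect, e]
    ext k
    by_cases hk : k = i
    · subst hk; simp; ring
    · simp [hk]
  have hline' : HasDerivAt (fun t : ℝ => x₀ + (-t) • e) (-e) 0 := by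
    simpa using ((hasDerivAt_id (0 : ℝ)).neg.smul_const e).const_add x₀
  have hux : HasFDerivAt u (fderiv ℝ u x₀) x₀ :=
    ((hu x₀ hx₀).differentiableAt (by norm_num)).hasFDerivAt
  have hφd : HasDerivAt (fun t : ℝ => φ (x₀ + t • e)) (fderiv ℝ u x₀ e) 0 := by
    have h1 : HasDerivAt (fun t : ℝ => u (x₀ + t • e)) (fderiv ℝ u x₀ e) 0 :=
      HasFDerivAt.comp_hasDerivAt (0 : ℝ) (by simpa using hux) hline
    have h2 : HasDerivAt (fun t : ℝ => u (x₀ + (-t) • e)) (fderiv ℝ u x₀ (-e)) 0 :=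
      HasFDerivAt.comp_hasDerivAt (0 : ℝ) (by simpa using hux) hline'
    have h3 := (h1.sub h2).const_mul (1 / 2 : ℝ)
    have h4 : (fun t : ℝ => φ (x₀ + t • e))
        = fun t => 1 / 2 * (u (x₀ + t • e) - u (x₀ + (-t) • e)) := by
      funext t; simp only [φ]; rw [hRline]
    rw [h4]
    refine h3.congr_deriv ?_
    simp; ring
  have hψd : HasDerivAt (fun t : ℝ => M / d ^ 2 * t ^ 2 + A * (t * (d - t)))
      (A * d) 0 := by
    have := (((hasDerivAt_id (0 : ℝ)).pow 2).const_mul (M / d ^ 2)).add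
      (((hasDerivAt_id (0 : ℝ)).mul ((hasDerivAt_id (0 : ℝ)).const_sub d)).const_mul A)
    refine this.congr_deriv ?_
    simp
  have hψline : ∀ t : ℝ, ψ (x₀ + t • e) = M / d ^ 2 * t ^ 2 + A * (t * (d - t)) := by
    intro t; simp [ψ, e, norm_smul]
  have hcmp : ∀ᶠ t in 𝓝[>] (0 : ℝ), slope (fun t : ℝ => φ (x₀ + t • e)) 0 t
      ≤ slope (fun t : ℝ => M / d ^ 2 * t ^ 2 + A * (t * (d - t))) 0 t := by
    filter_upwards [Ioo_mem_nhdsGT hd] with t ht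
    have hmem : x₀ + t • e ∈ K := by
      constructor
      · rw [mem_closedBall_iff_norm]
        simp [e, norm_smul, abs_of_pos ht.1, ht.2.le]
      · simp [e, ht.1.le]
    have h1 := hK _ hmem
    rw [hψline] at h1
    rw [slope_def_field, slope_def_field]
    have h0 : φ (x₀ + (0 : ℝ) • e) = 0 := by
      simp only [φ]; rw [hRline]; simp
    rw [h0]
    have : 0 < t - 0 := by simpa using ht.1
    gcongr
    simp
  have hmono : 𝓝[>] (0 : ℝ) ≤ 𝓝[≠] 0 := nhdsWithin_mono _ fun t (ht : 0 < t) => ne_of_gt ht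
  have h5 := le_of_tendsto_of_tendsto
    ((hasDerivAt_iff_tendsto_slope.1 hφd).mono_left hmono)
    ((hasDerivAt_iff_tendsto_slope.1 hψd).mono_left hmono) hcmp
  refine h5.trans (le_of_eq ?_)
  simp only [A]; field_simp

/-- Interior gradient estimate for the Poisson equation. -/
theorem abs_fderiv_single_le {N : ℕ} {u : Euc N → ℝ} {x₀ : Euc N} {d M F : ℝ} (hd : 0 < d)
    (hu : ∀ x ∈ Metric.closedBall x₀ d, ContDiffAt ℝ 2 u x)
    (hM : ∀ x ∈ Metric.closedBall x₀ d, |u x| ≤ M)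
    (hF : ∀ x ∈ Metric.closedBall x₀ d, |lap u x| ≤ F) (i : Fin N) :
    |fderiv ℝ u x₀ (EuclideanSpace.single i 1)| ≤ N * M / d + F * d / 2 := by
  refine abs_le'.2 ⟨fderiv_single_le hd hu hM hF i, ?_⟩
  have h := fderiv_single_le (u := fun y => (-1) * u y) hd
    (fun x hx => contDiffAt_const.mul (hu x hx)) (M := M) (F := F)
    (fun x hx => by simpa using hM x hx)
    (fun x hx => by rw [lap_const_mul _ (hu x hx)]; simpa using hF x hx) i
  have hx₀ : x₀ ∈ Metric.closedBall x₀ d := Metric.mem_closedBall_self hd.le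
  rw [fderiv_const_mul ((hu x₀ hx₀).differentiableAt (by norm_num))] at h
  simpa using h

/-- Positivity of a nonnegative superharmonic function propagates inside a ball. -/
theorem pos_of_superharmonic_ball {N : ℕ} {v : Euc N → ℝ} {y z : Euc N} {r : ℝ}
    (hv : ∀ x ∈ Metric.closedBall y r, ContDiffAt ℝ 2 v x)
    (h0 : ∀ x ∈ Metric.closedBall y r, 0 ≤ v x)
    (hlap : ∀ x ∈ Metric.closedBall y r, lap v x ≤ 0) (hy : 0 < v y)
    (hz : z ∈ Metric.ball y r) : 0 < v z := by
  have hr : 0 < r := Metric.pos_of_mem_ball hz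
  have hyc : ContinuousAt v y := (hv y (Metric.mem_closedBall_self hr.le)).continuousAt
  obtain ⟨s', hs'0, hs'⟩ := Metric.eventually_nhds_iff.1
    (hyc.eventually (lt_mem_nhds (half_lt_self hy)))
  set s := min (s' / 2) (r / 2)
  have hs0 : 0 < s := by positivity
  have hsr : s < r := (min_le_right _ _).trans_lt (half_lt_self hr)
  have hsm : ∀ x, ‖x - y‖ ≤ s → v y / 2 < v x := fun x hx => by
    refine hs' ?_
    rw [dist_eq_norm]
    exact (hx.trans (min_le_left _ _)).trans_lt (half_lt_self hs'0)
  rcases le_or_gt ‖z - y‖ s with hzs | hzs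
  · linarith [hsm z hzs]
  set k : ℝ := (N + 1) / s ^ 2
  have hk : 0 < k := by positivity
  set c := v y / 2
  have hc : 0 < c := by positivity
  set h : Euc N → ℝ := fun x => c * (Real.exp (-k * ‖x - y‖ ^ 2) - Real.exp (-k * r ^ 2))
  have hE : ContDiff ℝ 2 fun x : Euc N => Real.exp (-k * ‖x - y‖ ^ 2) :=
    (contDiff_const.mul ((contDiff_id.sub contDiff_const).norm_sq ℝ)).exp
  have hE' : ContDiff ℝ 2 fun x : Euc N => Real.exp (-k * ‖x - y‖ ^ 2) - Real.exp (-k * r ^ 2) :=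
    hE.sub contDiff_const
  have hhc : ContDiff ℝ 2 h := contDiff_const.mul hE'
  have hlaph : ∀ x : Euc N, s ≤ ‖x - y‖ → 0 < lap h x := by
    intro x hx
    have hd : ∀ r, HasDerivAt (fun r => Real.exp (-k * r)) (-k * Real.exp (-k * r)) r := fun r => by
      have := ((hasDerivAt_id r).const_mul (-k)).exp
      refine this.congr_deriv ?_
      simp; ring
    rw [lap_const_mul _ hE'.contDiffAt, lap_sub hE.contDiffAt contDiffAt_const, lap_const,
      lap_radial (F := fun r => Real.exp (-k * r)) (F' := fun r => -k * Real.exp (-k * r))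
        (Eventually.of_forall hd) ((hd _).const_mul (-k))]
    have h1 : s ^ 2 ≤ ‖x - y‖ ^ 2 := by gcongr
    have h2 : (N : ℝ) + 1 ≤ k * ‖x - y‖ ^ 2 := by
      calc (N : ℝ) + 1 = k * s ^ 2 := by simp only [k]; field_simp
        _ ≤ _ := by gcongr
    have h3 := Real.exp_pos (-k * ‖x - y‖ ^ 2)
    have hN : (0 : ℝ) ≤ N := Nat.cast_nonneg _
    have : 4 * ‖x - y‖ ^ 2 * (-k * (-k * Real.exp (-k * ‖x - y‖ ^ 2)))
        + 2 * N * (-k * Real.exp (-k * ‖x - y‖ ^ 2)) - 0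
        = k * Real.exp (-k * ‖x - y‖ ^ 2) * (4 * (k * ‖x - y‖ ^ 2) - 2 * N) := by ring
    rw [this]
    have : 0 < 4 * (k * ‖x - y‖ ^ 2) - 2 * N := by linarith
    positivity
  set K : Set (Euc N) := Metric.closedBall y r ∩ {x | s ≤ ‖x - y‖}
  have hnc : Continuous fun x : Euc N => ‖x - y‖ := by fun_prop
  have hKc : IsCompact K :=
    (isCompact_closedBall y r).inter_right (isClosed_le continuous_const hnc)
  have hzK : z ∈ K := ⟨Metric.ball_subset_closedBall hz, hzs.le⟩
  obtain ⟨w, hw, hwmin⟩ := hKc.exists_isMinOn ⟨z, hzK⟩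
    (f := fun x => v x - h x) (fun x hx =>
      ((hv x hx.1).continuousAt.sub hhc.continuous.continuousAt).continuousWithinAt)
  have hw0 : 0 ≤ v w - h w := by
    rcases (show s ≤ ‖w - y‖ from hw.2).eq_or_lt with h1 | h1
    · have h2 := hsm w h1.symm.le
      have : h w ≤ c * 1 := by
        simp only [h]
        gcongr
        have : Real.exp (-k * ‖w - y‖ ^ 2) ≤ 1 := Real.exp_le_one_iff.2 (by
          have : 0 ≤ k * ‖w - y‖ ^ 2 := by positivity
          linarith)
        linarith [Real.exp_pos (-k * r ^ 2)]
      linarith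
    rcases (mem_closedBall_iff_norm.1 hw.1).eq_or_lt with h2 | h2
    · have : h w = 0 := by simp only [h]; rw [h2]; ring
      rw [this, sub_zero]; exact h0 w hw.1
    · exfalso
      have hloc : IsLocalMin (fun x => v x - h x) w := by
        refine hwmin.isLocalMin ?_
        refine inter_mem (Metric.closedBall_mem_nhds_of_mem (mem_ball_iff_norm.2 h2)) ?_
        filter_upwards [hnc.continuousAt.eventually (lt_mem_nhds h1)] with x hx using le_of_lt hx
      have h3 := lap_nonneg_of_isLocalMin ((hv w hw.1).sub hhc.contDiffAt) hloc
      rw [lap_sub (hv w hw.1) hhc.contDiffAt] at h3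
      linarith [hlap w hw.1, hlaph w hw.2]
  have h4 : v w - h w ≤ v z - h z := hwmin hzK
  have h5 : 0 < h z := by
    have h6 := mem_ball_iff_norm.1 hz
    have : Real.exp (-k * r ^ 2) < Real.exp (-k * ‖z - y‖ ^ 2) := by
      rw [Real.exp_lt_exp, neg_mul, neg_mul, neg_lt_neg_iff]
      gcongr
    exact mul_pos hc (by linarith)
  linarith

/-- Strong maximum principle. -/
theorem pos_of_superharmonic {N : ℕ} {Ω : Set (Euc N)} {v : Euc N → ℝ} (hΩ : IsOpen Ω)
    (hconn : IsPreconnected Ω) (hv : ∀ x ∈ Ω, ContDiffAt ℝ 2 v x) (h0 : ∀ x ∈ Ω, 0 ≤ v x)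
    (hlap : ∀ x ∈ Ω, lap v x ≤ 0) {x₁ : Euc N} (hx₁ : x₁ ∈ Ω) (hx₁v : 0 < v x₁) :
    ∀ x ∈ Ω, 0 < v x := by
  have hc : ContinuousOn v Ω := fun x hx => (hv x hx).continuousAt.continuousWithinAt
  set S := Ω ∩ {x | 0 < v x}
  set Z := Ω ∩ {x | v x = 0}
  have hS : IsOpen S := hc.isOpen_inter_preimage hΩ isOpen_Ioi
  have hZ : IsOpen Z := by
    rw [Metric.isOpen_iff]
    rintro z ⟨hz, hvz⟩
    obtain ⟨ε, hε, hball⟩ := Metric.isOpen_iff.1 hΩ z hz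
    refine ⟨ε / 4, by positivity, fun y hy => ?_⟩
    have hsub : Metric.closedBall y (ε / 2) ⊆ Ω := fun x hx => hball (by
      rw [Metric.mem_ball] at hy ⊢
      rw [Metric.mem_closedBall] at hx
      linarith [dist_triangle x y z])
    have hyΩ : y ∈ Ω := hsub (Metric.mem_closedBall_self (by positivity))
    refine ⟨hyΩ, ?_⟩
    by_contra hne
    have hpos : 0 < v y := lt_of_le_of_ne (h0 y hyΩ) (Ne.symm hne)
    have := pos_of_superharmonic_ball (z := z) (fun x hx => hv x (hsub hx))
      (fun x hx => h0 x (hsub hx)) (fun x hx => hlap x (hsub hx)) hpos (by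
        rw [Metric.mem_ball, dist_comm]
        rw [Metric.mem_ball] at hy
        linarith)
    exact absurd hvz this.ne.symm
  intro x hx
  by_contra hne
  have hvx : v x = 0 := le_antisymm (not_lt.1 hne) (h0 x hx)
  obtain ⟨w, -, hw1, hw2⟩ := hconn S Z hS hZ (fun y hy => by
    rcases (h0 y hy).eq_or_lt with h | h
    · exact Or.inr ⟨hy, h.symm⟩
    · exact Or.inl ⟨hy, h⟩) ⟨x₁, hx₁, hx₁, hx₁v⟩ ⟨x, hx, hx, hvx⟩
  have h1 : 0 < v w := hw1.2
  have h2 : v w = 0 := hw2.2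
  linarith

/-- `C¹` test functions compactly supported in `Ω`. -/
structure IsTest {N : ℕ} (Ω : Set (Euc N)) (φ : Euc N → ℝ) : Prop where
  contDiff : ContDiff ℝ 1 φ
  compact : HasCompactSupport φ
  subset : tsupport φ ⊆ Ω

theorem IsTest.eq_zero {N : ℕ} {Ω : Set (Euc N)} {φ : Euc N → ℝ} (h : IsTest Ω φ) {x : Euc N}
    (hx : x ∉ Ω) : φ x = 0 :=
  image_eq_zero_of_notMem_tsupport fun hx' => hx (h.subset hx')

theorem IsTest.fderiv_eq_zero {N : ℕ} {Ω : Set (Euc N)} {φ : Euc N → ℝ} (h : IsTest Ω φ)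
    {x : Euc N} (hx : x ∉ Ω) : fderiv ℝ φ x = 0 :=
  image_eq_zero_of_notMem_tsupport fun hx' => hx (h.subset (tsupport_fderiv_subset ℝ hx'))

theorem IsTest.differentiable {N : ℕ} {Ω : Set (Euc N)} {φ : Euc N → ℝ} (h : IsTest Ω φ) :
    Differentiable ℝ φ := h.contDiff.differentiable (by norm_num)

theorem IsTest.continuous_fderiv {N : ℕ} {Ω : Set (Euc N)} {φ : Euc N → ℝ} (h : IsTest Ω φ) :
    Continuous (fderiv ℝ φ) := h.contDiff.continuous_fderiv (by norm_num)

/-- The product of a function continuous on `Ω` and a continuous function with compact support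
in `Ω` is continuous with compact support. -/
theorem continuous_mul_of_tsupport_subset {N : ℕ} {Ω : Set (Euc N)} (hΩ : IsOpen Ω)
    {a b : Euc N → ℝ} (ha : ContinuousOn a Ω) (hb : Continuous b) (hbΩ : tsupport b ⊆ Ω) :
    Continuous fun x => a x * b x := by
  refine continuous_of_tsupport fun x hx => ?_
  have hx' : x ∈ Ω := hbΩ (tsupport_mul_subset_right hx)
  exact (ha.continuousAt (hΩ.mem_nhds hx')).mul hb.continuousAt

theorem integrable_mul_of_tsupport_subset {N : ℕ} {Ω : Set (Euc N)} (hΩ : IsOpen Ω)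
    {a b : Euc N → ℝ} (ha : ContinuousOn a Ω) (hb : Continuous b) (hbc : HasCompactSupport b)
    (hbΩ : tsupport b ⊆ Ω) : Integrable fun x => a x * b x :=
  (continuous_mul_of_tsupport_subset hΩ ha hb hbΩ).integrable_of_hasCompactSupport hbc.mul_left

theorem IsTest.fderiv_apply {N : ℕ} {Ω : Set (Euc N)} {φ : Euc N → ℝ} (h : IsTest Ω φ)
    (v : Euc N) : Continuous (fun x => fderiv ℝ φ x v) ∧
      HasCompactSupport (fun x => fderiv ℝ φ x v) ∧ tsupport (fun x => fderiv ℝ φ x v) ⊆ Ω :=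
  ⟨h.continuous_fderiv.clm_apply continuous_const, h.compact.fderiv_apply ℝ v,
    (tsupport_fderiv_apply_subset ℝ v).trans h.subset⟩

/-- Integration by parts against a test function, in one coordinate direction. -/
theorem IsTest.integral_mul_fderiv {N : ℕ} {Ω : Set (Euc N)} (hΩ : IsOpen Ω) {a χ : Euc N → ℝ}
    (hχ : IsTest Ω χ) (ha : ∀ x ∈ Ω, ContDiffAt ℝ 1 a x) (v : Euc N) :
    Integrable (fun x => a x * fderiv ℝ χ x v) ∧ Integrable (fun x => fderiv ℝ a x v * χ x) ∧
    ∫ x, a x * fderiv ℝ χ x v = - ∫ x, fderiv ℝ a x v * χ x := by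
  have hac : ContinuousOn a Ω := fun x hx => (ha x hx).continuousAt.continuousWithinAt
  have hac' : ContinuousOn (fun x => fderiv ℝ a x v) Ω := fun x hx =>
    (((ha x hx).fderiv_right (m := 0) (by norm_num)).continuousAt.clm_apply
      continuousAt_const).continuousWithinAt
  obtain ⟨h1, h2, h3⟩ := hχ.fderiv_apply v
  have i1 := integrable_mul_of_tsupport_subset hΩ hac h1 h2 h3
  have i2 := integrable_mul_of_tsupport_subset hΩ hac' hχ.contDiff.continuous hχ.compact hχ.subset
  exact ⟨i1, i2, integral_mul_fderiv_eq_neg_fderiv_mul_of_integrable i2 i1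
    (integrable_mul_of_tsupport_subset hΩ hac hχ.contDiff.continuous hχ.compact hχ.subset)
    (fun x hx => (ha x (hχ.subset hx)).differentiableAt (by norm_num))
    (fun x _ => hχ.differentiable x)⟩

theorem inner_gradient {N : ℕ} (u v : Euc N → ℝ) (x : Euc N) :
    inner ℝ (gradient u x) (gradient v x)
      = ∑ i, fderiv ℝ u x (EuclideanSpace.single i 1) * fderiv ℝ v x (EuclideanSpace.single i 1) := by
  have h : ∀ (w : Euc N → ℝ) i, gradient w x i = fderiv ℝ w x (EuclideanSpace.single i 1) := by
    intro w i
    have : inner ℝ (gradient w x) (EuclideanSpace.single i (1 : ℝ))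
        = fderiv ℝ w x (EuclideanSpace.single i 1) := by
      rw [gradient, InnerProductSpace.toDual_symm_apply]
    rw [← this, EuclideanSpace.inner_single_right]; simp
  rw [PiLp.inner_apply]
  refine Finset.sum_congr rfl fun i _ => ?_
  rw [h, h]; simp [mul_comm]

theorem norm_gradient {N : ℕ} (u : Euc N → ℝ) (x : Euc N) : ‖gradient u x‖ = ‖fderiv ℝ u x‖ := by
  rw [gradient, LinearIsometryEquiv.norm_map]

/-- Green's first identity against a test function. -/
theorem IsTest.integral_inner_gradient {N : ℕ} {Ω : Set (Euc N)} (hΩ : IsOpen Ω) {U χ : Euc N → ℝ}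
    (hχ : IsTest Ω χ) (hU : ∀ x ∈ Ω, ContDiffAt ℝ 2 U x) :
    Integrable (fun x => inner ℝ (gradient U x) (gradient χ x)) ∧
    Integrable (fun x => lap U x * χ x) ∧
    ∫ x, inner ℝ (gradient U x) (gradient χ x) = - ∫ x, lap U x * χ x := by
  have h := fun i : Fin N => hχ.integral_mul_fderiv hΩ
    (fun x hx => (hU x hx).fderiv_apply_const (EuclideanSpace.single i 1))
    (EuclideanSpace.single i 1)
  simp_rw [inner_gradient, lap, Finset.sum_mul]
  refine ⟨integrable_finsetSum _ fun i _ => (h i).1,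
    integrable_finsetSum _ fun i _ => (h i).2.1, ?_⟩
  rw [integral_finsetSum _ fun i _ => (h i).1, integral_finsetSum _ fun i _ => (h i).2.1,
    ← Finset.sum_neg_distrib]
  exact Finset.sum_congr rfl fun i _ => (h i).2.2

theorem HasCompactSupport.sq_norm {N : ℕ} {E : Type*} [NormedAddCommGroup E] {φ : Euc N → E}
    (h : HasCompactSupport φ) : HasCompactSupport fun x => ‖φ x‖ ^ 2 :=
  h.mono fun x hx h0 => hx (by
    change ‖φ x‖ ^ 2 = 0
    rw [h0, norm_zero, zero_pow two_ne_zero])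

theorem HasCompactSupport.sq_real {N : ℕ} {φ : Euc N → ℝ}
    (h : HasCompactSupport φ) : HasCompactSupport fun x => φ x ^ 2 :=
  h.mono fun x hx h0 => hx (by
    change φ x ^ 2 = 0
    rw [h0, zero_pow two_ne_zero])

theorem IsTest.integrable_sq {N : ℕ} {Ω : Set (Euc N)} {φ : Euc N → ℝ} (h : IsTest Ω φ) :
    Integrable fun x => φ x ^ 2 := by
  refine (h.contDiff.continuous.pow 2).integrable_of_hasCompactSupport ?_
  exact h.compact.sq_real

theorem IsTest.integrable_fderiv_sq {N : ℕ} {Ω : Set (Euc N)} {φ : Euc N → ℝ} (h : IsTest Ω φ) :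
    Integrable fun x => ‖fderiv ℝ φ x‖ ^ 2 := by
  refine (h.continuous_fderiv.norm.pow 2).integrable_of_hasCompactSupport ?_
  exact (h.compact.fderiv ℝ).sq_norm

/-- The Poincaré inequality on a bounded set. -/
theorem IsTest.poincare {N : ℕ} {Ω : Set (Euc N)} (hΩ : IsOpen Ω) {φ : Euc N → ℝ}
    (h : IsTest Ω φ) (i : Fin N) {R : ℝ} (hR : ∀ x ∈ Ω, ‖x‖ ≤ R) :
    ∫ x, φ x ^ 2 ≤ 4 * R ^ 2 * ∫ x, ‖fderiv ℝ φ x‖ ^ 2 := by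
  set e : Euc N := EuclideanSpace.single i 1
  have hd : ∀ x, HasFDerivAt (fun x => φ x ^ 2) ((2 * φ x) • fderiv ℝ φ x) x := fun x => by
    have := (h.differentiable x).hasFDerivAt.pow 2
    simpa using this
  have h2 : IsTest Ω fun x => φ x ^ 2 :=
    ⟨h.contDiff.pow 2, h.compact.sq_real,
      (closure_mono fun x hx => by
        rw [Function.mem_support] at hx ⊢
        exact fun h0 => hx (by simp [h0])).trans h.subset⟩
  obtain ⟨i1, i2, i3⟩ := h2.integral_mul_fderiv hΩ (a := fun x : Euc N => x i)
    (fun x _ => (EuclideanSpace.proj i : Euc N →L[ℝ] ℝ).contDiff.contDiffAt) e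
  have e1 : ∀ x : Euc N, fderiv ℝ (fun x : Euc N => x i) x e = 1 := fun x => by
    have := (EuclideanSpace.proj i : Euc N →L[ℝ] ℝ).hasFDerivAt (x := x)
    rw [show (fun x : Euc N => x i) = (EuclideanSpace.proj i : Euc N →L[ℝ] ℝ) from rfl, this.fderiv]
    simp [e]
  simp only [e1, one_mul, (hd _).fderiv] at i1 i2 i3
  have h4 : ∫ x, φ x ^ 2 ≤ ∫ x, (1 / 2 * φ x ^ 2 + 2 * R ^ 2 * ‖fderiv ℝ φ x‖ ^ 2) := by
    rw [← neg_neg (∫ x, φ x ^ 2), ← i3, ← integral_neg]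
    refine integral_mono i1.neg
      ((h.integrable_sq.const_mul _).add (h.integrable_fderiv_sq.const_mul _)) fun x => ?_
    simp only [smul_apply, smul_eq_mul]
    by_cases hx : x ∈ Ω
    · have h5 : |x i| ≤ R := (PiLp.norm_apply_le x i).trans (hR x hx)
      have h6 : |fderiv ℝ φ x e| ≤ ‖fderiv ℝ φ x‖ := by
        simpa [e] using (fderiv ℝ φ x).le_opNorm e
      set D := ‖fderiv ℝ φ x‖
      have h7 : |x i * fderiv ℝ φ x e| ≤ R * D := by
        rw [abs_mul]; gcongr; exact (abs_nonneg _).trans h5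
      have h8 : (x i * fderiv ℝ φ x e) ^ 2 ≤ (R * D) ^ 2 := by
        rw [← sq_abs]; gcongr
      nlinarith [sq_nonneg (φ x + 2 * (x i * fderiv ℝ φ x e))]
    · simp [h.eq_zero hx, h.fderiv_eq_zero hx]
  rw [integral_add (h.integrable_sq.const_mul _) (h.integrable_fderiv_sq.const_mul _),
    integral_const_mul, integral_const_mul] at h4
  linarith

/-- Test functions can be approximated in `C¹` by smooth ones. -/
theorem IsTest.exists_smooth_approx {N : ℕ} {Ω : Set (Euc N)} (hΩ : IsOpen Ω) {ψ : Euc N → ℝ}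
    (h : IsTest Ω ψ) {η : ℝ} (hη : 0 < η) :
    ∃ φ, ContDiff ℝ (⊤ : ℕ∞) φ ∧ IsTest Ω φ ∧ (∀ x, |φ x - ψ x| ≤ η) ∧
      ∀ x, ‖fderiv ℝ φ x - fderiv ℝ ψ x‖ ≤ η := by
  obtain ⟨δ₁, hδ₁, h1⟩ := Metric.uniformContinuous_iff.1
    (h.compact.uniformContinuous_of_continuous h.contDiff.continuous) η hη
  obtain ⟨δ₂, hδ₂, h2⟩ := Metric.uniformContinuous_iff.1
    ((h.compact.fderiv ℝ).uniformContinuous_of_continuous h.continuous_fderiv) η hη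
  obtain ⟨δ₃, hδ₃, h3⟩ := h.compact.isCompact.exists_cthickening_subset_open hΩ h.subset
  set δ := min δ₁ (min δ₂ δ₃)
  have hδ : 0 < δ := by positivity
  let ρ : ContDiffBump (0 : Euc N) := ⟨δ / 2, δ, half_pos hδ, half_lt_self hδ⟩
  set φ : Euc N → ℝ := convolution (ρ.normed volume) ψ (ContinuousLinearMap.lsmul ℝ ℝ) volume
  have hρint : LocallyIntegrable (ρ.normed (volume : Measure (Euc N))) volume :=
    ρ.integrable_normed.locallyIntegrable
  have hφs : ContDiff ℝ (⊤ : ℕ∞) φ :=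
    ρ.hasCompactSupport_normed.contDiff_convolution_left _ ρ.contDiff_normed
      h.contDiff.continuous.locallyIntegrable
  have hφd : ∀ x, fderiv ℝ φ x
      = convolution (ρ.normed volume) (fderiv ℝ ψ) (ContinuousLinearMap.lsmul ℝ ℝ) volume x := by
    intro x
    rw [(h.compact.hasFDerivAt_convolution_right (ContinuousLinearMap.lsmul ℝ ℝ) hρint
      h.contDiff x).fderiv]
    unfold convolution
    refine integral_congr_ae (Eventually.of_forall fun t => ?_)
    ext v
    simp [ContinuousLinearMap.precompR_apply]
  refine ⟨φ, hφs, ⟨hφs.of_le (by exact_mod_cast le_top), ρ.hasCompactSupport_normed.convolution _ h.compact,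
    ?_⟩, fun x => ?_, fun x => ?_⟩
  · refine (closure_minimal ?_ Metric.isClosed_cthickening).trans h3
    refine (support_convolution_subset _).trans ?_
    rintro _ ⟨a, ha, b, hb, rfl⟩
    rw [ρ.support_normed_eq] at ha
    refine Metric.mem_cthickening_of_dist_le _ b _ _ (subset_tsupport _ hb) ?_
    rw [mem_ball_zero_iff] at ha
    simp only [dist_eq_norm, add_sub_cancel_right]
    exact (ha.trans_le ((min_le_right _ _).trans (min_le_right _ _))).le
  · rw [← Real.dist_eq]
    refine ρ.dist_normed_convolution_le h.contDiff.continuous.aestronglyMeasurable fun y hy => ?_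
    exact (h1 (hy.trans_le (min_le_left _ _))).le
  · rw [← dist_eq_norm, hφd]
    refine ρ.dist_normed_convolution_le h.continuous_fderiv.aestronglyMeasurable fun y hy => ?_
    exact (h2 (hy.trans_le ((min_le_right _ _).trans (min_le_left _ _)))).le

/-- The set of Rayleigh quotients defining the first eigenvalue. -/
theorem firstEig_le_ratio {N : ℕ} {Ω : Set (Euc N)} {φ : Euc N → ℝ}
    (hs : ContDiff ℝ (⊤ : ℕ∞) φ) (h : IsTest Ω φ) :
    firstEig Ω * ∫ x, φ x ^ 2 ≤ ∫ x, ‖fderiv ℝ φ x‖ ^ 2 := by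
  by_cases h0 : φ = 0
  · simp [h0]
  have hle : firstEig Ω ≤ (∫ x, ‖fderiv ℝ φ x‖ ^ 2) / ∫ x, φ x ^ 2 := by
    refine csInf_le ⟨0, ?_⟩ ⟨φ, hs, h.compact, h.subset, h0, rfl⟩
    rintro r ⟨ψ, -, -, -, -, rfl⟩
    positivity
  have hpos : 0 ≤ ∫ x, φ x ^ 2 := by positivity
  rcases hpos.eq_or_lt with hp | hp
  · rw [← hp, mul_zero]; positivity
  · rwa [le_div_iff₀ hp] at hle

theorem IsTest.integral_sq_pos {N : ℕ} {Ω : Set (Euc N)} {φ : Euc N → ℝ} (h : IsTest Ω φ)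
    (h0 : φ ≠ 0) : 0 < ∫ x, φ x ^ 2 := by
  obtain ⟨x, hx⟩ := Function.ne_iff.1 h0
  refine (h.contDiff.continuous.pow 2).integral_pos_of_hasCompactSupport_nonneg_nonzero ?_ ?_
    (x := x) ?_
  · exact h.compact.sq_real
  · exact fun y => sq_nonneg _
  · simpa using hx

theorem exists_isTest {N : ℕ} {Ω : Set (Euc N)} (hΩ : IsOpen Ω) (hne : Ω.Nonempty) :
    ∃ φ, ContDiff ℝ (⊤ : ℕ∞) φ ∧ IsTest Ω φ ∧ φ ≠ 0 := by
  obtain ⟨x, hx⟩ := hne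
  obtain ⟨φ, h1, h2, h3, -, h4⟩ := exists_contDiff_tsupport_subset (n := (⊤ : ℕ∞)) (hΩ.mem_nhds hx)
  refine ⟨φ, h3, ⟨h3.of_le (by exact_mod_cast le_top), h2, h1⟩, fun h => ?_⟩
  simp [h] at h4

theorem firstEig_pos {N : ℕ} {Ω : Set (Euc N)} (hN : 2 ≤ N) (hΩ : IsOpen Ω) (hne : Ω.Nonempty)
    (hb : Bornology.IsBounded Ω) : 0 < firstEig Ω := by
  obtain ⟨R, hR0, hR⟩ := hb.exists_pos_norm_le
  refine lt_of_lt_of_le (show 0 < 1 / (4 * R ^ 2) by positivity) (le_csInf ?_ ?_)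
  · obtain ⟨φ, h1, h2, h3⟩ := exists_isTest hΩ hne
    exact ⟨_, φ, h1, h2.compact, h2.subset, h3, rfl⟩
  · rintro r ⟨φ, h1, h2, h3, h4, rfl⟩
    have h : IsTest Ω φ := ⟨h1.of_le (by exact_mod_cast le_top), h2, h3⟩
    have := h.poincare hΩ ⟨0, by omega⟩ hR
    rw [div_le_div_iff₀ (by positivity) (h.integral_sq_pos h4)]
    linarith

theorem exists_ratio_lt {N : ℕ} {Ω : Set (Euc N)} (hΩ : IsOpen Ω) (hne : Ω.Nonempty) {c : ℝ}
    (hc : firstEig Ω < c) : ∃ φ, ContDiff ℝ (⊤ : ℕ∞) φ ∧ IsTest Ω φ ∧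
      0 < ∫ x, φ x ^ 2 ∧ ∫ x, ‖fderiv ℝ φ x‖ ^ 2 < c * ∫ x, φ x ^ 2 := by
  obtain ⟨r, ⟨φ, h1, h2, h3, h4, rfl⟩, hr⟩ := exists_lt_of_csInf_lt (by
    obtain ⟨φ, h1, h2, h3⟩ := exists_isTest hΩ hne
    exact ⟨_, φ, h1, h2.compact, h2.subset, h3, rfl⟩) hc
  have h : IsTest Ω φ := ⟨h1.of_le (by exact_mod_cast le_top), h2, h3⟩
  exact ⟨φ, h1, h, h.integral_sq_pos h4, (div_lt_iff₀ (h.integral_sq_pos h4)).1 hr⟩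

theorem IsTest.firstEig_mul_le {N : ℕ} {Ω : Set (Euc N)} (hΩ : IsOpen Ω)
    (hb : Bornology.IsBounded Ω) {ψ : Euc N → ℝ} (h : IsTest Ω ψ) :
    firstEig Ω * ∫ x, ψ x ^ 2 ≤ ∫ x, ‖fderiv ℝ ψ x‖ ^ 2 := by
  choose φ hs ht h1 h2 using fun n : ℕ => h.exists_smooth_approx hΩ (η := 1 / ((n : ℝ) + 1))
    (by positivity)
  have hη : ∀ n : ℕ, (1 : ℝ) / (n + 1) ≤ 1 := fun n => by
    rw [div_le_one (by positivity)]; linarith [(Nat.cast_nonneg n : (0 : ℝ) ≤ n)]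
  have hη0 : Tendsto (fun n : ℕ => (1 : ℝ) / (n + 1)) atTop (𝓝 0) :=
    tendsto_one_div_add_atTop_nhds_zero_nat
  have hvol : volume Ω < ⊤ := hb.measure_lt_top
  have : IsFiniteMeasure (volume.restrict Ω) := ⟨by simpa using hvol⟩
  have restr1 : ∀ {χ : Euc N → ℝ}, IsTest Ω χ → ∫ x, χ x ^ 2 = ∫ x in Ω, χ x ^ 2 := fun hχ =>
    (setIntegral_eq_integral_of_forall_compl_eq_zero fun x hx => by simp [hχ.eq_zero hx]).symm
  have restr2 : ∀ {χ : Euc N → ℝ}, IsTest Ω χ →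
      ∫ x, ‖fderiv ℝ χ x‖ ^ 2 = ∫ x in Ω, ‖fderiv ℝ χ x‖ ^ 2 := fun hχ =>
    (setIntegral_eq_integral_of_forall_compl_eq_zero fun x hx => by
      simp [hχ.fderiv_eq_zero hx]).symm
  obtain ⟨C, hC⟩ := h.contDiff.continuous.bounded_above_of_compact_support h.compact
  obtain ⟨C', hC'⟩ := h.continuous_fderiv.bounded_above_of_compact_support (h.compact.fderiv ℝ)
  have t1 : Tendsto (fun n => ∫ x in Ω, φ n x ^ 2) atTop (𝓝 (∫ x in Ω, ψ x ^ 2)) := by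
    refine tendsto_integral_of_dominated_convergence (fun _ => (C + 1) ^ 2)
      (fun n => ((ht n).contDiff.continuous.pow 2).aestronglyMeasurable) (integrable_const _)
      (fun n => Eventually.of_forall fun x => ?_) (Eventually.of_forall fun x => ?_)
    · rw [norm_pow]
      gcongr
      calc ‖φ n x‖ = ‖(φ n x - ψ x) + ψ x‖ := by ring_nf
        _ ≤ ‖φ n x - ψ x‖ + ‖ψ x‖ := norm_add_le _ _
        _ ≤ C + 1 := by
          have := (h1 n x).trans (hη n)
          rw [← Real.norm_eq_abs] at this
          linarith [hC x]
    · refine Tendsto.pow ?_ 2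
      rw [tendsto_iff_norm_sub_tendsto_zero]
      exact squeeze_zero (fun _ => norm_nonneg _) (fun n => h1 n x) hη0
  have t2 : Tendsto (fun n => ∫ x in Ω, ‖fderiv ℝ (φ n) x‖ ^ 2) atTop
      (𝓝 (∫ x in Ω, ‖fderiv ℝ ψ x‖ ^ 2)) := by
    refine tendsto_integral_of_dominated_convergence (fun _ => (C' + 1) ^ 2)
      (fun n => ((ht n).continuous_fderiv.norm.pow 2).aestronglyMeasurable) (integrable_const _)
      (fun n => Eventually.of_forall fun x => ?_) (Eventually.of_forall fun x => ?_)
    · rw [norm_pow, norm_norm]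
      gcongr
      calc ‖fderiv ℝ (φ n) x‖ = ‖(fderiv ℝ (φ n) x - fderiv ℝ ψ x) + fderiv ℝ ψ x‖ := by
            rw [sub_add_cancel]
        _ ≤ ‖fderiv ℝ (φ n) x - fderiv ℝ ψ x‖ + ‖fderiv ℝ ψ x‖ := norm_add_le _ _
        _ ≤ C' + 1 := by
          have := (h2 n x).trans (hη n)
          linarith [hC' x]
    · refine (Tendsto.norm ?_).pow 2
      rw [tendsto_iff_norm_sub_tendsto_zero]
      exact squeeze_zero (fun _ => norm_nonneg _) (fun n => h2 n x) hη0
  rw [restr1 h, restr2 h]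
  refine le_of_tendsto_of_tendsto' (t1.const_mul _) t2 fun n => ?_
  rw [← restr1 (ht n), ← restr2 (ht n)]
  exact firstEig_le_ratio (hs n) (ht n)

/-- The domains considered: bounded, nonempty, connected and open in dimension at least two. -/
structure IsDom {N : ℕ} (Ω : Set (Euc N)) : Prop where
  dim : 2 ≤ N
  isOpen : IsOpen Ω
  conn : IsConnected Ω
  bdd : Bornology.IsBounded Ω

theorem IsDom.firstEig_pos {N : ℕ} {Ω : Set (Euc N)} (hΩ : IsDom Ω) : 0 < firstEig Ω :=
  _root_.firstEig_pos hΩ.dim hΩ.isOpen hΩ.conn.nonempty hΩ.bdd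

theorem IsDom.isFiniteMeasure {N : ℕ} {Ω : Set (Euc N)} (hΩ : IsDom Ω) :
    IsFiniteMeasure ((volume : Measure (Euc N)).restrict Ω) :=
  ⟨by simpa using hΩ.bdd.measure_lt_top⟩

/-- The Hilbert space `L²(Ω)`. -/
abbrev L2 {N : ℕ} (Ω : Set (Euc N)) := Lp ℝ 2 ((volume : Measure (Euc N)).restrict Ω)

/-- The linear space of test functions. -/
def testSpace {N : ℕ} (Ω : Set (Euc N)) : Submodule ℝ (Euc N → ℝ) where
  carrier := {φ | IsTest Ω φ}
  add_mem' := fun {a b} ha hb => ⟨ha.contDiff.add hb.contDiff, ha.compact.add hb.compact,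
    (tsupport_add _ _).trans (union_subset ha.subset hb.subset)⟩
  zero_mem' := ⟨contDiff_const, HasCompactSupport.zero, by simp [tsupport]⟩
  smul_mem' := fun c {a} ha => ⟨contDiff_const.smul ha.contDiff, ha.compact.smul_left,
    (tsupport_smul_subset_right (fun _ => c) a).trans ha.subset⟩

theorem IsTest.continuous_gradient {N : ℕ} {Ω : Set (Euc N)} {φ : Euc N → ℝ} (h : IsTest Ω φ) :
    Continuous (gradient φ) :=
  (InnerProductSpace.toDual ℝ (Euc N)).symm.continuous.comp h.continuous_fderiv

theorem IsTest.memLp {N : ℕ} {Ω : Set (Euc N)} {φ : Euc N → ℝ} (h : IsTest Ω φ) :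
    MemLp φ 2 (volume.restrict Ω) :=
  (h.contDiff.continuous.memLp_of_hasCompactSupport h.compact).restrict Ω

theorem IsTest.memLp_gradient {N : ℕ} {Ω : Set (Euc N)} {φ : Euc N → ℝ} (h : IsTest Ω φ) :
    MemLp (gradient φ) 2 (volume.restrict Ω) := by
  refine (h.continuous_gradient.memLp_of_hasCompactSupport ?_).restrict Ω
  refine (h.compact.fderiv ℝ).mono fun x hx h0 => hx ?_
  simp [gradient, h0]

/-- A test function as an element of `L²(Ω)`. -/
def testIncl {N : ℕ} (Ω : Set (Euc N)) : testSpace Ω →ₗ[ℝ] L2 Ω where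
  toFun φ := (show IsTest Ω φ.1 from φ.2).memLp.toLp φ.1
  map_add' _ _ := MemLp.toLp_add _ _
  map_smul' c _ := MemLp.toLp_const_smul c _

/-- The gradient of a test function as a square integrable vector field. -/
def testGrad {N : ℕ} (Ω : Set (Euc N)) :
    testSpace Ω →ₗ[ℝ] Lp (Euc N) 2 ((volume : Measure (Euc N)).restrict Ω) where
  toFun φ := (show IsTest Ω φ.1 from φ.2).memLp_gradient.toLp (gradient φ.1)
  map_add' φ ψ := by
    rw [← MemLp.toLp_add]
    congr 1
    ext1 x
    have h1 : IsTest Ω φ.1 := φ.2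
    have h2 : IsTest Ω ψ.1 := ψ.2
    simp only [gradient, Pi.add_apply, Submodule.coe_add]
    rw [fderiv_add (h1.differentiable x) (h2.differentiable x), map_add]
  map_smul' c φ := by
    rw [RingHom.id_apply, ← MemLp.toLp_const_smul]
    congr 1
    ext1 x
    have h1 : IsTest Ω φ.1 := φ.2
    simp only [gradient, Pi.smul_apply, Submodule.coe_smul]
    rw [fderiv_const_smul (h1.differentiable x), map_smul]

/-- The energy space: the closure of the gradients of test functions. -/
abbrev Energy {N : ℕ} (Ω : Set (Euc N)) := (LinearMap.range (testGrad Ω)).topologicalClosure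

/-- The gradient as a map into the energy space. -/
def testEnergy {N : ℕ} (Ω : Set (Euc N)) : testSpace Ω →ₗ[ℝ] Energy Ω :=
  (testGrad Ω).codRestrict _ fun φ =>
    Submodule.le_topologicalClosure _ (LinearMap.mem_range_self _ φ)

theorem denseRange_testEnergy {N : ℕ} (Ω : Set (Euc N)) : DenseRange (testEnergy Ω) := by
  intro x
  rw [Metric.mem_closure_iff]
  intro ε hε
  have hx : x.1 ∈ closure (((LinearMap.range (testGrad Ω) : Submodule ℝ _) :
      Set (Lp (Euc N) 2 ((volume : Measure (Euc N)).restrict Ω)))) := x.2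
  obtain ⟨y, ⟨φ, rfl⟩, hy⟩ := Metric.mem_closure_iff.1 hx ε hε
  exact ⟨testEnergy Ω φ, ⟨φ, rfl⟩, hy⟩

/-- The inclusion of the energy space into `L²(Ω)`. -/
def energyIncl {N : ℕ} (Ω : Set (Euc N)) : Energy Ω →L[ℝ] L2 Ω :=
  (testIncl Ω).extendOfNorm (testEnergy Ω)

/-- The adjoint of the inclusion. -/
def energyAdj {N : ℕ} (Ω : Set (Euc N)) : L2 Ω →L[ℝ] Energy Ω := (energyIncl Ω).adjoint

section Abstract

variable {E F : Type*} [NormedAddCommGroup E] [InnerProductSpace ℝ E] [CompleteSpace E]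
  [NormedAddCommGroup F] [InnerProductSpace ℝ F] [CompleteSpace F]

theorem ContinuousLinearMap.norm_comp_adjoint_self (A : E →L[ℝ] F) :
    ‖A ∘L A.adjoint‖ = ‖A‖ ^ 2 := by
  have := ContinuousLinearMap.norm_adjoint_comp_self A.adjoint
  rw [ContinuousLinearMap.adjoint_adjoint, LinearIsometryEquiv.norm_map] at this
  rw [this, sq]

theorem ContinuousLinearMap.inner_comp_adjoint_left (A : E →L[ℝ] F) (f g : F) :
    inner ℝ ((A ∘L A.adjoint) f) g = inner ℝ (A.adjoint f) (A.adjoint g) := by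
  rw [ContinuousLinearMap.comp_apply, ← ContinuousLinearMap.adjoint_inner_right]

end Abstract

theorem eq_of_dense_inner {E ι : Type*} [NormedAddCommGroup E] [InnerProductSpace ℝ E]
    {j : ι → E} (hj : DenseRange j) {a b : E} (h : ∀ i, inner ℝ a (j i) = inner ℝ b (j i)) :
    a = b := by
  have h1 : (fun y => inner ℝ a y) = fun y => inner ℝ b y :=
    hj.equalizer (by fun_prop) (by fun_prop) (funext h)
  exact ext_inner_right ℝ fun y => congrFun h1 y

/-- The solution operator of the Dirichlet problem for `-Δ`. -/
def greenOp {N : ℕ} (Ω : Set (Euc N)) : L2 Ω →L[ℝ] L2 Ω :=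
  energyIncl Ω ∘L energyAdj Ω

theorem L2_inner {N : ℕ} {Ω : Set (Euc N)} (f g : L2 Ω) : inner ℝ f g = ∫ x in Ω, f x * g x := by
  rw [L2.inner_def]
  refine integral_congr_ae (Eventually.of_forall fun x => ?_)
  simp [mul_comm]

theorem inner_testIncl {N : ℕ} {Ω : Set (Euc N)} (f : L2 Ω) (φ : testSpace Ω) :
    inner ℝ f (testIncl Ω φ) = ∫ x in Ω, f x * φ.1 x := by
  rw [L2_inner]
  refine integral_congr_ae ?_
  filter_upwards [(show IsTest Ω φ.1 from φ.2).memLp.coeFn_toLp] with x hx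
  rw [show (testIncl Ω φ : Euc N → ℝ) x = φ.1 x from hx]

theorem inner_testEnergy {N : ℕ} {Ω : Set (Euc N)} (φ ψ : testSpace Ω) :
    inner ℝ (testEnergy Ω φ) (testEnergy Ω ψ)
      = ∫ x, inner ℝ (gradient φ.1 x) (gradient ψ.1 x) := by
  have h1 : IsTest Ω φ.1 := φ.2
  have h2 : IsTest Ω ψ.1 := ψ.2
  change inner ℝ (testGrad Ω φ) (testGrad Ω ψ) = _
  have h3 : ∫ x in Ω, inner ℝ (gradient φ.1 x) (gradient ψ.1 x)
      = ∫ x, inner ℝ (gradient φ.1 x) (gradient ψ.1 x) :=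
    setIntegral_eq_integral_of_forall_compl_eq_zero fun x hx => by
      simp [gradient, h1.fderiv_eq_zero hx]
  rw [L2.inner_def, ← h3]
  refine integral_congr_ae ?_
  filter_upwards [h1.memLp_gradient.coeFn_toLp, h2.memLp_gradient.coeFn_toLp] with x hx hx'
  rw [show (testGrad Ω φ : Euc N → Euc N) x = _ from hx,
    show (testGrad Ω ψ : Euc N → Euc N) x = _ from hx']

theorem norm_testEnergy_sq {N : ℕ} {Ω : Set (Euc N)} (φ : testSpace Ω) :
    ‖testEnergy Ω φ‖ ^ 2 = ∫ x, ‖fderiv ℝ φ.1 x‖ ^ 2 := by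
  rw [← real_inner_self_eq_norm_sq, inner_testEnergy]
  simp_rw [real_inner_self_eq_norm_sq, norm_gradient]

theorem norm_testIncl_sq {N : ℕ} {Ω : Set (Euc N)} (φ : testSpace Ω) :
    ‖testIncl Ω φ‖ ^ 2 = ∫ x, φ.1 x ^ 2 := by
  have h1 : IsTest Ω φ.1 := φ.2
  have h3 : ∫ x in Ω, φ.1 x ^ 2 = ∫ x, φ.1 x ^ 2 :=
    setIntegral_eq_integral_of_forall_compl_eq_zero fun x hx => by simp [h1.eq_zero hx]
  rw [← real_inner_self_eq_norm_sq, inner_testIncl, ← h3]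
  refine integral_congr_ae ?_
  filter_upwards [h1.memLp.coeFn_toLp] with x hx
  rw [show (testIncl Ω φ : Euc N → ℝ) x = φ.1 x from hx, sq]

theorem IsDom.norm_testIncl_le {N : ℕ} {Ω : Set (Euc N)} (hΩ : IsDom Ω) (φ : testSpace Ω) :
    ‖testIncl Ω φ‖ ≤ (√(firstEig Ω))⁻¹ * ‖testEnergy Ω φ‖ := by
  have hpos := hΩ.firstEig_pos
  have h := (show IsTest Ω φ.1 from φ.2).firstEig_mul_le hΩ.isOpen hΩ.bdd
  rw [← norm_testIncl_sq, ← norm_testEnergy_sq] at h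
  refine le_of_sq_le_sq ?_ (by positivity)
  rw [mul_pow, inv_pow, Real.sq_sqrt hpos.le, inv_mul_eq_div, le_div_iff₀ hpos]
  linarith

theorem IsDom.energyIncl_testEnergy {N : ℕ} {Ω : Set (Euc N)} (hΩ : IsDom Ω) (φ : testSpace Ω) :
    energyIncl Ω (testEnergy Ω φ) = testIncl Ω φ :=
  LinearMap.extendOfNorm_eq (denseRange_testEnergy Ω) ⟨_, hΩ.norm_testIncl_le⟩ φ

theorem IsDom.inner_adjoint_testEnergy {N : ℕ} {Ω : Set (Euc N)} (hΩ : IsDom Ω) (h : L2 Ω)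
    (φ : testSpace Ω) : inner ℝ (energyAdj Ω h) (testEnergy Ω φ)
      = ∫ x in Ω, h x * φ.1 x := by
  have h1 : inner ℝ (energyAdj Ω h) (testEnergy Ω φ)
      = inner ℝ h (energyIncl Ω (testEnergy Ω φ)) :=
    ContinuousLinearMap.adjoint_inner_left (energyIncl Ω) (testEnergy Ω φ) h
  rw [h1, hΩ.energyIncl_testEnergy φ, inner_testIncl h φ]

theorem IsDom.norm_greenOp {N : ℕ} {Ω : Set (Euc N)} (hΩ : IsDom Ω) :
    ‖greenOp Ω‖ = (firstEig Ω)⁻¹ := by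
  have hpos := hΩ.firstEig_pos
  have hle : ‖energyIncl Ω‖ ≤ (√(firstEig Ω))⁻¹ :=
    LinearMap.opNorm_extendOfNorm_le (denseRange_testEnergy Ω) (by positivity) hΩ.norm_testIncl_le
  have hG : ‖greenOp Ω‖ = ‖energyIncl Ω‖ ^ 2 :=
    ContinuousLinearMap.norm_comp_adjoint_self (energyIncl Ω)
  rw [hG]
  refine le_antisymm ?_ ?_
  · calc ‖energyIncl Ω‖ ^ 2 ≤ ((√(firstEig Ω))⁻¹) ^ 2 := by gcongr
      _ = (firstEig Ω)⁻¹ := by rw [inv_pow, Real.sq_sqrt hpos.le]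
  · by_contra! hlt
    set a := ‖energyIncl Ω‖ ^ 2
    have key : ∀ φ : testSpace Ω, ∫ x, φ.1 x ^ 2 ≤ a * ∫ x, ‖fderiv ℝ φ.1 x‖ ^ 2 := fun φ => by
      rw [← norm_testIncl_sq, ← norm_testEnergy_sq, ← hΩ.energyIncl_testEnergy, ← mul_pow]
      gcongr
      exact (energyIncl Ω).le_opNorm _
    have ha : 0 ≤ a := sq_nonneg _
    set b := max a ((firstEig Ω)⁻¹ / 2)
    have hb : b < (firstEig Ω)⁻¹ := max_lt hlt (half_lt_self (by positivity))
    have hb0 : 0 < b := lt_max_of_lt_right (by positivity)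
    obtain ⟨φ, -, h1, h2, h3⟩ := exists_ratio_lt hΩ.isOpen hΩ.conn.nonempty
      ((lt_inv_comm₀ hpos hb0).2 hb)
    have h4 := key ⟨φ, h1⟩
    have h5 : a * ∫ x, ‖fderiv ℝ φ x‖ ^ 2 ≤ b * ∫ x, ‖fderiv ℝ φ x‖ ^ 2 := by
      gcongr; exact le_max_left _ _
    have h6 : b * ∫ x, ‖fderiv ℝ φ x‖ ^ 2 < b * (b⁻¹ * ∫ x, φ x ^ 2) := by gcongr
    rw [mul_inv_cancel_left₀ hb0.ne'] at h6
    simp only at h4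
    linarith

theorem greenOp_inner_left {N : ℕ} {Ω : Set (Euc N)} (f g : L2 Ω) :
    inner ℝ (greenOp Ω f) g
      = inner ℝ (energyAdj Ω f) (energyAdj Ω g) :=
  ContinuousLinearMap.inner_comp_adjoint_left (energyIncl Ω) f g

theorem greenOp_symm {N : ℕ} {Ω : Set (Euc N)} (f g : L2 Ω) :
    inner ℝ (greenOp Ω f) g = inner ℝ f (greenOp Ω g) := by
  rw [greenOp_inner_left f g, real_inner_comm (greenOp Ω g) f, greenOp_inner_left g f]
  exact real_inner_comm _ _

theorem greenOp_inner_self_nonneg {N : ℕ} {Ω : Set (Euc N)} (f : L2 Ω) :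
    0 ≤ inner ℝ (greenOp Ω f) f := by
  rw [greenOp_inner_left f f]; exact real_inner_self_nonneg

/-- `greenOp` inverts `-Δ` in the sense of distributions. -/
theorem IsDom.greenOp_weak {N : ℕ} {Ω : Set (Euc N)} (hΩ : IsDom Ω) (h : L2 Ω) {φ : Euc N → ℝ}
    (hφ : IsTest Ω φ) (hφ2 : ContDiff ℝ 2 φ) :
    ∫ x in Ω, greenOp Ω h x * lap φ x = - ∫ x in Ω, h x * φ x := by
  have hc : Continuous (lap φ) := by
    unfold lap
    refine continuous_finsetSum _ fun i _ => ?_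
    have h1 : ContDiff ℝ 1 (fun y => fderiv ℝ φ y (EuclideanSpace.single i 1)) :=
      contDiff_iff_contDiffAt.2 fun x => hφ2.contDiffAt.fderiv_apply_const _
    exact (h1.continuous_fderiv (by norm_num)).clm_apply continuous_const
  have hcs : HasCompactSupport (lap φ) := by
    refine hφ.compact.of_isClosed_subset isClosed_closure (closure_minimal ?_ (isClosed_tsupport φ))
    intro x hx
    by_contra hx'
    refine hx ?_
    have : φ =ᶠ[𝓝 x] fun _ => 0 := notMem_tsupport_iff_eventuallyEq.1 hx'
    rw [lap_congr this, lap_const]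
  have hm : MemLp (lap φ) 2 (volume.restrict Ω) :=
    (hc.memLp_of_hasCompactSupport hcs).restrict Ω
  have hadj : energyAdj Ω (hm.toLp _) = - testEnergy Ω ⟨φ, hφ⟩ := by
    refine eq_of_dense_inner (denseRange_testEnergy Ω) fun χ => ?_
    have hχ : IsTest Ω χ.1 := χ.2
    obtain ⟨-, -, h3⟩ := hχ.integral_inner_gradient hΩ.isOpen
      (U := φ) (fun x _ => hφ2.contDiffAt)
    have h4 : ∫ x in Ω, lap φ x * χ.1 x = ∫ x, lap φ x * χ.1 x :=
      setIntegral_eq_integral_of_forall_compl_eq_zero fun x hx => by simp [hχ.eq_zero hx]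
    rw [inner_neg_left, hΩ.inner_adjoint_testEnergy _ χ, inner_testEnergy, h3, ← h4, neg_neg]
    refine integral_congr_ae ?_
    filter_upwards [hm.coeFn_toLp] with x hx
    rw [hx]
  have h1 : inner ℝ (greenOp Ω h) (hm.toLp _) = ∫ x in Ω, greenOp Ω h x * lap φ x := by
    rw [L2_inner]
    refine integral_congr_ae ?_
    filter_upwards [hm.coeFn_toLp] with x hx
    rw [hx]
  rw [← h1, greenOp_inner_left h _, hadj, inner_neg_right, hΩ.inner_adjoint_testEnergy h ⟨φ, hφ⟩]

theorem hasDerivAt_max_sq (s : ℝ) : HasDerivAt (fun r : ℝ => max r 0 ^ 2) (2 * max s 0) s := by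
  rcases lt_trichotomy s 0 with hs | rfl | hs
  · rw [max_eq_right hs.le, mul_zero]
    refine (hasDerivAt_const s (0 : ℝ)).congr_of_eventuallyEq ?_
    filter_upwards [eventually_lt_nhds hs] with r hr
    simp [max_eq_right hr.le]
  · rw [max_self, mul_zero, hasDerivAt_iff_isLittleO_nhds_zero]
    simp only [zero_add, max_self, smul_zero, sub_zero]
    refine Asymptotics.IsLittleO.of_bound fun c hc => ?_
    filter_upwards [Metric.ball_mem_nhds (0 : ℝ) hc] with r hr
    rw [Metric.mem_ball, dist_zero_right, Real.norm_eq_abs] at hr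
    rw [Real.norm_eq_abs, Real.norm_eq_abs]
    have h1 : |max r 0| ≤ |r| := by
      rcases le_total r 0 with h | h
      · simp [max_eq_right h]
      · simp [max_eq_left h]
    have h2 : (0 : ℝ) ^ 2 = 0 := by norm_num
    rw [h2, sub_zero, abs_pow, sq]
    exact mul_le_mul (h1.trans hr.le) h1 (abs_nonneg _) hc.le
  · rw [max_eq_left hs.le]
    have := hasDerivAt_pow 2 s
    simp only [Nat.cast_ofNat, Nat.add_one_sub_one, pow_one] at this
    refine this.congr_of_eventuallyEq ?_
    filter_upwards [eventually_gt_nhds hs] with r hr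
    simp [max_eq_left hr.le]

/-- A `C¹` cut-off of the negative part. -/
theorem exists_truncation {c : ℝ} (hc : 0 < c) : ∃ ζ ζ' : ℝ → ℝ, (∀ t, HasDerivAt ζ (ζ' t) t) ∧
    Continuous ζ' ∧ (∀ t, 0 ≤ ζ t) ∧ (∀ t, c ≤ t → ζ t = 0) ∧ (∀ t, -t ≤ ζ t) ∧
    ∀ t, -1 ≤ ζ' t ∧ ζ' t ≤ 0 := by
  refine ⟨fun t => (max (c - t) 0 ^ 2 - max (-t) 0 ^ 2) / (2 * c),
    fun t => -(max (c - t) 0 - max (-t) 0) / c, fun t => ?_, by fun_prop, fun t => ?_,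
    fun t ht => ?_, fun t => ?_, fun t => ?_⟩
  · have h1 := (hasDerivAt_max_sq (c - t)).scomp t ((hasDerivAt_id t).const_sub c)
    have h2 := (hasDerivAt_max_sq (-t)).scomp t (hasDerivAt_id t).neg
    have h3 := (h1.sub h2).div_const (2 * c)
    refine h3.congr_deriv ?_
    simp only [smul_eq_mul]
    field_simp
    ring
  · have : max (-t) 0 ≤ max (c - t) 0 := max_le_max (by linarith) le_rfl
    have h0 : 0 ≤ max (-t) 0 := le_max_right _ _
    refine div_nonneg ?_ (by positivity)
    nlinarith
  · simp [max_eq_right (show c - t ≤ 0 by linarith), max_eq_right (show -t ≤ 0 by linarith)]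
  · rw [le_div_iff₀ (by positivity)]
    rcases le_total t 0 with h | h
    · rw [max_eq_left (by linarith), max_eq_left (by linarith)]
      nlinarith
    · rw [max_eq_right (show -t ≤ 0 by linarith)]
      nlinarith [sq_nonneg (max (c - t) 0)]
  · rw [le_div_iff₀ hc, div_le_iff₀ hc]
    have : max (-t) 0 ≤ max (c - t) 0 := max_le_max (by linarith) le_rfl
    have h2 : max (c - t) 0 ≤ max (-t) 0 + c := max_le (by linarith [le_max_left (-t) 0])
      (by linarith [le_max_right (-t) 0])
    constructor <;> linarith

theorem IsTest.integrable_inner_gradient {N : ℕ} {Ω : Set (Euc N)} {φ χ : Euc N → ℝ}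
    (hφ : IsTest Ω φ) (hχ : IsTest Ω χ) :
    Integrable fun x => (inner ℝ (gradient φ x) (gradient χ x) : ℝ) := by
  refine (hφ.continuous_gradient.inner hχ.continuous_gradient).integrable_of_hasCompactSupport ?_
  refine (hχ.compact.fderiv ℝ).mono fun x hx h0 => hx ?_
  simp [gradient, h0]

theorem ae_le_of_tendsto_Lp {α : Type*} [MeasurableSpace α] {μ : Measure α} {v : ℕ → Lp ℝ 2 μ}
    {w : Lp ℝ 2 μ} (hv : Tendsto v atTop (𝓝 w)) {U : α → ℝ} (h : ∀ n, ∀ᵐ x ∂μ, v n x ≤ U x) :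
    ∀ᵐ x ∂μ, w x ≤ U x := by
  obtain ⟨ns, -, hns⟩ := (tendstoInMeasure_of_tendsto_Lp hv).exists_seq_tendsto_ae
  filter_upwards [hns, ae_all_iff.2 h] with x hx h1
  exact le_of_tendsto' hx fun n => h1 _

theorem IsTest.exists_truncated {N : ℕ} {Ω : Set (Euc N)} (hΩ : IsDom Ω) {U : Euc N → ℝ}
    (hU : ∀ x ∈ Ω, ContDiffAt ℝ 2 U x) {c : ℝ} (hc : 0 < c) (hUc : ∀ x ∈ Ω, c ≤ U x)
    {φ : Euc N → ℝ} (hφ : IsTest Ω φ) : ∃ χ : Euc N → ℝ, IsTest Ω χ ∧ (∀ x, 0 ≤ χ x) ∧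
      (∀ x ∈ Ω, φ x - χ x ≤ U x) ∧ ∀ x ∈ Ω, 0 ≤ 2 * inner ℝ (gradient φ x) (gradient χ x)
        - inner ℝ (gradient χ x) (gradient χ x) - 2 * inner ℝ (gradient U x) (gradient χ x) := by
  classical
  obtain ⟨ζ, ζ', hζ, hζc, h0, h1, h2, h3⟩ := exists_truncation hc
  have hζ1 : ContDiff ℝ 1 ζ := by
    rw [contDiff_one_iff_deriv]
    refine ⟨fun t => (hζ t).differentiableAt, ?_⟩
    rwa [show deriv ζ = ζ' from funext fun t => (hζ t).deriv]
  set χ : Euc N → ℝ := Ω.indicator fun x => ζ (U x - φ x)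
  have hin : ∀ x ∈ Ω, χ =ᶠ[𝓝 x] fun x => ζ (U x - φ x) := fun x hx => by
    filter_upwards [hΩ.isOpen.mem_nhds hx] with y hy
    exact indicator_of_mem hy _
  have hout : ∀ x, x ∉ tsupport φ → χ x = 0 := fun x hx => by
    by_cases hxΩ : x ∈ Ω
    · rw [show χ x = ζ (U x - φ x) from indicator_of_mem hxΩ _, image_eq_zero_of_notMem_tsupport hx, sub_zero]
      exact h1 _ (hUc x hxΩ)
    · exact indicator_of_notMem hxΩ _
  have hsupp : tsupport χ ⊆ tsupport φ :=
    closure_minimal (fun x hx => by by_contra h; exact hx (hout x h)) (isClosed_tsupport φ)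
  have hχ : IsTest Ω χ := by
    refine ⟨contDiff_iff_contDiffAt.2 fun x => ?_,
      hφ.compact.of_isClosed_subset (isClosed_tsupport χ) hsupp, hsupp.trans hφ.subset⟩
    by_cases hx : x ∈ tsupport φ
    · have hxΩ := hφ.subset hx
      refine ContDiffAt.congr_of_eventuallyEq ?_ (hin x hxΩ)
      exact hζ1.contDiffAt.comp x (((hU x hxΩ).of_le (by norm_num)).sub hφ.contDiff.contDiffAt)
    · refine (contDiffAt_const (c := (0 : ℝ))).congr_of_eventuallyEq ?_
      filter_upwards [(isClosed_tsupport φ).isOpen_compl.mem_nhds hx] with y hy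
      exact hout y hy
  refine ⟨χ, hχ, fun x => indicator_nonneg (fun _ _ => h0 _) x, fun x hx => ?_, fun x hx => ?_⟩
  · rw [show χ x = ζ (U x - φ x) from indicator_of_mem hx _]
    linarith [h2 (U x - φ x)]
  · have hd : HasFDerivAt χ (ζ' (U x - φ x) • (fderiv ℝ U x - fderiv ℝ φ x)) x := by
      refine HasFDerivAt.congr_of_eventuallyEq ?_ (hin x hx)
      exact (hζ _).comp_hasFDerivAt x
        ((((hU x hx).differentiableAt (by norm_num)).hasFDerivAt).sub
          (hφ.differentiable x).hasFDerivAt)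
    have hg : gradient χ x = ζ' (U x - φ x) • (gradient U x - gradient φ x) := by
      simp only [gradient, hd.fderiv, map_smul, map_sub]
    obtain ⟨h4, h5⟩ := h3 (U x - φ x)
    rw [hg]
    set z := ζ' (U x - φ x)
    set A := gradient U x
    set B := gradient φ x
    have h6 : (0 : ℝ) ≤ inner ℝ (A - B) (A - B) := real_inner_self_nonneg
    have h7 : (inner ℝ (A - B) (A - B) : ℝ) = inner ℝ A (A - B) - inner ℝ B (A - B) :=
      inner_sub_left _ _ _
    rw [inner_smul_right, inner_smul_right, inner_smul_left, inner_smul_right, RCLike.conj_to_real]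
    have h8 : 0 ≤ -z * (2 + z) * inner ℝ (A - B) (A - B) :=
      mul_nonneg (mul_nonneg (by linarith) (by linarith)) h6
    calc 0 ≤ -z * (2 + z) * inner ℝ (A - B) (A - B) := h8
      _ = -2 * z * inner ℝ (A - B) (A - B) - z * (z * inner ℝ (A - B) (A - B)) := by ring
      _ = _ := by
        nth_rewrite 1 [h7]
        ring

theorem norm_sub_sub_sq {E : Type*} [NormedAddCommGroup E] [InnerProductSpace ℝ E] (a b g : E) :
    ‖a - b - g‖ ^ 2 = ‖a - g‖ ^ 2 - (2 * (inner ℝ a b - inner ℝ g b) - inner ℝ b b) := by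
  rw [sub_right_comm, norm_sub_sq_real, inner_sub_left, real_inner_self_eq_norm_sq]
  ring

/-- Comparison with classical strict supersolutions. -/
theorem IsDom.greenOp_le {N : ℕ} {Ω : Set (Euc N)} (hΩ : IsDom Ω) {U : Euc N → ℝ}
    (hU : ∀ x ∈ Ω, ContDiffAt ℝ 2 U x) {c : ℝ} (hc : 0 < c) (hUc : ∀ x ∈ Ω, c ≤ U x) {h : L2 Ω}
    (hh : ∀ᵐ x ∂(volume : Measure (Euc N)).restrict Ω, h x ≤ - lap U x) :
    ∀ᵐ x ∂(volume : Measure (Euc N)).restrict Ω, greenOp Ω h x ≤ U x := by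
  set g := energyAdj Ω h
  have key : ∀ φ : testSpace Ω, ∃ ψ : testSpace Ω, (∀ x ∈ Ω, ψ.1 x ≤ U x) ∧
      ‖testEnergy Ω ψ - g‖ ≤ ‖testEnergy Ω φ - g‖ := by
    intro φ
    have hφ : IsTest Ω φ.1 := φ.2
    obtain ⟨χ, hχ, hχ0, hle, hgr⟩ := hφ.exists_truncated hΩ hU hc hUc
    let χ' : testSpace Ω := ⟨χ, hχ⟩
    refine ⟨φ - χ', hle, ?_⟩
    obtain ⟨h1, h2, h3⟩ := hχ.integral_inner_gradient hΩ.isOpen hU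
    have h4 : ∫ x in Ω, lap U x * χ x = ∫ x, lap U x * χ x :=
      setIntegral_eq_integral_of_forall_compl_eq_zero fun x hx => by simp [hχ.eq_zero hx]
    have h5 : ∫ x in Ω, h x * χ x ≤ - ∫ x in Ω, lap U x * χ x := by
      rw [← integral_neg]
      refine integral_mono_ae ((Lp.memLp h).integrable_mul hχ.memLp) h2.restrict.neg ?_
      filter_upwards [hh] with x hx
      have := mul_le_mul_of_nonneg_right hx (hχ0 x)
      simpa using this
    have h6 : 0 ≤ ∫ x, (2 * inner ℝ (gradient φ.1 x) (gradient χ x)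
        - inner ℝ (gradient χ x) (gradient χ x) - 2 * inner ℝ (gradient U x) (gradient χ x)) := by
      refine integral_nonneg fun x => ?_
      by_cases hx : x ∈ Ω
      · exact hgr x hx
      · simp [gradient, hχ.fderiv_eq_zero hx]
    have i1 := hφ.integrable_inner_gradient hχ
    have i2 := hχ.integrable_inner_gradient hχ
    have i3 : Integrable fun x => 2 * (inner ℝ (gradient φ.1 x) (gradient χ x) : ℝ)
        - inner ℝ (gradient χ x) (gradient χ x) := (i1.const_mul 2).sub i2
    rw [integral_sub i3 (h1.const_mul 2), integral_sub (i1.const_mul 2) i2,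
      integral_const_mul, integral_const_mul, h3] at h6
    have e1 : inner ℝ (testEnergy Ω φ) (testEnergy Ω χ')
        = ∫ x, inner ℝ (gradient φ.1 x) (gradient χ x) := inner_testEnergy φ χ'
    have e2 : inner ℝ (testEnergy Ω χ') (testEnergy Ω χ')
        = ∫ x, inner ℝ (gradient χ x) (gradient χ x) := inner_testEnergy χ' χ'
    have e3 : inner ℝ g (testEnergy Ω χ') = ∫ x in Ω, h x * χ x :=
      hΩ.inner_adjoint_testEnergy h χ'
    have e4 : ‖testEnergy Ω (φ - χ') - g‖ ^ 2 = ‖testEnergy Ω φ - g‖ ^ 2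
        - (2 * (inner ℝ (testEnergy Ω φ) (testEnergy Ω χ') - inner ℝ g (testEnergy Ω χ'))
          - inner ℝ (testEnergy Ω χ') (testEnergy Ω χ')) := by
      rw [map_sub]
      exact norm_sub_sub_sq _ _ _
    refine le_of_sq_le_sq ?_ (norm_nonneg _)
    rw [e4, e1, e2, e3]
    linarith
  have hex : ∀ n : ℕ, ∃ ψ : testSpace Ω, (∀ x ∈ Ω, ψ.1 x ≤ U x) ∧
      ‖testEnergy Ω ψ - g‖ ≤ 1 / ((n : ℝ) + 1) := fun n => by
    have hn : (0 : ℝ) < 1 / ((n : ℝ) + 1) := Nat.one_div_pos_of_nat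
    obtain ⟨φ, hφ⟩ := (denseRange_testEnergy Ω).exists_dist_lt g hn
    obtain ⟨ψ, h1, h2⟩ := key φ
    refine ⟨ψ, h1, h2.trans ?_⟩
    rw [← dist_eq_norm, dist_comm]
    exact hφ.le
  choose ψ hψ1 hψ2 using hex
  have hlim : Tendsto (fun n => testEnergy Ω (ψ n)) atTop (𝓝 g) := by
    rw [tendsto_iff_norm_sub_tendsto_zero]
    exact squeeze_zero (fun _ => norm_nonneg _) hψ2 tendsto_one_div_add_atTop_nhds_zero_nat
  have hlim2 : Tendsto (fun n => testIncl Ω (ψ n)) atTop (𝓝 (greenOp Ω h)) := by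
    have := ((energyIncl Ω).continuous.tendsto g).comp hlim
    refine this.congr fun n => ?_
    exact hΩ.energyIncl_testEnergy (ψ n)
  refine ae_le_of_tendsto_Lp hlim2 fun n => ?_
  filter_upwards [(show IsTest Ω (ψ n).1 from (ψ n).2).memLp.coeFn_toLp,
    ae_restrict_mem hΩ.isOpen.measurableSet] with x hx hxΩ
  rw [show (testIncl Ω (ψ n) : Euc N → ℝ) x = (ψ n).1 x from hx]
  exact hψ1 n x hxΩ

theorem contDiffAt_sq_add {N : ℕ} (x₀ x : Euc N) {δ : ℝ} :
    ContDiffAt ℝ 2 (fun y : Euc N => ‖y - x₀‖ ^ 2 + δ ^ 2) x :=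
  ((contDiff_norm_sq ℝ).comp (contDiff_id.sub contDiff_const)).contDiffAt.add contDiffAt_const

theorem sq_add_pos {N : ℕ} (x₀ x : Euc N) {δ : ℝ} (hδ : 0 < δ) : 0 < ‖x - x₀‖ ^ 2 + δ ^ 2 := by
  positivity

theorem lap_rpow_sq_add {N : ℕ} (x₀ x : Euc N) {δ : ℝ} (hδ : 0 < δ) (t : ℝ) :
    lap (fun y => (‖y - x₀‖ ^ 2 + δ ^ 2) ^ t) x
      = 2 * t * (‖x - x₀‖ ^ 2 + δ ^ 2) ^ (t - 2)
        * ((N + 2 * (t - 1)) * (‖x - x₀‖ ^ 2 + δ ^ 2) - 2 * (t - 1) * δ ^ 2) := by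
  set q := ‖x - x₀‖ ^ 2 + δ ^ 2 with hq
  have hq0 : 0 < q := sq_add_pos x₀ x hδ
  have h1 : ∀ r : ℝ, 0 < r + δ ^ 2 → ∀ p : ℝ, HasDerivAt (fun r : ℝ => (r + δ ^ 2) ^ p)
      (p * (r + δ ^ 2) ^ (p - 1)) r := fun r hr p => by
    have := ((hasDerivAt_id r).add_const (δ ^ 2)).rpow_const (p := p) (Or.inl hr.ne')
    simpa using this
  have h2 : ∀ᶠ r in 𝓝 (‖x - x₀‖ ^ 2), HasDerivAt (fun r : ℝ => (r + δ ^ 2) ^ t)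
      (t * (r + δ ^ 2) ^ (t - 1)) r := by
    have : Tendsto (fun r : ℝ => r + δ ^ 2) (𝓝 (‖x - x₀‖ ^ 2)) (𝓝 q) :=
      (continuous_id.add continuous_const).tendsto _
    filter_upwards [this.eventually (eventually_gt_nhds hq0)] with r hr
    exact h1 r hr t
  rw [lap_radial h2 ((h1 _ hq0 (t - 1)).const_mul t), ← hq,
    show t - 1 - 1 = t - 2 by ring, show t - 1 = t - 2 + 1 by ring, Real.rpow_add_one hq0.ne',
    show ‖x - x₀‖ ^ 2 = q - δ ^ 2 by rw [hq]; ring]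
  ring

theorem contDiffAt_rpow_sq_add {N : ℕ} (x₀ x : Euc N) {δ : ℝ} (hδ : 0 < δ) (t : ℝ) :
    ContDiffAt ℝ 2 (fun y : Euc N => (‖y - x₀‖ ^ 2 + δ ^ 2) ^ t) x :=
  (contDiffAt_sq_add x₀ x).rpow_const_of_ne (sq_add_pos x₀ x hδ).ne'

theorem lap_log_sq_add (x₀ x : Euc 2) {δ : ℝ} (hδ : 0 < δ) :
    lap (fun y => Real.log (‖y - x₀‖ ^ 2 + δ ^ 2)) x
      = 4 * δ ^ 2 * (‖x - x₀‖ ^ 2 + δ ^ 2) ^ (-2 : ℝ) := by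
  set q := ‖x - x₀‖ ^ 2 + δ ^ 2 with hq
  have hq0 : 0 < q := sq_add_pos x₀ x hδ
  have h2 : ∀ᶠ r in 𝓝 (‖x - x₀‖ ^ 2), HasDerivAt (fun r : ℝ => Real.log (r + δ ^ 2))
      ((r + δ ^ 2)⁻¹) r := by
    have : Tendsto (fun r : ℝ => r + δ ^ 2) (𝓝 (‖x - x₀‖ ^ 2)) (𝓝 q) :=
      (continuous_id.add continuous_const).tendsto _
    filter_upwards [this.eventually (eventually_gt_nhds hq0)] with r hr
    simpa using ((hasDerivAt_id r).add_const (δ ^ 2)).log hr.ne'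
  have h3 : HasDerivAt (fun r : ℝ => (r + δ ^ 2)⁻¹) (-1 / q ^ 2) (‖x - x₀‖ ^ 2) := by
    exact ((hasDerivAt_id (‖x - x₀‖ ^ 2)).add_const (δ ^ 2)).inv hq0.ne'
  rw [lap_radial h2 h3, ← hq, Real.rpow_neg hq0.le,
    show ‖x - x₀‖ ^ 2 = q - δ ^ 2 by rw [hq]; ring]
  norm_num
  field_simp
  ring

section Order

variable {N : ℕ} {Ω : Set (Euc N)}

theorem ae_le_const_of_forall_pos {α : Type*} [MeasurableSpace α] {μ : Measure α} {w : α → ℝ}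
    {a : ℝ} (h : ∀ c : ℝ, 0 < c → ∀ᵐ x ∂μ, w x ≤ a + c) : ∀ᵐ x ∂μ, w x ≤ a := by
  have h1 : ∀ᵐ x ∂μ, ∀ n : ℕ, w x ≤ a + 1 / ((n : ℝ) + 1) :=
    ae_all_iff.2 fun n => h _ Nat.one_div_pos_of_nat
  filter_upwards [h1] with x hx
  have := (tendsto_one_div_add_atTop_nhds_zero_nat (𝕜 := ℝ)).const_add a
  rw [add_zero] at this
  exact ge_of_tendsto' this hx

theorem IsDom.greenOp_nonneg (hΩ : IsDom Ω) {h : L2 Ω} (hh : 0 ≤ h) : 0 ≤ greenOp Ω h := by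
  rw [← Lp.coeFn_nonneg] at hh ⊢
  have h1 : ∀ c : ℝ, 0 < c →
      ∀ᵐ x ∂(volume : Measure (Euc N)).restrict Ω, greenOp Ω (-h) x ≤ 0 + c := fun c hc => by
    rw [zero_add]
    refine hΩ.greenOp_le (U := fun _ => c) (fun _ _ => contDiffAt_const) hc (fun _ _ => le_rfl) ?_
    filter_upwards [hh, Lp.coeFn_neg h] with x hx hx'
    rw [hx', lap_const, Pi.neg_apply]
    simpa using hx
  have h2 := ae_le_const_of_forall_pos h1
  rw [map_neg] at h2
  filter_upwards [h2, Lp.coeFn_neg (greenOp Ω h)] with x hx hx'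
  rw [hx', Pi.neg_apply] at hx
  simpa using hx

theorem IsDom.greenOp_mono (hΩ : IsDom Ω) {h k : L2 Ω} (hh : h ≤ k) :
    greenOp Ω h ≤ greenOp Ω k := by
  have := hΩ.greenOp_nonneg (sub_nonneg.2 hh)
  rwa [map_sub, sub_nonneg] at this

theorem IsDom.greenOp_pow_mono (hΩ : IsDom Ω) (m : ℕ) {h k : L2 Ω} (hh : h ≤ k) :
    (greenOp Ω ^ m) h ≤ (greenOp Ω ^ m) k := by
  induction m with
  | zero => simpa using hh
  | succ m ih =>
    rw [pow_succ']
    exact hΩ.greenOp_mono ih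

theorem IsDom.greenOp_pow_nonneg (hΩ : IsDom Ω) (m : ℕ) {h : L2 Ω} (hh : 0 ≤ h) :
    0 ≤ (greenOp Ω ^ m) h := by
  simpa using hΩ.greenOp_pow_mono m hh

theorem greenOp_pow_symm (m : ℕ) (f g : L2 Ω) :
    inner ℝ ((greenOp Ω ^ m) f) g = inner ℝ f ((greenOp Ω ^ m) g) := by
  induction m generalizing f g with
  | zero => simp
  | succ m ih =>
    have h1 : (greenOp Ω ^ (m + 1)) f = greenOp Ω ((greenOp Ω ^ m) f) := by rw [pow_succ']; rfl
    have h2 : (greenOp Ω ^ (m + 1)) g = (greenOp Ω ^ m) (greenOp Ω g) := by rw [pow_succ]; rfl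
    rw [h1, h2, greenOp_symm _ g, ih f _]

theorem IsDom.exists_dist_bound (hΩ : IsDom Ω) :
    ∃ Q : ℝ, 1 ≤ Q ∧ ∀ x ∈ Ω, ∀ x₀ ∈ Ω, ∀ δ ∈ Ioc (0 : ℝ) 1, ‖x - x₀‖ ^ 2 + δ ^ 2 ≤ Q := by
  obtain ⟨C, hC⟩ := Metric.isBounded_iff.1 hΩ.bdd
  refine ⟨C ^ 2 + 1, by nlinarith [sq_nonneg C], fun x hx x₀ hx₀ δ hδ => ?_⟩
  have h1 := hC hx hx₀
  rw [dist_eq_norm] at h1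
  have h2 : ‖x - x₀‖ ^ 2 ≤ C ^ 2 := by gcongr
  have h3 : δ ^ 2 ≤ 1 := pow_le_one₀ hδ.1.le hδ.2
  linarith

/-- Iterated Green potentials of singular data are bounded. -/
theorem IsDom.exists_pow_bound (hΩ : IsDom Ω) (m : ℕ) : ∀ s : ℝ, m < s → s < m + 1 → s < N / 2 →
    ∃ C, 0 < C ∧ ∀ K, 0 < K → ∀ x₀ ∈ Ω, ∀ δ ∈ Ioc (0 : ℝ) 1, ∀ h : L2 Ω,
      (∀ᵐ x ∂(volume : Measure (Euc N)).restrict Ω, h x ≤ K * (‖x - x₀‖ ^ 2 + δ ^ 2) ^ (-s)) →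
      ∀ᵐ x ∂(volume : Measure (Euc N)).restrict Ω, (greenOp Ω ^ (m + 1)) h x ≤ C * K := by
  obtain ⟨Q, hQ1, hQ⟩ := hΩ.exists_dist_bound
  have hQ0 : 0 < Q := by linarith
  have hN : (2 : ℝ) ≤ N := by exact_mod_cast hΩ.dim
  induction m with
  | zero =>
    intro s hs0 hs1 hs
    rw [Nat.cast_zero] at hs0
    set σ := 1 - s with hσ
    have hσ0 : 0 < σ := by simp at hs1; linarith
    refine ⟨(Q ^ σ + 1) / (4 * σ ^ 2), by positivity, fun K hK x₀ hx₀ δ hδ h hh => ?_⟩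
    have hq0 : ∀ x : Euc N, 0 < ‖x - x₀‖ ^ 2 + δ ^ 2 := fun x => sq_add_pos x₀ x hδ.1
    set c := K / (4 * σ ^ 2) with hc
    have hc0 : 0 < c := by positivity
    have key := hΩ.greenOp_le (h := h)
      (U := fun x => c * ((Q ^ σ + 1) - (‖x - x₀‖ ^ 2 + δ ^ 2) ^ σ)) (fun x _ =>
        contDiffAt_const.mul (contDiffAt_const.sub (contDiffAt_rpow_sq_add x₀ x hδ.1 σ)))
      hc0 (fun x hx => ?_) ?_
    · rw [zero_add, pow_one]
      filter_upwards [key] with x hx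
      refine hx.trans ?_
      have : 0 ≤ (‖x - x₀‖ ^ 2 + δ ^ 2) ^ σ := (Real.rpow_pos_of_pos (hq0 x) _).le
      calc c * ((Q ^ σ + 1) - (‖x - x₀‖ ^ 2 + δ ^ 2) ^ σ) ≤ c * (Q ^ σ + 1) := by
            gcongr; linarith
        _ = _ := by rw [hc]; ring
    · have : (‖x - x₀‖ ^ 2 + δ ^ 2) ^ σ ≤ Q ^ σ :=
        Real.rpow_le_rpow (hq0 x).le (hQ x hx x₀ hx₀ δ hδ) hσ0.le
      nlinarith
    · filter_upwards [hh] with x hx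
      refine hx.trans ?_
      rw [lap_const_mul _ (contDiffAt_const.sub (contDiffAt_rpow_sq_add x₀ x hδ.1 σ)),
        lap_sub contDiffAt_const (contDiffAt_rpow_sq_add x₀ x hδ.1 σ), lap_const,
        lap_rpow_sq_add x₀ x hδ.1]
      set q := ‖x - x₀‖ ^ 2 + δ ^ 2
      have hq := hq0 x
      have e1 : q ^ (-s) = q ^ (σ - 2) * q := by
        rw [← Real.rpow_add_one hq.ne']; congr 1; rw [hσ]; ring
      have e2 : K = c * (4 * σ ^ 2) := by rw [hc]; field_simp
      have hp := Real.rpow_pos_of_pos hq (σ - 2)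
      have h4 : 2 * σ * q ≤ (N + 2 * (σ - 1)) * q - 2 * (σ - 1) * δ ^ 2 := by
        nlinarith [sq_nonneg δ]
      rw [e1, e2]
      calc c * (4 * σ ^ 2) * (q ^ (σ - 2) * q)
          = c * (2 * σ * q ^ (σ - 2) * (2 * σ * q)) := by ring
        _ ≤ c * (2 * σ * q ^ (σ - 2) * ((N + 2 * (σ - 1)) * q - 2 * (σ - 1) * δ ^ 2)) := by
            gcongr
        _ = _ := by ring
  | succ m ih =>
    intro s hs0 hs1 hs
    push_cast at hs0 hs1
    obtain ⟨C, hC, hm⟩ := ih (s - 1) (by linarith) (by linarith) (by linarith)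
    set t := s - 1 with ht
    have ht0 : 0 < t := by have : (0 : ℝ) ≤ m := m.cast_nonneg; linarith
    have htN : 0 < N - 2 - 2 * t := by linarith
    refine ⟨C / (2 * t * (N - 2 - 2 * t)), by positivity, fun K hK x₀ hx₀ δ hδ h hh => ?_⟩
    have hq0 : ∀ x : Euc N, 0 < ‖x - x₀‖ ^ 2 + δ ^ 2 := fun x => sq_add_pos x₀ x hδ.1
    set c := K / (2 * t * (N - 2 - 2 * t)) with hc
    have hc0 : 0 < c := by positivity
    have key := hΩ.greenOp_le (h := h) (c := c * Q ^ (-t))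
      (U := fun x => c * (‖x - x₀‖ ^ 2 + δ ^ 2) ^ (-t)) (fun x _ =>
        contDiffAt_const.mul (contDiffAt_rpow_sq_add x₀ x hδ.1 _))
      (mul_pos hc0 (Real.rpow_pos_of_pos hQ0 _)) (fun x hx => ?_) ?_
    · have := hm c hc0 x₀ hx₀ δ hδ _ key
      rw [pow_succ, show C / (2 * t * (N - 2 - 2 * t)) * K = C * c by rw [hc]; ring]
      exact this
    · refine mul_le_mul_of_nonneg_left ?_ hc0.le
      exact Real.rpow_le_rpow_of_nonpos (hq0 x) (hQ x hx x₀ hx₀ δ hδ) (by linarith)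
    · filter_upwards [hh] with x hx
      refine hx.trans ?_
      rw [lap_const_mul _ (contDiffAt_rpow_sq_add x₀ x hδ.1 _), lap_rpow_sq_add x₀ x hδ.1]
      set q := ‖x - x₀‖ ^ 2 + δ ^ 2
      have hq := hq0 x
      have e1 : q ^ (-s) = q ^ (-t - 2) * q := by
        rw [← Real.rpow_add_one hq.ne']; congr 1; rw [ht]; ring
      have e2 : K = c * (2 * t * (N - 2 - 2 * t)) := by rw [hc]; field_simp
      have hp := Real.rpow_pos_of_pos hq (-t - 2)
      have h4 : (N - 2 - 2 * t) * q ≤ (N + 2 * (-t - 1)) * q - 2 * (-t - 1) * δ ^ 2 := by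
        nlinarith [mul_nonneg ht0.le (sq_nonneg δ), sq_nonneg δ]
      rw [e1, e2]
      calc c * (2 * t * (N - 2 - 2 * t)) * (q ^ (-t - 2) * q)
          = c * (2 * t * q ^ (-t - 2) * ((N - 2 - 2 * t) * q)) := by ring
        _ ≤ c * (2 * t * q ^ (-t - 2) * ((N + 2 * (-t - 1)) * q - 2 * (-t - 1) * δ ^ 2)) := by
            gcongr
        _ = _ := by ring

theorem IsDom.exists_greenOp_const (hΩ : IsDom Ω) : ∃ C, 0 < C ∧ ∀ K, 0 < K → ∀ h : L2 Ω,
    (∀ᵐ x ∂(volume : Measure (Euc N)).restrict Ω, h x ≤ K) →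
      ∀ᵐ x ∂(volume : Measure (Euc N)).restrict Ω, greenOp Ω h x ≤ C * K := by
  obtain ⟨Q, hQ1, hQ⟩ := hΩ.exists_dist_bound
  have hQ0 : 0 < Q := by linarith
  have hN : (2 : ℝ) ≤ N := by exact_mod_cast hΩ.dim
  obtain ⟨C, hC, h0⟩ := hΩ.exists_pow_bound 0 (1 / 2) (by norm_num) (by norm_num) (by linarith)
  obtain ⟨x₀, hx₀⟩ := hΩ.conn.nonempty
  refine ⟨C * Q ^ (1 / 2 : ℝ), by positivity, fun K hK h hh => ?_⟩
  have := h0 (Q ^ (1 / 2 : ℝ) * K) (by positivity) x₀ hx₀ 1 ⟨one_pos, le_rfl⟩ h ?_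
  · simpa only [zero_add, pow_one, mul_assoc] using this
  · filter_upwards [hh, ae_restrict_mem hΩ.isOpen.measurableSet] with x hx hxΩ
    have hq := sq_add_pos x₀ x one_pos
    have h1 := hQ x hxΩ x₀ hx₀ 1 ⟨one_pos, le_rfl⟩
    set q := ‖x - x₀‖ ^ 2 + (1 : ℝ) ^ 2
    have h2 : 1 ≤ Q ^ (1 / 2 : ℝ) * q ^ (-(1 / 2) : ℝ) := by
      rw [Real.rpow_neg hq.le, ← div_eq_mul_inv, one_le_div (by positivity)]
      exact Real.rpow_le_rpow hq.le h1 (by norm_num)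
    calc h x ≤ K := hx
      _ ≤ K * (Q ^ (1 / 2 : ℝ) * q ^ (-(1 / 2) : ℝ)) := le_mul_of_one_le_right hK.le h2
      _ = _ := by ring

/-- The Green potential of a concentrated source. -/
theorem IsDom.exists_greenOp_concentrated (hΩ : IsDom Ω) : ∃ C, 0 < C ∧
    ∀ x₀ ∈ Ω, ∀ δ ∈ Ioc (0 : ℝ) 1, ∀ h : L2 Ω,
      (∀ᵐ x ∂(volume : Measure (Euc N)).restrict Ω,
        h x ≤ δ ^ 2 * (‖x - x₀‖ ^ 2 + δ ^ 2) ^ (-(N / 2 + 1) : ℝ)) →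
      ∀ᵐ x ∂(volume : Measure (Euc N)).restrict Ω,
        greenOp Ω h x ≤ C * (‖x - x₀‖ ^ 2 + δ ^ 2) ^ (-(N / 2 - 3 / 4) : ℝ) := by
  obtain ⟨Q, hQ1, hQ⟩ := hΩ.exists_dist_bound
  have hQ0 : 0 < Q := by linarith
  rcases hΩ.dim.eq_or_lt with rfl | hN
  · refine ⟨(Q + 1) ^ (1 / 4 : ℝ), by positivity, fun x₀ hx₀ δ hδ h hh => ?_⟩
    have hq0 : ∀ x : Euc 2, 0 < ‖x - x₀‖ ^ 2 + δ ^ 2 := fun x => sq_add_pos x₀ x hδ.1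
    have hcd : ∀ x, ContDiffAt ℝ 2 (fun x : Euc 2 => Real.log (‖x - x₀‖ ^ 2 + δ ^ 2)) x :=
      fun x => (contDiffAt_sq_add x₀ x).log (hq0 x).ne'
    have key := hΩ.greenOp_le (h := h) (c := 4⁻¹ * (Real.log (Q + 1) - Real.log Q))
      (U := fun x => 4⁻¹ * (Real.log (Q + 1) - Real.log (‖x - x₀‖ ^ 2 + δ ^ 2))) (fun x _ =>
        contDiffAt_const.mul (contDiffAt_const.sub (hcd x)))
      (mul_pos (by norm_num) (sub_pos.2 (Real.log_lt_log hQ0 (by linarith)))) (fun x hx => ?_) ?_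
    · filter_upwards [key] with x hx
      refine hx.trans ?_
      have hq := hq0 x
      set q := ‖x - x₀‖ ^ 2 + δ ^ 2
      rw [← Real.log_div (by positivity) hq.ne']
      have h1 := Real.log_le_rpow_div (x := (Q + 1) / q) (by positivity)
        (show (0 : ℝ) < 1 / 4 by norm_num)
      rw [Real.div_rpow (by positivity) hq.le] at h1
      have e : (-((2 : ℕ) / 2 - 3 / 4) : ℝ) = -(1 / 4) := by norm_num
      rw [e, Real.rpow_neg hq.le]
      calc _ ≤ 4⁻¹ * ((Q + 1) ^ (1 / 4 : ℝ) / q ^ (1 / 4 : ℝ) / (1 / 4)) := by gcongr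
        _ = _ := by ring
    · have := Real.log_le_log (hq0 x) (hQ x hx x₀ hx₀ δ hδ)
      gcongr
    · filter_upwards [hh] with x hx
      refine hx.trans ?_
      rw [lap_const_mul _ (contDiffAt_const.sub (hcd x)), lap_sub contDiffAt_const (hcd x),
        lap_const, lap_log_sq_add x₀ x hδ.1]
      have e : (-((2 : ℕ) / 2 + 1) : ℝ) = -2 := by norm_num
      rw [e]
      exact le_of_eq (by ring)
  · have hN3 : (3 : ℝ) ≤ N := by exact_mod_cast hN
    refine ⟨Q ^ (1 / 4 : ℝ) / (N * (N - 2)),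
      div_pos (by positivity) (mul_pos (by linarith) (by linarith)), fun x₀ hx₀ δ hδ h hh => ?_⟩
    have hq0 : ∀ x : Euc N, 0 < ‖x - x₀‖ ^ 2 + δ ^ 2 := fun x => sq_add_pos x₀ x hδ.1
    set t : ℝ := (N - 2) / 2 with ht
    have ht0 : 0 < t := by rw [ht]; linarith
    set c : ℝ := 1 / (N * (N - 2)) with hc
    have hc0 : 0 < c := div_pos one_pos (mul_pos (by linarith) (by linarith))
    have key := hΩ.greenOp_le (h := h) (c := c * Q ^ (-t))
      (U := fun x => c * (‖x - x₀‖ ^ 2 + δ ^ 2) ^ (-t)) (fun x _ =>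
        contDiffAt_const.mul (contDiffAt_rpow_sq_add x₀ x hδ.1 _))
      (mul_pos hc0 (Real.rpow_pos_of_pos hQ0 _)) (fun x hx => ?_) ?_
    · filter_upwards [key, ae_restrict_mem hΩ.isOpen.measurableSet] with x hx hxΩ
      refine hx.trans ?_
      have hq := hq0 x
      have hqQ := hQ x hxΩ x₀ hx₀ δ hδ
      set q := ‖x - x₀‖ ^ 2 + δ ^ 2
      have e1 : q ^ (-t) = q ^ (1 / 4 : ℝ) * q ^ (-(N / 2 - 3 / 4) : ℝ) := by
        rw [← Real.rpow_add hq]; congr 1; rw [ht]; ring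
      rw [e1, show Q ^ (1 / 4 : ℝ) / (N * (N - 2)) = c * Q ^ (1 / 4 : ℝ) by rw [hc]; ring,
        mul_assoc]
      have h1 := Real.rpow_le_rpow hq.le hqQ (show (0 : ℝ) ≤ 1 / 4 by norm_num)
      have h2 := Real.rpow_pos_of_pos hq (-(N / 2 - 3 / 4) : ℝ)
      gcongr
    · refine mul_le_mul_of_nonneg_left ?_ hc0.le
      exact Real.rpow_le_rpow_of_nonpos (hq0 x) (hQ x hx x₀ hx₀ δ hδ) (by linarith)
    · filter_upwards [hh] with x hx
      refine hx.trans (le_of_eq ?_)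
      rw [lap_const_mul _ (contDiffAt_rpow_sq_add x₀ x hδ.1 _), lap_rpow_sq_add x₀ x hδ.1]
      have e1 : (-(N / 2 + 1) : ℝ) = -t - 2 := by rw [ht]; ring
      have e2 : c * (N * (N - 2)) = 1 := by
        rw [hc]; exact one_div_mul_cancel (mul_pos (by linarith) (by linarith)).ne'
      have e3 : (N : ℝ) = 2 * t + 2 := by rw [ht]; ring
      rw [e1]
      set P := (‖x - x₀‖ ^ 2 + δ ^ 2) ^ (-t - 2)
      calc δ ^ 2 * P = c * (N * (N - 2)) * (δ ^ 2 * P) := by rw [e2, one_mul]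
        _ = _ := by rw [e3]; ring

end Order

section Smoothing

variable {N : ℕ} {Ω : Set (Euc N)}

theorem IsDom.integrable (hΩ : IsDom Ω) (h : L2 Ω) :
    Integrable h ((volume : Measure (Euc N)).restrict Ω) :=
  have := hΩ.isFiniteMeasure
  (Lp.memLp h).integrable one_le_two

theorem inner_toLp (f : L2 Ω) {g : Euc N → ℝ} (hg : MemLp g 2 (volume.restrict Ω)) :
    inner ℝ f (hg.toLp g) = ∫ x in Ω, f x * g x := by
  rw [L2_inner]
  refine integral_congr_ae ?_
  filter_upwards [hg.coeFn_toLp] with x hx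
  rw [hx]

theorem volume_closedBall_toReal (x₀ : Euc N) {δ : ℝ} (hδ : 0 ≤ δ) :
    (volume : Measure (Euc N)).real (Metric.closedBall x₀ δ)
      = δ ^ N * (volume : Measure (Euc N)).real (Metric.ball 0 1) := by
  rw [Measure.real, Measure.addHaar_closedBall _ _ hδ, ENNReal.toReal_mul,
    ENNReal.toReal_ofReal (by positivity), finrank_euclideanSpace_fin]
  rfl

/-- An approximate identity concentrating at `x₀`. -/
def conc (x₀ : Euc N) (δ : ℝ) (x : Euc N) : ℝ :=
  δ ^ 2 * (‖x - x₀‖ ^ 2 + δ ^ 2) ^ (-(N / 2 + 1) : ℝ)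

theorem continuous_conc (x₀ : Euc N) {δ : ℝ} (hδ : 0 < δ) : Continuous (conc x₀ δ) :=
  continuous_iff_continuousAt.2 fun x =>
    continuousAt_const.mul (contDiffAt_rpow_sq_add x₀ x hδ _).continuousAt

theorem conc_nonneg (x₀ : Euc N) {δ : ℝ} (hδ : 0 < δ) (x : Euc N) : 0 ≤ conc x₀ δ x :=
  mul_nonneg (sq_nonneg _) (Real.rpow_pos_of_pos (sq_add_pos x₀ x hδ) _).le

theorem norm_conc_le (x₀ : Euc N) {δ : ℝ} (hδ : 0 < δ) (x : Euc N) :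
    ‖conc x₀ δ x‖ ≤ δ ^ 2 * (δ ^ 2) ^ (-(N / 2 + 1) : ℝ) := by
  rw [Real.norm_of_nonneg (conc_nonneg x₀ hδ x)]
  refine mul_le_mul_of_nonneg_left ?_ (sq_nonneg _)
  refine Real.rpow_le_rpow_of_nonpos (pow_pos hδ 2) (by nlinarith [sq_nonneg ‖x - x₀‖]) ?_
  have : (0 : ℝ) ≤ N := N.cast_nonneg
  linarith

theorem le_conc (x₀ : Euc N) {δ : ℝ} (hδ : 0 < δ) {x : Euc N}
    (hx : x ∈ Metric.closedBall x₀ δ) :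
    (2 ^ (N / 2 + 1 : ℝ))⁻¹ * (δ ^ N)⁻¹ ≤ conc x₀ δ x := by
  have hE0 : (0 : ℝ) < N / 2 + 1 := by positivity
  rw [Metric.mem_closedBall, dist_eq_norm] at hx
  have h2 : ‖x - x₀‖ ^ 2 ≤ δ ^ 2 := by gcongr
  have h3 : (2 * δ ^ 2) ^ (-(N / 2 + 1) : ℝ) ≤ (‖x - x₀‖ ^ 2 + δ ^ 2) ^ (-(N / 2 + 1) : ℝ) :=
    Real.rpow_le_rpow_of_nonpos (sq_add_pos x₀ x hδ) (by linarith) (by linarith)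
  have h4 : (2 * δ ^ 2) ^ (-(N / 2 + 1) : ℝ)
      = (2 ^ (N / 2 + 1 : ℝ))⁻¹ * ((δ ^ N)⁻¹ * (δ ^ 2)⁻¹) := by
    rw [Real.rpow_neg (by positivity), Real.mul_rpow (by norm_num) (by positivity), mul_inv,
      ← mul_inv (δ ^ N)]
    congr 2
    have h5 : ((N : ℝ) / 2 + 1) = ((N + 2 : ℕ) : ℝ) / 2 := by push_cast; ring
    have h6 : (δ ^ 2) ^ (((N + 2 : ℕ) : ℝ) / 2) = δ ^ (N + 2) := by
      rw [Real.rpow_div_two_eq_sqrt _ (sq_nonneg δ), Real.sqrt_sq hδ.le, Real.rpow_natCast]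
    rw [h5, h6, pow_add]
  calc (2 ^ (N / 2 + 1 : ℝ))⁻¹ * (δ ^ N)⁻¹
      = δ ^ 2 * ((2 ^ (N / 2 + 1 : ℝ))⁻¹ * ((δ ^ N)⁻¹ * (δ ^ 2)⁻¹)) := by field_simp
    _ ≤ _ := by
        rw [← h4]
        exact mul_le_mul_of_nonneg_left h3 (sq_nonneg _)

theorem IsDom.memLp_conc (hΩ : IsDom Ω) (x₀ : Euc N) {δ : ℝ} (hδ : 0 < δ) :
    MemLp (conc x₀ δ) 2 (volume.restrict Ω) :=
  have := hΩ.isFiniteMeasure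
  MemLp.of_bound (continuous_conc x₀ hδ).aestronglyMeasurable _
    (Eventually.of_forall (norm_conc_le x₀ hδ))

theorem IsDom.exists_pow_conc_bound (hΩ : IsDom Ω) : ∃ k : ℕ, ∃ C, 0 < C ∧
    ∀ x₀ ∈ Ω, ∀ δ ∈ Ioc (0 : ℝ) 1, ∀ h : L2 Ω,
      (∀ᵐ x ∂(volume : Measure (Euc N)).restrict Ω, h x ≤ conc x₀ δ x) →
      ∀ᵐ x ∂(volume : Measure (Euc N)).restrict Ω, (greenOp Ω ^ k) h x ≤ C := by
  have hN : (2 : ℝ) ≤ N := by exact_mod_cast hΩ.dim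
  have hs0 : (0 : ℝ) ≤ N / 2 - 3 / 4 := by linarith
  obtain ⟨m, hm1, hm2⟩ : ∃ m : ℕ, (m : ℝ) < N / 2 - 3 / 4 ∧ (N / 2 - 3 / 4 : ℝ) < m + 1 := by
    refine ⟨⌊(N / 2 - 3 / 4 : ℝ)⌋₊, (Nat.floor_le hs0).lt_of_ne fun h => ?_,
      Nat.lt_floor_add_one _⟩
    have h1 : ((4 * ⌊(N / 2 - 3 / 4 : ℝ)⌋₊ + 3 : ℕ) : ℝ) = ((2 * N : ℕ) : ℝ) := by
      push_cast; linarith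
    have h2 := Nat.cast_injective h1
    omega
  obtain ⟨C₂, hC₂, h2⟩ := hΩ.exists_pow_bound m _ hm1 hm2 (by linarith)
  obtain ⟨C₁, hC₁, h1⟩ := hΩ.exists_greenOp_concentrated
  refine ⟨m + 1 + 1, C₂ * C₁, by positivity, fun x₀ hx₀ δ hδ h hh => ?_⟩
  have h3 := h2 C₁ hC₁ x₀ hx₀ δ hδ _ (h1 x₀ hx₀ δ hδ h hh)
  rw [pow_succ]
  exact h3

theorem IsDom.integral_greenOp_pow_mul_le (hΩ : IsDom Ω) : ∃ k : ℕ, ∃ C, 0 < C ∧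
    ∀ h : L2 Ω, 0 ≤ h → ∀ x₀ ∈ Ω, ∀ δ ∈ Ioc (0 : ℝ) 1,
      ∫ x in Ω, (greenOp Ω ^ k) h x * conc x₀ δ x ≤ C * ∫ x in Ω, h x := by
  obtain ⟨k, C, hC, hk⟩ := hΩ.exists_pow_conc_bound
  refine ⟨k, C, hC, fun h hh x₀ hx₀ δ hδ => ?_⟩
  have hmem := hΩ.memLp_conc x₀ hδ.1
  have h3 := hk x₀ hx₀ δ hδ (hmem.toLp _) (by
    filter_upwards [hmem.coeFn_toLp] with x hx
    rw [hx])
  rw [← inner_toLp ((greenOp Ω ^ k) h) hmem, greenOp_pow_symm k h, L2_inner,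
    ← integral_const_mul]
  refine integral_mono_ae ((Lp.memLp _).integrable_mul (Lp.memLp _))
    ((hΩ.integrable h).const_mul _) ?_
  rw [← Lp.coeFn_nonneg] at hh
  filter_upwards [h3, hh] with x hx hx'
  rw [mul_comm]
  exact mul_le_mul_of_nonneg_right hx hx'

theorem setIntegral_closedBall_le {w : Euc N → ℝ}
    (hw : IntegrableOn w Ω) (hw0 : 0 ≤ᵐ[volume.restrict Ω] w) {x₀ : Euc N} {δ : ℝ} (hδ : 0 < δ)
    (hball : Metric.closedBall x₀ δ ⊆ Ω) :
    ∫ x in Metric.closedBall x₀ δ, w x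
      ≤ 2 ^ (N / 2 + 1 : ℝ) * δ ^ N * ∫ x in Ω, w x * conc x₀ δ x := by
  have h_int : IntegrableOn (fun x => w x * conc x₀ δ x) Ω :=
    hw.mul_bdd (continuous_conc x₀ hδ).aestronglyMeasurable
      (Eventually.of_forall (norm_conc_le x₀ hδ))
  have h5 : ∫ x in Metric.closedBall x₀ δ, w x * ((2 ^ (N / 2 + 1 : ℝ))⁻¹ * (δ ^ N)⁻¹)
      ≤ ∫ x in Ω, w x * conc x₀ δ x := by
    refine le_trans ?_ (setIntegral_mono_set h_int ?_ hball.eventuallyLE)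
    · refine setIntegral_mono_ae_restrict ((hw.mono_set hball).mul_const _)
        (h_int.mono_set hball) ?_
      filter_upwards [ae_restrict_of_ae_restrict_of_subset hball hw0,
        ae_restrict_mem Metric.isClosed_closedBall.measurableSet] with x h6 h7
      exact mul_le_mul_of_nonneg_left (le_conc x₀ hδ h7) h6
    · filter_upwards [hw0] with x hx
      exact mul_nonneg hx (conc_nonneg x₀ hδ x)
  rw [integral_mul_const] at h5
  have h6 : (0 : ℝ) < 2 ^ (N / 2 + 1 : ℝ) := by positivity
  have h7 : (0 : ℝ) < δ ^ N := by positivity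
  rw [← mul_inv, ← div_eq_mul_inv, div_le_iff₀ (by positivity)] at h5
  linarith

theorem ae_le_of_closedBall_average_le (hΩ : IsOpen Ω) {w : Euc N → ℝ}
    (hw : IntegrableOn w Ω) {B : ℝ} (h : ∀ x₀ ∈ Ω, ∀ δ ∈ Ioc (0 : ℝ) 1,
      Metric.closedBall x₀ δ ⊆ Ω → ∫ x in Metric.closedBall x₀ δ, w x
        ≤ B * (volume : Measure (Euc N)).real (Metric.closedBall x₀ δ)) :
    ∀ᵐ x ∂(volume : Measure (Euc N)).restrict Ω, w x ≤ B := by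
  have hwi : Integrable (Ω.indicator w) := IntegrableOn.integrable_indicator hw hΩ.measurableSet
  have hleb := IsUnifLocDoublingMeasure.ae_tendsto_average (μ := (volume : Measure (Euc N)))
    hwi.locallyIntegrable 1
  rw [ae_restrict_iff' hΩ.measurableSet]
  filter_upwards [hleb] with x₀ hx hx₀
  have hlim := hx (l := 𝓝[>] (0 : ℝ)) (fun _ => x₀) (fun δ => δ) tendsto_id (by
    filter_upwards [self_mem_nhdsWithin] with δ hδ
    exact Metric.mem_closedBall_self (by rw [one_mul]; exact (mem_Ioi.1 hδ).le))
  rw [indicator_of_mem hx₀] at hlim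
  obtain ⟨r, hr0, hr⟩ := Metric.isOpen_iff.1 hΩ x₀ hx₀
  refine le_of_tendsto hlim ?_
  filter_upwards [self_mem_nhdsWithin, mem_nhdsWithin_of_mem_nhds (Iio_mem_nhds hr0),
    mem_nhdsWithin_of_mem_nhds (Iio_mem_nhds one_pos)] with δ hδ0 hδr hδ1
  rw [mem_Ioi] at hδ0
  have hball : Metric.closedBall x₀ δ ⊆ Ω := (Metric.closedBall_subset_ball hδr).trans hr
  have hpos : 0 < (volume : Measure (Euc N)).real (Metric.closedBall x₀ δ) :=
    ENNReal.toReal_pos (Metric.measure_closedBall_pos _ _ hδ0).ne' measure_closedBall_lt_top.ne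
  have h6 : ∫ x in Metric.closedBall x₀ δ, Ω.indicator w x
      = ∫ x in Metric.closedBall x₀ δ, w x :=
    setIntegral_congr_fun Metric.isClosed_closedBall.measurableSet
      fun x hx => indicator_of_mem (hball hx) _
  rw [setAverage_eq, smul_eq_mul, inv_mul_le_iff₀ hpos, h6, mul_comm]
  exact h x₀ hx₀ δ ⟨hδ0, (mem_Iio.1 hδ1).le⟩ hball

/-- Powers of the Green operator map `L¹` to `L^∞`. -/
theorem IsDom.exists_smoothing (hΩ : IsDom Ω) : ∃ k : ℕ, ∃ C, 0 < C ∧ ∀ h : L2 Ω, 0 ≤ h →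
    ∀ᵐ x ∂(volume : Measure (Euc N)).restrict Ω, (greenOp Ω ^ k) h x ≤ C * ∫ y in Ω, h y := by
  obtain ⟨k, C, hC, hk⟩ := hΩ.integral_greenOp_pow_mul_le
  obtain ⟨V, hV⟩ : ∃ V, V = (volume : Measure (Euc N)).real (Metric.ball 0 1) := ⟨_, rfl⟩
  have hV0 : 0 < V := by
    rw [hV]
    exact ENNReal.toReal_pos (Metric.measure_ball_pos _ _ one_pos).ne' measure_ball_lt_top.ne
  refine ⟨k, C * 2 ^ (N / 2 + 1 : ℝ) / V, by positivity, fun h hh => ?_⟩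
  refine ae_le_of_closedBall_average_le hΩ.isOpen (hΩ.integrable _)
    fun x₀ hx₀ δ hδ hball => ?_
  have h1 := setIntegral_closedBall_le (hΩ.integrable _)
    ((Lp.coeFn_nonneg _).2 (hΩ.greenOp_pow_nonneg k hh)) hδ.1 hball
  have h2 := hk h hh x₀ hx₀ δ hδ
  have hδN : 0 < δ ^ N := pow_pos hδ.1 N
  rw [volume_closedBall_toReal x₀ hδ.1.le, ← hV]
  refine h1.trans ?_
  calc _ ≤ 2 ^ (N / 2 + 1 : ℝ) * δ ^ N * (C * ∫ x in Ω, h x) := by gcongr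
    _ = _ := by field_simp

theorem IsDom.exists_smoothing_ge (hΩ : IsDom Ω) : ∃ k₀ : ℕ, ∀ k, k₀ ≤ k → ∃ C, 0 < C ∧
    ∀ h : L2 Ω, 0 ≤ h → ∀ᵐ x ∂(volume : Measure (Euc N)).restrict Ω,
      (greenOp Ω ^ k) h x ≤ C * ∫ y in Ω, h y := by
  obtain ⟨k₀, h0⟩ := hΩ.exists_smoothing
  obtain ⟨C₁, hC₁, h1⟩ := hΩ.exists_greenOp_const
  refine ⟨k₀, fun k hk => ?_⟩
  induction k, hk using Nat.le_induction with
  | base => exact h0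
  | succ k _ ih =>
    obtain ⟨C, hC, hk⟩ := ih
    refine ⟨C₁ * C, by positivity, fun h hh => ?_⟩
    have hi : 0 ≤ ∫ y in Ω, h y := integral_nonneg_of_ae ((Lp.coeFn_nonneg _).2 hh)
    refine ae_le_const_of_forall_pos fun c hc => ?_
    have hc1 : 0 < C₁⁻¹ * c := by positivity
    have h2 := h1 (C * (∫ y in Ω, h y) + C₁⁻¹ * c) (by positivity) ((greenOp Ω ^ k) h) (by
      filter_upwards [hk h hh] with x hx
      linarith)
    rw [mul_add, mul_inv_cancel_left₀ hC₁.ne', ← mul_assoc] at h2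
    rw [pow_succ']
    exact h2

theorem IsDom.integral_abs_le (hΩ : IsDom Ω) (h : L2 Ω) :
    ∫ x in Ω, |h x| ≤ √((volume : Measure (Euc N)).real Ω) * ‖h‖ := by
  have := hΩ.isFiniteMeasure
  have h1 : MemLp (fun _ : Euc N => (1 : ℝ)) 2 (volume.restrict Ω) := memLp_const 1
  have h2 : ∫ x in Ω, |h x| = inner ℝ |h| (h1.toLp _) := by
    rw [inner_toLp |h| h1]
    refine integral_congr_ae ?_
    filter_upwards [Lp.coeFn_abs h] with x hx
    rw [hx, mul_one]
  have h3 : ‖h1.toLp _‖ = √((volume : Measure (Euc N)).real Ω) := by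
    rw [← Real.sqrt_sq (norm_nonneg _), ← real_inner_self_eq_norm_sq, inner_toLp _ h1]
    congr 1
    have : ∫ x in Ω, (h1.toLp (fun _ : Euc N => (1 : ℝ))) x * 1 = ∫ x in Ω, (1 : ℝ) := by
      refine integral_congr_ae ?_
      filter_upwards [h1.coeFn_toLp] with x hx
      rw [hx, mul_one]
    rw [this]
    simp
  rw [h2, ← h3, mul_comm]
  refine (real_inner_le_norm _ _).trans_eq ?_
  rw [norm_abs_eq_norm]

/-- Powers of the Green operator map `L²` to `L^∞`. -/
theorem IsDom.exists_abs_pow_le (hΩ : IsDom Ω) : ∃ k₀ : ℕ, ∀ k, k₀ ≤ k → ∃ C, 0 < C ∧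
    ∀ h : L2 Ω, ∀ᵐ x ∂(volume : Measure (Euc N)).restrict Ω,
      |(greenOp Ω ^ k) h x| ≤ C * ‖h‖ := by
  obtain ⟨k₀, h0⟩ := hΩ.exists_smoothing_ge
  refine ⟨k₀, fun k hk => ?_⟩
  obtain ⟨C, hC, hCk⟩ := h0 k hk
  refine ⟨C * (√((volume : Measure (Euc N)).real Ω) + 1), by positivity, fun h => ?_⟩
  have h1 := (Lp.coeFn_le _ _).2 (hΩ.greenOp_pow_mono k (le_abs_self h))
  have h2 := (Lp.coeFn_le _ _).2 (hΩ.greenOp_pow_mono k (neg_le_abs h))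
  rw [map_neg] at h2
  filter_upwards [h1, h2, hCk |h| (abs_nonneg h), Lp.coeFn_neg ((greenOp Ω ^ k) h)]
    with x h3 h4 h5 h6
  rw [h6, Pi.neg_apply] at h4
  have h7 : ∫ y in Ω, |h| y = ∫ y in Ω, |h y| := integral_congr_ae (Lp.coeFn_abs h)
  have h8 := hΩ.integral_abs_le h
  rw [h7] at h5
  refine (abs_le.2 ⟨by linarith, by linarith⟩ : _ ≤ C * ∫ y in Ω, |h y|).trans ?_
  rw [mul_assoc]
  gcongr
  nlinarith [norm_nonneg h]

end Smoothing

section Compactness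

variable {E F : Type*} [NormedAddCommGroup E] [InnerProductSpace ℝ E] [NormedAddCommGroup F]
  [InnerProductSpace ℝ F]

theorem isCompactOperator_rankOne (a : E) (y : F) :
    IsCompactOperator ((ContinuousLinearMap.toSpanSingleton ℝ y).comp (innerSL ℝ a)) := by
  have h : IsCompactOperator (innerSL ℝ a : E →L[ℝ] ℝ) :=
    isCompactOperator_of_locallyCompactSpace_dom _
  exact h.clm_comp (ContinuousLinearMap.toSpanSingleton ℝ y)

theorem norm_sum_smul_le {ι : Type*} (s : Finset ι) (a : ι → ℝ) (y : ι → F) :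
    ‖∑ i ∈ s, a i • y i‖ ≤ √(∑ i ∈ s, a i ^ 2) * √(∑ i ∈ s, ‖y i‖ ^ 2) := by
  have h1 : ‖∑ i ∈ s, a i • y i‖ ≤ ∑ i ∈ s, |a i| * ‖y i‖ :=
    (norm_sum_le _ _).trans_eq (Finset.sum_congr rfl fun i _ => by rw [norm_smul, Real.norm_eq_abs])
  refine h1.trans ((Real.sum_mul_le_sqrt_mul_sqrt s _ _).trans_eq ?_)
  simp only [sq_abs]

/-- Hilbert–Schmidt operators are compact. -/
theorem isCompactOperator_of_sum_sq_le [CompleteSpace E] [CompleteSpace F] (T : E →L[ℝ] F) (C : ℝ)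
    (hT : ∀ (s : Finset E), Orthonormal ℝ (Subtype.val : s → E) →
      ∑ i ∈ s, ‖T i‖ ^ 2 ≤ C) : IsCompactOperator T := by
  obtain ⟨w, b, hb⟩ := exists_hilbertBasis ℝ E
  have hsum : Summable fun i : w => ‖T (b i)‖ ^ 2 := by
    refine summable_of_sum_le (fun i => sq_nonneg _) (c := C) fun u => ?_
    have h1 := hT (u.map ⟨Subtype.val, Subtype.val_injective⟩) (by
      have h2 := b.orthonormal
      rw [hb] at h2
      have h3 : ∀ i : (u.map ⟨Subtype.val, Subtype.val_injective⟩ : Finset E), (i : E) ∈ w := by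
        rintro ⟨i, hi⟩
        obtain ⟨j, _, rfl⟩ := Finset.mem_map.1 hi
        exact j.2
      exact h2.comp (fun i : (u.map ⟨Subtype.val, Subtype.val_injective⟩ : Finset E) =>
        (⟨i, h3 i⟩ : w)) fun i j hij =>
        Subtype.ext (congrArg (fun z : w => (z : E)) hij))
    rw [Finset.sum_map] at h1
    simpa [hb] using h1
  have hcl : T ∈ closure {S : E →L[ℝ] F | IsCompactOperator S} := by
    rw [Metric.mem_closure_iff]
    intro ε hε
    obtain ⟨s, hs⟩ := (summable_iff_vanishing_norm.1 hsum) ((ε / 2) ^ 2) (by positivity)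
    refine ⟨∑ i ∈ s, (ContinuousLinearMap.toSpanSingleton ℝ (T (b i))).comp (innerSL ℝ (b i)),
      ?_, ?_⟩
    · refine Finset.sum_induction _ (fun S : E →L[ℝ] F => IsCompactOperator S)
        (fun S S' h h' => h.add h') isCompactOperator_zero
        fun i _ => isCompactOperator_rankOne _ _
    · rw [dist_eq_norm]
      refine lt_of_le_of_lt (ContinuousLinearMap.opNorm_le_bound _ (half_pos hε).le fun x => ?_)
        (half_lt_self hε)
      have hlim : Tendsto (fun u : Finset w => ‖∑ i ∈ u, inner ℝ (b i) x • T (b i)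
          - ∑ i ∈ s, inner ℝ (b i) x • T (b i)‖) atTop
          (𝓝 ‖T x - ∑ i ∈ s, inner ℝ (b i) x • T (b i)‖) := by
        have h1 : HasSum (fun i => inner ℝ (b i) x • T (b i)) (T x) := by
          have h2 := (b.hasSum_repr x).mapL T
          simpa [b.repr_apply_apply] using h2
        exact (h1.sub_const _).norm
      have h3 : (T - ∑ i ∈ s, (ContinuousLinearMap.toSpanSingleton ℝ (T (b i))).comp
          (innerSL ℝ (b i))) x = T x - ∑ i ∈ s, inner ℝ (b i) x • T (b i) := by
        simp
      rw [h3]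
      refine le_of_tendsto hlim ?_
      filter_upwards [eventually_ge_atTop s] with u hu
      classical
      rw [← Finset.sum_sdiff hu, add_sub_cancel_right]
      refine (norm_sum_smul_le _ _ _).trans ?_
      rw [mul_comm]
      refine mul_le_mul ?_ ?_ (Real.sqrt_nonneg _) (half_pos hε).le
      · rw [Real.sqrt_le_left (half_pos hε).le]
        exact ((le_abs_self _).trans_lt (hs (u \ s) Finset.sdiff_disjoint)).le
      · rw [Real.sqrt_le_left (norm_nonneg _)]
        have h4 := b.orthonormal.sum_inner_products_le x (s := u \ s)
        simpa using h4
  exact isClosed_setOfPred_isCompactOperator.closure_subset hcl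

/-- A symmetric operator with compact square is compact. -/
theorem isCompactOperator_of_sq [CompleteSpace E] (A : E →L[ℝ] E)
    (hA : ∀ x y, inner ℝ (A x) y = inner ℝ x (A y)) (h : IsCompactOperator (A * A)) :
    IsCompactOperator A := by
  have hsq : ∀ x, ‖A x‖ ^ 2 ≤ ‖A (A x)‖ * ‖x‖ := fun x => by
    rw [← real_inner_self_eq_norm_sq, ← hA (A x) x]
    exact real_inner_le_norm _ _
  have h1 : TotallyBounded ((A * A) '' Metric.closedBall 0 1) :=
    ((isCompactOperator_iff_isCompact_closure_image_closedBall (A * A).toLinearMap one_pos).1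
      h).totallyBounded.subset subset_closure
  have h2 : TotallyBounded (A '' Metric.closedBall 0 1) := by
    rw [Metric.totallyBounded_iff]
    intro ε hε
    obtain ⟨t, ht, htf, hcov⟩ := Metric.finite_approx_of_totallyBounded h1 (ε ^ 2 / 2)
      (by positivity)
    obtain ⟨s, hs, hsf, hcov⟩ := (exists_subset_image_finite_and
      (p := fun t => (A * A) '' Metric.closedBall 0 1 ⊆ ⋃ y ∈ t, Metric.ball y (ε ^ 2 / 2))).1 ⟨t, ht, htf, hcov⟩
    refine ⟨A '' s, hsf.image _, ?_⟩
    rintro _ ⟨x, hx, rfl⟩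
    have h3 := hcov ⟨x, hx, rfl⟩
    simp only [mem_iUnion] at h3 ⊢
    obtain ⟨_, ⟨y, hy, rfl⟩, h4⟩ := h3
    refine ⟨A y, ⟨y, hy, rfl⟩, ?_⟩
    rw [Metric.mem_ball, dist_eq_norm] at h4 ⊢
    rw [← map_sub] at h4 ⊢
    have h5 := hsq (x - y)
    have hx1 : ‖x‖ ≤ 1 := by simpa using hx
    have hy1 : ‖y‖ ≤ 1 := by simpa using hs hy
    have h6 : ‖x - y‖ ≤ 2 := (norm_sub_le _ _).trans (by linarith)
    have h7 : ‖A (A (x - y))‖ < ε ^ 2 / 2 := h4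
    refine lt_of_pow_lt_pow_left₀ 2 hε.le ?_
    have h8 : ‖A (A (x - y))‖ * ‖x - y‖ ≤ ‖A (A (x - y))‖ * 2 := by gcongr
    linarith
  refine (isCompactOperator_iff_isCompact_closure_image_closedBall A.toLinearMap one_pos).2 ?_
  exact h2.closure.isCompact_of_isClosed isClosed_closure

variable {N : ℕ} {Ω : Set (Euc N)}

theorem ae_sum_sq_le {T : L2 Ω →L[ℝ] L2 Ω} {C : ℝ} (hC : 0 ≤ C)
    (hT : ∀ h, ∀ᵐ x ∂(volume : Measure (Euc N)).restrict Ω, |T h x| ≤ C * ‖h‖)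
    {ι : Type*} [Fintype ι] {e : ι → L2 Ω} (he : Orthonormal ℝ e) :
    ∀ᵐ x ∂(volume : Measure (Euc N)).restrict Ω, ∑ i, T (e i) x ^ 2 ≤ C ^ 2 := by
  have h1 : ∀ᵐ x ∂(volume : Measure (Euc N)).restrict Ω, ∀ q : ι → ℚ,
      |∑ i, (q i : ℝ) * T (e i) x| ≤ C * √(∑ i, (q i : ℝ) ^ 2) := by
    rw [ae_all_iff]
    intro q
    have h2 : ‖∑ i, (q i : ℝ) • e i‖ = √(∑ i, (q i : ℝ) ^ 2) := by
      rw [← Real.sqrt_sq (norm_nonneg _), ← real_inner_self_eq_norm_sq,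
        he.inner_sum (fun i => (q i : ℝ)) (fun i => (q i : ℝ)) Finset.univ]
      simp [sq]
    have h3 : ∀ᵐ x ∂(volume : Measure (Euc N)).restrict Ω,
        (∑ i, (q i : ℝ) • T (e i) : L2 Ω) x = ∑ i, (q i : ℝ) * T (e i) x := by
      have h4 := Lp.coeFn_finsetSum Finset.univ (fun i => (q i : ℝ) • T (e i))
      have h5 : ∀ᵐ x ∂(volume : Measure (Euc N)).restrict Ω, ∀ i,
          ((q i : ℝ) • T (e i) : L2 Ω) x = (q i : ℝ) * T (e i) x := by
        rw [ae_all_iff]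
        exact fun i => Lp.coeFn_smul _ _
      filter_upwards [h4, h5] with x h6 h7
      rw [h6, Finset.sum_apply]
      exact Finset.sum_congr rfl fun i _ => h7 i
    have h4 := hT (∑ i, (q i : ℝ) • e i)
    simp only [map_sum, map_smul] at h4
    filter_upwards [h3, h4] with x h5 h6
    rw [← h5, ← h2]
    exact h6
  filter_upwards [h1] with x hx
  have h2 : ∀ c : ι → ℝ, |∑ i, c i * T (e i) x| ≤ C * √(∑ i, c i ^ 2) := by
    have hd : DenseRange (fun q : ι → ℚ => fun i => (q i : ℝ)) :=
      DenseRange.piMap fun _ => Rat.denseRange_cast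
    have hcl : IsClosed {c : ι → ℝ | |∑ i, c i * T (e i) x| ≤ C * √(∑ i, c i ^ 2)} :=
      isClosed_le (by fun_prop) (by fun_prop)
    exact fun c => hd.induction_on (p := fun c => |∑ i, c i * T (e i) x| ≤ C * √(∑ i, c i ^ 2))
      c hcl hx
  have h3 := h2 fun i => T (e i) x
  have h4 : 0 ≤ ∑ i, T (e i) x ^ 2 := Finset.sum_nonneg fun i _ => sq_nonneg _
  simp only [← sq] at h3
  rw [abs_of_nonneg h4] at h3
  rcases h4.eq_or_lt with h5 | h5
  · rw [← h5]; positivity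
  · have h6 := Real.sqrt_pos.2 h5
    have h7 := Real.mul_self_sqrt h4
    have h8 : √(∑ i, T (e i) x ^ 2) ≤ C := by
      by_contra! h9
      nlinarith
    calc _ = √(∑ i, T (e i) x ^ 2) ^ 2 := (Real.sq_sqrt h4).symm
      _ ≤ C ^ 2 := by gcongr

theorem L2_norm_sq (f : L2 Ω) : ‖f‖ ^ 2 = ∫ x in Ω, f x ^ 2 := by
  rw [← real_inner_self_eq_norm_sq, L2_inner]
  simp only [sq]

theorem IsDom.isCompactOperator_of_bound (hΩ : IsDom Ω) {T : L2 Ω →L[ℝ] L2 Ω} {C : ℝ}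
    (hC : 0 ≤ C)
    (hT : ∀ h, ∀ᵐ x ∂(volume : Measure (Euc N)).restrict Ω, |T h x| ≤ C * ‖h‖) :
    IsCompactOperator T := by
  have := hΩ.isFiniteMeasure
  refine isCompactOperator_of_sum_sq_le T (∫ _ in Ω, C ^ 2) fun s hs => ?_
  have h1 := ae_sum_sq_le hC hT hs
  rw [← Finset.sum_coe_sort]
  simp only [L2_norm_sq]
  have hi : ∀ f : L2 Ω, Integrable (fun x => f x ^ 2) (volume.restrict Ω) := fun f =>
    (Lp.memLp f).integrable_sq
  rw [← integral_finsetSum _ fun i _ => hi _]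
  exact integral_mono_ae (integrable_finsetSum _ fun i _ => hi _) (integrable_const _) h1

/-- The Green operator is compact. -/
theorem IsDom.isCompactOperator_greenOp (hΩ : IsDom Ω) : IsCompactOperator (greenOp Ω) := by
  obtain ⟨k₀, h0⟩ := hΩ.exists_abs_pow_le
  have h1 : ∀ j : ℕ, IsCompactOperator ⇑(greenOp Ω ^ (2 ^ j)) → IsCompactOperator (greenOp Ω) := by
    intro j
    induction j with
    | zero => intro h; simpa using h
    | succ j ih =>
      intro h
      refine ih (isCompactOperator_of_sq _ (fun x y => greenOp_pow_symm _ x y) ?_)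
      rw [← pow_add, ← two_mul, ← pow_succ']
      exact h
  obtain ⟨C, hC, h2⟩ := h0 (2 ^ k₀) Nat.lt_two_pow_self.le
  exact h1 k₀ (hΩ.isCompactOperator_of_bound hC.le h2)

end Compactness

section Mollifier

variable {N : ℕ}

/-- A sequence of bump functions concentrating at the origin. -/
def bumpSeq (N n : ℕ) : ContDiffBump (0 : Euc N) where
  rIn := 1 / (2 * (n + 1))
  rOut := 1 / (n + 1)
  rIn_pos := by positivity
  rIn_lt_rOut := by
    have : (0 : ℝ) < n + 1 := by positivity
    gcongr
    linarith

theorem tendsto_bumpSeq_rOut : Tendsto (fun n => (bumpSeq N n).rOut) atTop (𝓝 0) :=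
  tendsto_one_div_add_atTop_nhds_zero_nat

/-- The normalised mollifier kernels. -/
def mollKer (N n : ℕ) : Euc N → ℝ := (bumpSeq N n).normed volume

theorem contDiff_mollKer {k : ℕ∞} (n : ℕ) : ContDiff ℝ k (mollKer N n) :=
  (bumpSeq N n).contDiff_normed

theorem hasCompactSupport_mollKer (n : ℕ) : HasCompactSupport (mollKer N n) :=
  (bumpSeq N n).hasCompactSupport_normed

theorem tsupport_mollKer (n : ℕ) :
    tsupport (mollKer N n) = Metric.closedBall 0 (bumpSeq N n).rOut :=
  (bumpSeq N n).tsupport_normed_eq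

/-- Mollification of a function. -/
def moll (n : ℕ) (g : Euc N → ℝ) : Euc N → ℝ :=
  convolution (mollKer N n) g (ContinuousLinearMap.lsmul ℝ ℝ) volume

theorem contDiff_moll {k : ℕ∞} (n : ℕ) {g : Euc N → ℝ} (hg : LocallyIntegrable g) :
    ContDiff ℝ k (moll n g) :=
  (hasCompactSupport_mollKer n).contDiff_convolution_left _ (contDiff_mollKer n) hg

theorem moll_apply (n : ℕ) (g : Euc N → ℝ) (x : Euc N) :
    moll n g x = ∫ y, mollKer N n (x - y) * g y :=
  convolution_lsmul_swap

theorem dist_moll_le (n : ℕ) {g : Euc N → ℝ} (hg : AEStronglyMeasurable g) {x : Euc N} {z ε : ℝ}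
    (hε : 0 ≤ ε) (h : ∀ y ∈ Metric.ball x (bumpSeq N n).rOut, dist (g y) z ≤ ε) :
    dist (moll n g x) z ≤ ε :=
  dist_convolution_le hε (bumpSeq N n).support_normed_eq.subset (bumpSeq N n).nonneg_normed
    (bumpSeq N n).integral_normed hg h

theorem abs_moll_le (n : ℕ) {g : Euc N → ℝ} (hg : AEStronglyMeasurable g) {B : ℝ} (hB : 0 ≤ B)
    (h : ∀ y, |g y| ≤ B) (x : Euc N) : |moll n g x| ≤ B := by
  have := dist_moll_le n hg (x := x) (z := 0) hB fun y _ => by simpa using h y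
  simpa using this

theorem ae_tendsto_moll {g : Euc N → ℝ} (hg : LocallyIntegrable g) :
    ∀ᵐ x, Tendsto (fun n => moll n g x) atTop (𝓝 (g x)) :=
  ContDiffBump.ae_convolution_tendsto_right_of_locallyIntegrable (φ := bumpSeq N) (K := 2)
    tendsto_bumpSeq_rOut
    (Eventually.of_forall fun n => by
      simp only [bumpSeq]
      have : (0 : ℝ) < n + 1 := by positivity
      exact le_of_eq (by field_simp)) hg

theorem tendstoLocallyUniformlyOn_moll {Ω : Set (Euc N)} (hΩ : IsOpen Ω) {g : Euc N → ℝ}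
    (hg : AEStronglyMeasurable g) (hc : ContinuousOn g Ω) :
    TendstoLocallyUniformlyOn (fun n => moll n g) g atTop Ω := by
  rw [Metric.tendstoLocallyUniformlyOn_iff]
  intro ε hε x₀ hx₀
  have h1 := Metric.continuousAt_iff.1 (hc.continuousAt (hΩ.mem_nhds hx₀)) (ε / 4) (by positivity)
  obtain ⟨r, hr, h2⟩ := h1
  refine ⟨Metric.ball x₀ (r / 2),
    mem_nhdsWithin_of_mem_nhds (Metric.ball_mem_nhds _ (by positivity)), ?_⟩
  filter_upwards [(tendsto_bumpSeq_rOut (N := N)).eventually (gt_mem_nhds (half_pos hr))] with n hn x hx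
  rw [dist_comm]
  refine lt_of_le_of_lt (dist_moll_le n hg (half_pos hε).le fun y hy => ?_) (half_lt_self hε)
  rw [Metric.mem_ball] at hx hy
  have hy' : dist y x₀ < r := (dist_triangle y x x₀).trans_lt (by linarith)
  have h3 := h2 hy'
  have h4 := h2 (hx.trans (half_lt_self hr))
  rw [dist_comm] at h4
  exact (dist_triangle _ (g x₀) _).trans (by linarith)

theorem fderiv_convolution_apply {ρ g : Euc N → ℝ} (hρ : ContDiff ℝ 1 ρ)
    (hs : HasCompactSupport ρ) (hg : LocallyIntegrable g) (x e : Euc N) :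
    fderiv ℝ (convolution ρ g (ContinuousLinearMap.lsmul ℝ ℝ) volume) x e
      = convolution (fun y => fderiv ℝ ρ y e) g (ContinuousLinearMap.lsmul ℝ ℝ) volume x := by
  rw [(hs.hasFDerivAt_convolution_left (ContinuousLinearMap.lsmul ℝ ℝ) hρ hg x).fderiv]
  have h1 : ConvolutionExistsAt (fderiv ℝ ρ) g x
      ((ContinuousLinearMap.lsmul ℝ ℝ).precompL (Euc N)) volume :=
    (hs.fderiv ℝ).convolutionExists_left _ (hρ.continuous_fderiv (by norm_num)) hg x
  rw [convolution_def, ContinuousLinearMap.integral_apply h1, convolution_def]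
  rfl

theorem fderiv_moll (n : ℕ) {g : Euc N → ℝ} (hg : LocallyIntegrable g) (x e : Euc N) :
    fderiv ℝ (moll n g) x e = ∫ y, fderiv ℝ (mollKer N n) (x - y) e * g y := by
  rw [moll, fderiv_convolution_apply (contDiff_mollKer (k := 1) n) (hasCompactSupport_mollKer n) hg]
  exact convolution_lsmul_swap

theorem hasCompactSupport_fderiv_apply {ρ : Euc N → ℝ} (hs : HasCompactSupport ρ) (e : Euc N) :
    HasCompactSupport fun y => fderiv ℝ ρ y e :=
  hs.fderiv_apply ℝ e

theorem lap_moll (n : ℕ) {g : Euc N → ℝ} (hg : LocallyIntegrable g) (x : Euc N) :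
    lap (moll n g) x = ∫ y, lap (mollKer N n) (x - y) * g y := by
  have h1 : ∀ e : Euc N, ContDiff ℝ 1 fun y => fderiv ℝ (mollKer N n) y e := fun e =>
    contDiff_iff_contDiffAt.2 fun x => (contDiff_mollKer (k := 2) n).contDiffAt.fderiv_apply_const e
  have h2 : ∀ e : Euc N, (fun y => fderiv ℝ (moll n g) y e)
      = convolution (fun y => fderiv ℝ (mollKer N n) y e) g (ContinuousLinearMap.lsmul ℝ ℝ)
        volume := fun e => funext fun y =>
    fderiv_convolution_apply (contDiff_mollKer (k := 1) n) (hasCompactSupport_mollKer n) hg y e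
  have hc := fun e : Euc N => hasCompactSupport_fderiv_apply (hasCompactSupport_mollKer n) e
  unfold lap
  simp_rw [h2, Finset.sum_mul]
  rw [integral_finsetSum]
  · refine Finset.sum_congr rfl fun i _ => ?_
    rw [fderiv_convolution_apply (h1 _) (hc _) hg]
    exact convolution_lsmul_swap
  · intro i _
    have h3 := (hasCompactSupport_fderiv_apply (hc (EuclideanSpace.single i 1))
      (EuclideanSpace.single i 1)).convolutionExists_left (ContinuousLinearMap.lsmul ℝ ℝ)
      (((h1 (EuclideanSpace.single i 1)).continuous_fderiv (by norm_num)).clm_apply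
        continuous_const) hg x
    exact h3.integrable_swap

theorem fderiv_comp_const_sub_apply {ρ : Euc N → ℝ} (hρ : Differentiable ℝ ρ) (x y e : Euc N) :
    fderiv ℝ (fun z => ρ (x - z)) y e = - fderiv ℝ ρ (x - y) e := by
  have h := (hρ (x - y)).hasFDerivAt.comp y ((hasFDerivAt_id y).const_sub x)
  rw [show (fun z => ρ (x - z)) = ρ ∘ HSub.hSub x from rfl, h.fderiv]
  simp

theorem lap_comp_const_sub {ρ : Euc N → ℝ} (hρ : ContDiff ℝ 2 ρ) (x y : Euc N) :
    lap (fun z => ρ (x - z)) y = lap ρ (x - y) := by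
  unfold lap
  refine Finset.sum_congr rfl fun i _ => ?_
  have h1 : (fun z => fderiv ℝ (fun z => ρ (x - z)) z (EuclideanSpace.single i 1))
      = fun z => - fderiv ℝ ρ (x - z) (EuclideanSpace.single i 1) :=
    funext fun z => fderiv_comp_const_sub_apply (hρ.differentiable (by norm_num)) x z _
  have h2 : Differentiable ℝ fun z => fderiv ℝ ρ z (EuclideanSpace.single i 1) := fun z =>
    (hρ.contDiffAt.fderiv_apply_const _).differentiableAt (by norm_num)
  rw [h1, fderiv_fun_neg, neg_apply, fderiv_comp_const_sub_apply h2, neg_neg]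

theorem isTest_mollKer {Ω : Set (Euc N)} {n : ℕ} {x : Euc N}
    (hx : Metric.closedBall x (bumpSeq N n).rOut ⊆ Ω) : IsTest Ω fun y => mollKer N n (x - y) := by
  have hsub : tsupport (fun y => mollKer N n (x - y))
      ⊆ Metric.closedBall x (bumpSeq N n).rOut := by
    refine closure_minimal (fun y hy => ?_) Metric.isClosed_closedBall
    have h1 : x - y ∈ tsupport (mollKer N n) := subset_tsupport _ hy
    rw [tsupport_mollKer, Metric.mem_closedBall, dist_zero_right] at h1
    rwa [Metric.mem_closedBall, dist_comm, dist_eq_norm]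
  exact ⟨(contDiff_mollKer (k := 1) n).comp (contDiff_const.sub contDiff_id),
    (isCompact_closedBall _ _).of_isClosed_subset (isClosed_tsupport _) hsub, hsub.trans hx⟩

theorem fderiv_moll_eq {Ω : Set (Euc N)} (hΩ : IsOpen Ω) {n : ℕ} {g : Euc N → ℝ}
    (hg : LocallyIntegrable g) (hgc : ∀ x ∈ Ω, ContDiffAt ℝ 1 g x) {x : Euc N}
    (hx : Metric.closedBall x (bumpSeq N n).rOut ⊆ Ω) (e : Euc N) :
    fderiv ℝ (moll n g) x e = moll n (Ω.indicator fun y => fderiv ℝ g y e) x := by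
  have ht := isTest_mollKer hx
  have h1 := (ht.integral_mul_fderiv hΩ hgc e).2.2
  rw [fderiv_moll n hg, moll_apply]
  have hd := (contDiff_mollKer (N := N) (k := 1) n).differentiable (by norm_num)
  simp_rw [fderiv_comp_const_sub_apply hd, mul_neg, integral_neg] at h1
  simp_rw [mul_comm (fderiv ℝ (mollKer N n) _ e)]
  rw [neg_inj.1 h1]
  refine integral_congr_ae (Eventually.of_forall fun y => ?_)
  by_cases hy : y ∈ Ω
  · simp only [indicator_of_mem hy, mul_comm]
  · have := ht.eq_zero hy
    simp only [this, mul_zero, zero_mul]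

/-- The distributional equation `-ΔV = F` in `Ω`. -/
def WeakEq (Ω : Set (Euc N)) (V F : Euc N → ℝ) : Prop :=
  ∀ φ, IsTest Ω φ → ContDiff ℝ 2 φ → ∫ x, V x * lap φ x = - ∫ x, F x * φ x

theorem WeakEq.lap_moll {Ω : Set (Euc N)} {V F : Euc N → ℝ} (h : WeakEq Ω V F)
    (hV : LocallyIntegrable V) {n : ℕ} {x : Euc N}
    (hx : Metric.closedBall x (bumpSeq N n).rOut ⊆ Ω) : lap (moll n V) x = - moll n F x := by
  have h1 := h _ (isTest_mollKer hx)
    ((contDiff_mollKer (k := 2) n).comp (contDiff_const.sub contDiff_id))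
  simp_rw [lap_comp_const_sub (contDiff_mollKer (N := N) (k := 2) n)] at h1
  rw [_root_.lap_moll n hV, moll_apply]
  simp_rw [mul_comm _ (V _), mul_comm _ (F _)]
  exact h1

end Mollifier

section InteriorRegularity

variable {N : ℕ} {Ω : Set (Euc N)}

theorem norm_le_sum_single (L : Euc N →L[ℝ] ℝ) : ‖L‖ ≤ ∑ i, |L (EuclideanSpace.single i 1)| := by
  refine L.opNorm_le_bound (Finset.sum_nonneg fun i _ => abs_nonneg _) fun x => ?_
  have h1 : L x = ∑ i, x i * L (EuclideanSpace.single i 1) := by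
    conv_lhs => rw [← (EuclideanSpace.basisFun (Fin N) ℝ).sum_repr x]
    simp [map_sum]
  rw [h1, Finset.sum_mul]
  refine (Finset.abs_sum_le_sum_abs _ _).trans (Finset.sum_le_sum fun i _ => ?_)
  rw [abs_mul, mul_comm]
  exact mul_le_mul_of_nonneg_left (PiLp.norm_apply_le x i) (abs_nonneg _)

theorem norm_fderiv_le {u : Euc N → ℝ} {x₀ : Euc N} {d M F : ℝ} (hd : 0 < d)
    (hu : ∀ x ∈ Metric.closedBall x₀ d, ContDiffAt ℝ 2 u x)
    (hM : ∀ x ∈ Metric.closedBall x₀ d, |u x| ≤ M)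
    (hF : ∀ x ∈ Metric.closedBall x₀ d, |lap u x| ≤ F) :
    ‖fderiv ℝ u x₀‖ ≤ N * (N * M / d + F * d / 2) := by
  refine (norm_le_sum_single _).trans
    ((Finset.sum_le_sum fun i _ => abs_fderiv_single_le hd hu hM hF i).trans_eq ?_)
  rw [Finset.sum_const, Finset.card_univ, Fintype.card_fin, nsmul_eq_mul]

theorem tendstoLocallyUniformlyOn_of_uniformCauchySeqOn_ball {E : Type*} [NormedAddCommGroup E]
    [CompleteSpace E] {w : ℕ → Euc N → E}
    (h : ∀ x ∈ Ω, ∃ r > 0, UniformCauchySeqOn w atTop (Metric.ball x r)) :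
    ∃ W, TendstoLocallyUniformlyOn w W atTop Ω := by
  have h1 : ∀ x, ∃ l, x ∈ Ω → Tendsto (fun n => w n x) atTop (𝓝 l) := fun x => by
    by_cases hx : x ∈ Ω
    · obtain ⟨r, hr, hr'⟩ := h x hx
      obtain ⟨l, hl⟩ := cauchySeq_tendsto_of_complete (hr'.cauchySeq (Metric.mem_ball_self hr))
      exact ⟨l, fun _ => hl⟩
    · exact ⟨0, fun h => absurd h hx⟩
  choose W hW using h1
  refine ⟨W, fun U hU x hx => ?_⟩
  obtain ⟨r, hr, hr'⟩ := h x hx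
  have h2 : TendstoUniformlyOn w W atTop (Ω ∩ Metric.ball x r) :=
    (hr'.mono inter_subset_right).tendstoUniformlyOn_of_tendsto fun y hy => hW y hy.1
  exact ⟨Ω ∩ Metric.ball x r, inter_mem_nhdsWithin _ (Metric.ball_mem_nhds _ hr), h2 U hU⟩

theorem exists_closedBall_subset (hΩ : IsOpen Ω) {x₀ : Euc N} (hx₀ : x₀ ∈ Ω) (k : ℝ) (hk : 0 < k) :
    ∃ r > 0, Metric.closedBall x₀ (k * r) ⊆ Ω := by
  obtain ⟨s, hs, h⟩ := Metric.isOpen_iff.1 hΩ x₀ hx₀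
  refine ⟨s / (2 * k), by positivity, (Metric.closedBall_subset_ball ?_).trans h⟩
  have : k * (s / (2 * k)) = s / 2 := by field_simp
  linarith

theorem exists_tendsto_fderiv (hΩ : IsOpen Ω) {w : ℕ → Euc N → ℝ} {W F : Euc N → ℝ}
    (hw : ∀ n, ContDiff ℝ 2 (w n)) (hW : TendstoLocallyUniformlyOn w W atTop Ω)
    (hF : TendstoLocallyUniformlyOn (fun n => lap (w n)) F atTop Ω) :
    (∀ x ∈ Ω, DifferentiableAt ℝ W x) ∧
    TendstoLocallyUniformlyOn (fun n => fderiv ℝ (w n)) (fderiv ℝ W) atTop Ω := by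
  have hcauchy : ∀ x ∈ Ω, ∃ r > 0,
      UniformCauchySeqOn (fun n => fderiv ℝ (w n)) atTop (Metric.ball x r) := by
    intro x₀ hx₀
    obtain ⟨r, hr, hball⟩ := exists_closedBall_subset hΩ hx₀ 2 two_pos
    refine ⟨r, hr, ?_⟩
    have hK := isCompact_closedBall x₀ (2 * r)
    have h1 := ((tendstoLocallyUniformlyOn_iff_tendstoUniformlyOn_of_compact hK).1
      (hW.mono hball)).uniformCauchySeqOn
    have h2 := ((tendstoLocallyUniformlyOn_iff_tendstoUniformlyOn_of_compact hK).1
      (hF.mono hball)).uniformCauchySeqOn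
    rw [Metric.uniformCauchySeqOn_iff] at h1 h2 ⊢
    intro ε hε
    obtain ⟨η, hη, hηε⟩ : ∃ η > 0, N * (N * η / r + η * r / 2) < ε := by
      refine ⟨ε / (N * (N / r + r / 2) + 1), by positivity, ?_⟩
      have h3 : (0 : ℝ) ≤ N * (N / r + r / 2) := by positivity
      have h4 : N * (N * (ε / (N * (N / r + r / 2) + 1)) / r
          + ε / (N * (N / r + r / 2) + 1) * r / 2)
          = ε * ((N * (N / r + r / 2)) / (N * (N / r + r / 2) + 1)) := by ring
      rw [h4]
      have h5 : (N * (N / r + r / 2)) / (N * (N / r + r / 2) + 1) < (1 : ℝ) := by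
        rw [div_lt_one (by positivity)]
        linarith
      nlinarith
    obtain ⟨n₁, hn₁⟩ := h1 η hη
    obtain ⟨n₂, hn₂⟩ := h2 η hη
    refine ⟨max n₁ n₂, fun m hm n hn x hx => ?_⟩
    have hsub : Metric.closedBall x r ⊆ Metric.closedBall x₀ (2 * r) :=
      Metric.closedBall_subset_closedBall' (by rw [Metric.mem_ball] at hx; linarith)
    have hd : ∀ n, DifferentiableAt ℝ (w n) x := fun n =>
      (hw n).contDiffAt.differentiableAt (by norm_num)
    rw [dist_eq_norm, ← fderiv_fun_sub (hd m) (hd n)]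
    refine lt_of_le_of_lt (norm_fderiv_le hr
      (fun y _ => (hw m).contDiffAt.sub (hw n).contDiffAt) (fun y hy => ?_) fun y hy => ?_) hηε
    · exact (hn₁ m (le_of_max_le_left hm) n (le_of_max_le_left hn) y (hsub hy)).le
    · rw [lap_sub (hw m).contDiffAt (hw n).contDiffAt]
      exact (hn₂ m (le_of_max_le_right hm) n (le_of_max_le_right hn) y (hsub hy)).le
  obtain ⟨W', hW'⟩ := tendstoLocallyUniformlyOn_of_uniformCauchySeqOn_ball hcauchy
  have h3 : ∀ x ∈ Ω, HasFDerivAt W (W' x) x := fun x hx =>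
    hasFDerivAt_of_tendstoLocallyUniformlyOn hΩ hW'
      (fun n y _ => ((hw n).contDiffAt.differentiableAt (by norm_num)).hasFDerivAt)
      (fun y hy => hW.tendsto_at hy) hx
  exact ⟨fun x hx => (h3 x hx).differentiableAt,
    hW'.congr_right fun x hx => (h3 x hx).fderiv.symm⟩

theorem eventually_forall_closedBall_subset {x₀ : Euc N} {r : ℝ} (hr : 0 < r)
    (hball : Metric.closedBall x₀ (3 * r) ⊆ Ω) : ∀ᶠ n in atTop,
      ∀ z ∈ Metric.closedBall x₀ (2 * r), Metric.closedBall z (bumpSeq N n).rOut ⊆ Ω := by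
  filter_upwards [(tendsto_bumpSeq_rOut (N := N)).eventually (gt_mem_nhds hr)] with n hn z hz
  refine (Metric.closedBall_subset_closedBall' ?_).trans hball
  rw [Metric.mem_closedBall] at hz
  linarith

/-- Bounded distributional solutions with bounded right-hand side have a continuous version. -/
theorem WeakEq.exists_continuousOn (hΩ : IsOpen Ω) {V F : Euc N → ℝ} (h : WeakEq Ω V F)
    (hV : LocallyIntegrable V) (hF : AEStronglyMeasurable F) {B B' : ℝ} (hB : 0 ≤ B) (hB' : 0 ≤ B')
    (hVB : ∀ x, |V x| ≤ B) (hFB : ∀ x, |F x| ≤ B') :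
    ∃ W : Euc N → ℝ, (∀ x, |W x| ≤ B) ∧ ContinuousOn W Ω ∧ ∀ᵐ x, x ∈ Ω → W x = V x := by
  have hlip : ∀ x₀ ∈ Ω, ∃ r > 0, ∃ L ≥ 0, ∀ᶠ n in atTop, ∀ x ∈ Metric.ball x₀ r,
      ∀ y ∈ Metric.ball x₀ r, |moll n V x - moll n V y| ≤ L * ‖x - y‖ := by
    intro x₀ hx₀
    obtain ⟨r, hr, hball⟩ := exists_closedBall_subset hΩ hx₀ 3 (by norm_num)
    refine ⟨r, hr, N * (N * B / r + B' * r / 2), by positivity, ?_⟩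
    filter_upwards [eventually_forall_closedBall_subset hr hball] with n hn x hx y hy
    have h2 : ContDiff ℝ 2 (moll n V) := contDiff_moll (k := 2) n hV
    refine Convex.norm_image_sub_le_of_norm_fderiv_le (𝕜 := ℝ) (s := Metric.ball x₀ r)
      (fun z _ => h2.differentiable (by norm_num) z) (fun z hz => ?_) (convex_ball _ _) hy hx
    refine norm_fderiv_le hr (fun y _ => h2.contDiffAt)
      (fun y _ => abs_moll_le n hV.aestronglyMeasurable hB hVB y) fun y hy => ?_
    rw [h.lap_moll hV (hn y (Metric.closedBall_subset_closedBall' (by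
      rw [Metric.mem_ball] at hz; linarith) hy)), abs_neg]
    exact abs_moll_le n hF hB' hFB y
  have hae := ae_tendsto_moll hV
  have hdense := Measure.dense_of_ae hae
  have hlim : ∀ x, ∃ l, |l| ≤ B ∧ (x ∈ Ω → Tendsto (fun n => moll n V x) atTop (𝓝 l)) := by
    intro x
    by_cases hx : x ∈ Ω
    · obtain ⟨r, hr, L, hL, hev⟩ := hlip x hx
      have hc : CauchySeq fun n => moll n V x := by
        rw [Metric.cauchySeq_iff]
        intro ε hε
        obtain ⟨y, hy, hyt⟩ := Metric.dense_iff.1 hdense x (min r (ε / (4 * (L + 1))))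
          (lt_min hr (by positivity))
        rw [Metric.mem_ball, lt_min_iff, dist_comm] at hy
        obtain ⟨n₁, h1⟩ := Metric.cauchySeq_iff.1 hyt.cauchySeq (ε / 2) (half_pos hε)
        obtain ⟨n₂, h2⟩ := eventually_atTop.1 hev
        refine ⟨max n₁ n₂, fun m hm n hn => ?_⟩
        have h3 := h1 m (le_of_max_le_left hm) n (le_of_max_le_left hn)
        have hyb : y ∈ Metric.ball x r := by rw [Metric.mem_ball, dist_comm]; exact hy.1
        have h4 := h2 m (le_of_max_le_right hm) x (Metric.mem_ball_self hr) y hyb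
        have h5 := h2 n (le_of_max_le_right hn) x (Metric.mem_ball_self hr) y hyb
        have h6 : L * ‖x - y‖ < ε / 4 := by
          have h7 : ‖x - y‖ * (4 * (L + 1)) < ε := by
            have := hy.2
            rwa [dist_eq_norm, lt_div_iff₀ (by positivity)] at this
          nlinarith [norm_nonneg (x - y)]
        rw [Real.dist_eq] at h3 ⊢
        rw [abs_lt] at h3 ⊢
        rw [abs_le] at h4 h5
        constructor <;> linarith
      obtain ⟨l, hl⟩ := cauchySeq_tendsto_of_complete hc
      exact ⟨l, le_of_tendsto hl.abs (Eventually.of_forall fun n =>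
        abs_moll_le n hV.aestronglyMeasurable hB hVB x), fun _ => hl⟩
    · exact ⟨0, by simpa using hB, fun h => absurd h hx⟩
  choose W hWB hW using hlim
  refine ⟨W, hWB, fun x₀ hx₀ => ContinuousAt.continuousWithinAt ?_, ?_⟩
  · obtain ⟨r, hr, L, hL, hev⟩ := hlip x₀ hx₀
    rw [Metric.continuousAt_iff]
    intro ε hε
    have hnhds : Ω ∩ Metric.ball x₀ (min r (ε / (L + 1))) ∈ 𝓝 x₀ :=
      inter_mem (hΩ.mem_nhds hx₀) (Metric.ball_mem_nhds _ (lt_min hr (by positivity)))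
    obtain ⟨δ, hδ, hsub⟩ := Metric.mem_nhds_iff.1 hnhds
    refine ⟨δ, hδ, fun {x} hx => ?_⟩
    obtain ⟨hxΩ, hxb⟩ := hsub hx
    rw [Metric.mem_ball, lt_min_iff] at hxb
    have h1 : |W x - W x₀| ≤ L * ‖x - x₀‖ := by
      refine le_of_tendsto ((hW x hxΩ).sub (hW x₀ hx₀)).abs ?_
      filter_upwards [hev] with n hn
      exact hn x hxb.1 x₀ (Metric.mem_ball_self hr)
    have h2 := hxb.2
    rw [dist_eq_norm, lt_div_iff₀ (by positivity)] at h2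
    rw [Real.dist_eq]
    rcases eq_or_ne x x₀ with rfl | hne
    · simpa using hε
    · have := norm_pos_iff.2 (sub_ne_zero.2 hne)
      nlinarith
  · filter_upwards [hae] with x hx hxΩ
    exact tendsto_nhds_unique (hW x hxΩ) hx

theorem TendstoLocallyUniformlyOn.clm_apply_const {w : ℕ → Euc N → (Euc N →L[ℝ] ℝ)}
    {W : Euc N → (Euc N →L[ℝ] ℝ)} (h : TendstoLocallyUniformlyOn w W atTop Ω) (e : Euc N) :
    TendstoLocallyUniformlyOn (fun n x => w n x e) (fun x => W x e) atTop Ω :=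
  UniformContinuous.comp_tendstoLocallyUniformlyOn
    (ContinuousLinearMap.apply ℝ ℝ e).uniformContinuous h

theorem tendstoLocallyUniformlyOn_of_eventually_eq (hΩ : IsOpen Ω) {w w' : ℕ → Euc N → ℝ}
    {W : Euc N → ℝ} (h : TendstoLocallyUniformlyOn w W atTop Ω)
    (heq : ∀ n x, (∀ᶠ z in 𝓝 x, Metric.closedBall z (bumpSeq N n).rOut ⊆ Ω) → w' n x = w n x) :
    TendstoLocallyUniformlyOn w' W atTop Ω := by
  intro U hU x hx
  obtain ⟨t, ht, h1⟩ := h U hU x hx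
  obtain ⟨r, hr, hball⟩ := exists_closedBall_subset hΩ hx 3 (by norm_num)
  refine ⟨t ∩ Metric.ball x (2 * r), inter_mem ht
    (mem_nhdsWithin_of_mem_nhds (Metric.ball_mem_nhds _ (by positivity))), ?_⟩
  filter_upwards [h1, eventually_forall_closedBall_subset hr hball] with n h2 h3 y hy
  have h4 : ∀ᶠ z in 𝓝 y, Metric.closedBall z (bumpSeq N n).rOut ⊆ Ω := by
    filter_upwards [Metric.isOpen_ball.mem_nhds hy.2] with z hz
    exact h3 z (Metric.ball_subset_closedBall hz)
  rw [heq n y h4]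
  exact h2 y hy.1

theorem WeakEq.tendsto_lap_moll (hΩ : IsOpen Ω) {V F : Euc N → ℝ} (h : WeakEq Ω V F)
    (hV : LocallyIntegrable V) (hF : AEStronglyMeasurable F) (hFc : ContinuousOn F Ω) :
    TendstoLocallyUniformlyOn (fun n => lap (moll n V)) (fun x => - F x) atTop Ω :=
  tendstoLocallyUniformlyOn_of_eventually_eq hΩ (w := fun n x => - moll n F x)
    (UniformContinuous.comp_tendstoLocallyUniformlyOn uniformContinuous_neg
      (tendstoLocallyUniformlyOn_moll hΩ hF hFc)) fun _ _ hx => h.lap_moll hV hx.self_of_nhds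

theorem contDiffOn_of_fderiv_single (hΩ : IsOpen Ω) {W : Euc N → ℝ} {k : ℕ}
    (hd : DifferentiableOn ℝ W Ω)
    (h : ∀ i, ContDiffOn ℝ k (fun x => fderiv ℝ W x (EuclideanSpace.single i 1)) Ω) :
    ContDiffOn ℝ (k + 1) W Ω := by
  rw [contDiffOn_succ_iff_fderiv_of_isOpen hΩ]
  refine ⟨hd, by simp, ?_⟩
  have h1 : fderiv ℝ W = fun x => ∑ i, fderiv ℝ W x (EuclideanSpace.single i 1) •
      (EuclideanSpace.proj i : Euc N →L[ℝ] ℝ) := by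
    funext x
    ext y
    conv_lhs => rw [← (EuclideanSpace.basisFun (Fin N) ℝ).sum_repr y]
    simp [map_sum, mul_comm]
  rw [h1]
  exact ContDiffOn.sum fun i _ => (h i).smul contDiffOn_const

theorem WeakEq.contDiffOn_one (hΩ : IsOpen Ω) {V F : Euc N → ℝ} (h : WeakEq Ω V F)
    (hV : LocallyIntegrable V) (hVc : ContinuousOn V Ω) (hF : AEStronglyMeasurable F)
    (hFc : ContinuousOn F Ω) : ContDiffOn ℝ 1 V Ω ∧
    TendstoLocallyUniformlyOn (fun n => fderiv ℝ (moll n V)) (fderiv ℝ V) atTop Ω := by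
  obtain ⟨h1, h2⟩ := exists_tendsto_fderiv hΩ (fun n => contDiff_moll (k := 2) n hV)
    (tendstoLocallyUniformlyOn_moll hΩ hV.aestronglyMeasurable hVc)
    (h.tendsto_lap_moll hΩ hV hF hFc)
  refine ⟨?_, h2⟩
  have h3 : ContinuousOn (fderiv ℝ V) Ω := h2.continuousOn (Frequently.of_forall fun n =>
    ((contDiff_moll (k := 1) n hV).continuous_fderiv (by norm_num)).continuousOn)
  rw [show (1 : WithTop ℕ∞) = 0 + 1 by norm_num, contDiffOn_succ_iff_fderiv_of_isOpen hΩ]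
  exact ⟨fun x hx => (h1 x hx).differentiableWithinAt, by simp, contDiffOn_zero.2 h3⟩

theorem lap_fderiv_apply {u : Euc N → ℝ} (hu : ContDiff ℝ 3 u) (x e : Euc N) :
    lap (fun y => fderiv ℝ u y e) x = fderiv ℝ (lap u) x e := by
  have h1 : ∀ v, ContDiff ℝ 2 fun y => fderiv ℝ u y v := fun v =>
    (hu.fderiv_right (m := 2) (by norm_num)).clm_apply contDiff_const
  have h2 : ∀ v w, ContDiff ℝ 1 fun y => fderiv ℝ (fun z => fderiv ℝ u z v) y w := fun v w =>
    ((h1 v).fderiv_right (m := 1) (by norm_num)).clm_apply contDiff_const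
  have hsw : ∀ {g : Euc N → ℝ}, ContDiff ℝ 2 g → ∀ (v w y : Euc N),
      fderiv ℝ (fun z => fderiv ℝ g z v) y w = fderiv ℝ (fun z => fderiv ℝ g z w) y v := by
    intro g hg v w y
    have hd : DifferentiableAt ℝ (fderiv ℝ g) y :=
      (hg.fderiv_right (m := 1) (by norm_num)).contDiffAt.differentiableAt (by norm_num)
    have hs := hg.contDiffAt.isSymmSndFDerivAt (x := y) (by simp)
    rw [fderiv_clm_apply hd (differentiableAt_const _),
      fderiv_clm_apply hd (differentiableAt_const _)]
    simpa using hs.eq w v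
  unfold lap
  rw [fderiv_fun_sum fun i _ => (h2 _ _).contDiffAt.differentiableAt (by norm_num)]
  rw [_root_.sum_apply]
  refine Finset.sum_congr rfl fun i _ => ?_
  have h3 : (fun y => fderiv ℝ (fun z => fderiv ℝ u z e) y (EuclideanSpace.single i 1))
      = fun y => fderiv ℝ (fun z => fderiv ℝ u z (EuclideanSpace.single i 1)) y e :=
    funext fun y => hsw (hu.of_le (by norm_num)) _ _ y
  rw [h3, hsw (h1 _)]

theorem WeakEq.tendsto_lap_fderiv_moll (hΩ : IsOpen Ω) {V F : Euc N → ℝ} (h : WeakEq Ω V F)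
    (hV : LocallyIntegrable V) (hF : LocallyIntegrable F) (hFc : ContDiffOn ℝ 1 F Ω) (e : Euc N) :
    TendstoLocallyUniformlyOn (fun n => lap (fun y => fderiv ℝ (moll n V) y e))
      (fun x => - Ω.indicator (fun y => fderiv ℝ F y e) x) atTop Ω := by
  have hcF : ContinuousOn (fun y => fderiv ℝ F y e) Ω :=
    (hFc.continuousOn_fderiv_of_isOpen hΩ (by norm_num)).clm_apply continuousOn_const
  have hcI : ContinuousOn (Ω.indicator fun y => fderiv ℝ F y e) Ω :=
    hcF.congr fun x hx => indicator_of_mem hx _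
  have hmI : AEStronglyMeasurable (Ω.indicator fun y => fderiv ℝ F y e) :=
    (aestronglyMeasurable_indicator_iff hΩ.measurableSet).2
      (hcF.aestronglyMeasurable hΩ.measurableSet)
  refine tendstoLocallyUniformlyOn_of_eventually_eq hΩ
    (w := fun n x => - moll n (Ω.indicator fun y => fderiv ℝ F y e) x)
    (UniformContinuous.comp_tendstoLocallyUniformlyOn uniformContinuous_neg
      (tendstoLocallyUniformlyOn_moll hΩ hmI hcI)) fun n x hx => ?_
  have h1 : lap (moll n V) =ᶠ[𝓝 x] fun z => - moll n F z := by
    filter_upwards [hx] with z hz using h.lap_moll hV hz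
  rw [lap_fderiv_apply (contDiff_moll (k := 3) n hV), h1.fderiv_eq, fderiv_fun_neg, neg_apply,
    fderiv_moll_eq hΩ hF (fun y hy => hFc.contDiffAt (hΩ.mem_nhds hy)) hx.self_of_nhds]

/-- Distributional solutions with `C¹` right-hand side are classical. -/
theorem WeakEq.contDiffOn_two (hΩ : IsOpen Ω) {V F : Euc N → ℝ} (h : WeakEq Ω V F)
    (hV : LocallyIntegrable V) (hVc : ContinuousOn V Ω) (hF : LocallyIntegrable F)
    (hFc : ContDiffOn ℝ 1 F Ω) : ContDiffOn ℝ 2 V Ω ∧ ∀ x ∈ Ω, lap V x = - F x := by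
  obtain ⟨h1, h2⟩ := h.contDiffOn_one hΩ hV hVc hF.aestronglyMeasurable hFc.continuousOn
  have hw : ∀ n (e : Euc N), ContDiff ℝ 2 fun y => fderiv ℝ (moll n V) y e := fun n e =>
    ((contDiff_moll (k := 3) n hV).fderiv_right (m := 2) (by norm_num)).clm_apply contDiff_const
  have h3 := fun e : Euc N => exists_tendsto_fderiv hΩ (fun n => hw n e) (h2.clm_apply_const e)
    (h.tendsto_lap_fderiv_moll hΩ hV hF hFc e)
  constructor
  · refine contDiffOn_of_fderiv_single hΩ (k := 1) (h1.differentiableOn (by norm_num)) fun i => ?_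
    obtain ⟨h4, h5⟩ := h3 (EuclideanSpace.single i 1)
    rw [Nat.cast_one, show (1 : WithTop ℕ∞) = 0 + 1 by norm_num,
      contDiffOn_succ_iff_fderiv_of_isOpen hΩ]
    refine ⟨fun x hx => (h4 x hx).differentiableWithinAt, by simp, contDiffOn_zero.2 ?_⟩
    exact h5.continuousOn (Frequently.of_forall fun n =>
      ((hw n _).continuous_fderiv (by norm_num)).continuousOn)
  · intro x hx
    have h4 : Tendsto (fun n => lap (moll n V) x) atTop (𝓝 (lap V x)) := by
      unfold lap
      exact tendsto_finsetSum _ fun i _ =>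
        ((h3 (EuclideanSpace.single i 1)).2.clm_apply_const _).tendsto_at hx
    exact tendsto_nhds_unique h4
      ((h.tendsto_lap_moll hΩ hV hF.aestronglyMeasurable hFc.continuousOn).tendsto_at hx)

end InteriorRegularity

section Classical

variable {N : ℕ} {Ω : Set (Euc N)}

theorem ContinuousOn.le_of_ae_le (hΩ : IsOpen Ω) {f g : Euc N → ℝ} (hf : ContinuousOn f Ω)
    (hg : ContinuousOn g Ω) (h : ∀ᵐ x, x ∈ Ω → f x ≤ g x) : ∀ x ∈ Ω, f x ≤ g x := by
  have h1 : IsOpen (Ω ∩ (fun x => f x - g x) ⁻¹' Ioi 0) :=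
    (hf.sub hg).isOpen_inter_preimage hΩ isOpen_Ioi
  have h2 : (volume : Measure (Euc N)) (Ω ∩ (fun x => f x - g x) ⁻¹' Ioi 0) = 0 := by
    rw [measure_eq_zero_iff_ae_notMem]
    filter_upwards [h] with x hx hx'
    have h3 : 0 < f x - g x := hx'.2
    linarith [hx hx'.1]
  have h3 := (h1.measure_eq_zero_iff (volume : Measure (Euc N))).1 h2
  intro x hx
  by_contra! h4
  have : x ∈ Ω ∩ (fun x => f x - g x) ⁻¹' Ioi 0 := ⟨hx, by simpa using h4⟩
  rw [h3] at this
  exact this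

theorem WeakEq.congr_ae {V F V' F' : Euc N → ℝ} (h : WeakEq Ω V F) (hV : V =ᵐ[volume] V')
    (hF : F =ᵐ[volume] F') : WeakEq Ω V' F' := fun φ hφ hφ2 => by
  have h1 := h φ hφ hφ2
  have h2 : ∫ x, V x * lap φ x = ∫ x, V' x * lap φ x :=
    integral_congr_ae (by filter_upwards [hV] with x hx; rw [hx])
  have h3 : ∫ x, F x * φ x = ∫ x, F' x * φ x :=
    integral_congr_ae (by filter_upwards [hF] with x hx; rw [hx])
  rw [← h2, ← h3, h1]

theorem IsDom.weakEq_greenOp (hΩ : IsDom Ω) (h : L2 Ω) :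
    WeakEq Ω (Ω.indicator (greenOp Ω h)) (Ω.indicator h) := fun φ hφ hφ2 => by
  have h1 := hΩ.greenOp_weak h hφ hφ2
  rw [← integral_indicator hΩ.isOpen.measurableSet,
    ← integral_indicator hΩ.isOpen.measurableSet] at h1
  simpa only [indicator_mul_left] using h1

/-- Truncation of an almost everywhere bounded function to a bounded representative. -/
theorem exists_bounded_representative (hΩ : IsDom Ω) (v : L2 Ω) {B : ℝ} (hB : 0 ≤ B)
    (hv : ∀ᵐ x ∂(volume : Measure (Euc N)).restrict Ω, 0 ≤ v x ∧ v x ≤ B) :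
    ∃ V : Euc N → ℝ, Integrable V ∧ (∀ x, |V x| ≤ B) ∧ Ω.indicator v =ᵐ[volume] V := by
  have heq : Ω.indicator v =ᵐ[volume] Ω.indicator fun x => max 0 (min (v x) B) := by
    rw [ae_restrict_iff' hΩ.isOpen.measurableSet] at hv
    filter_upwards [hv] with x hx
    by_cases hxΩ : x ∈ Ω
    · rw [indicator_of_mem hxΩ, indicator_of_mem hxΩ, min_eq_left (hx hxΩ).2,
        max_eq_right (hx hxΩ).1]
    · rw [indicator_of_notMem hxΩ, indicator_of_notMem hxΩ]
  refine ⟨_, Integrable.congr ?_ heq, fun x => ?_, heq⟩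
  · exact IntegrableOn.integrable_indicator (hΩ.integrable v) hΩ.isOpen.measurableSet
  · by_cases hxΩ : x ∈ Ω
    · rw [indicator_of_mem hxΩ, abs_of_nonneg (le_max_left _ _)]
      exact max_le hB (min_le_right _ _)
    · rw [indicator_of_notMem hxΩ, abs_zero]
      exact hB

theorem ContDiffOn.comp_graph {H : Euc N → ℝ → ℝ} {k : WithTop ℕ∞}
    (hH : ContDiffOn ℝ k (Function.uncurry H) (Ω ×ˢ univ)) {W : Euc N → ℝ}
    (hW : ContDiffOn ℝ k W Ω) : ContDiffOn ℝ k (fun x => H x (W x)) Ω :=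
  hH.comp (contDiffOn_id.prodMk hW) fun _ hx => ⟨hx, mem_univ _⟩

theorem IsDom.exists_classical (hΩ : IsDom Ω) {v h : L2 Ω} (hv : v = greenOp Ω h)
    {H : Euc N → ℝ → ℝ} (hH : ContDiffOn ℝ 1 (Function.uncurry H) (Ω ×ˢ univ))
    (hh : ∀ᵐ x ∂(volume : Measure (Euc N)).restrict Ω, h x = H x (v x)) {B B' : ℝ} (hB : 0 ≤ B)
    (hB' : 0 ≤ B') (hvB : ∀ᵐ x ∂(volume : Measure (Euc N)).restrict Ω, 0 ≤ v x ∧ v x ≤ B)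
    (hhB : ∀ᵐ x ∂(volume : Measure (Euc N)).restrict Ω, 0 ≤ h x ∧ h x ≤ B') (hv0 : v ≠ 0) :
    ∃ W : Euc N → ℝ, ContDiffOn ℝ 2 W Ω ∧ (∀ x ∈ Ω, 0 < W x) ∧
      (∀ x ∈ Ω, - lap W x = H x (W x)) ∧
      ∀ᵐ x ∂(volume : Measure (Euc N)).restrict Ω, W x = v x := by
  obtain ⟨V, hVi, hVB, hVeq⟩ := exists_bounded_representative hΩ v hB hvB
  obtain ⟨F, hFi, hFB, hFeq⟩ := exists_bounded_representative hΩ h hB' hhB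
  have hw : WeakEq Ω V F := by
    have := hΩ.weakEq_greenOp h
    rw [← hv] at this
    exact this.congr_ae hVeq hFeq
  obtain ⟨W, -, hWc, hWV⟩ := hw.exists_continuousOn hΩ.isOpen hVi.locallyIntegrable
    hFi.aestronglyMeasurable hB hB' hVB hFB
  rw [ae_restrict_iff' hΩ.isOpen.measurableSet] at hh hvB hhB
  have hWv : ∀ᵐ x, x ∈ Ω → W x = v x := by
    filter_upwards [hWV, hVeq] with x h1 h2 hx
    rw [h1 hx, ← h2, indicator_of_mem hx]
  have hVW : V =ᵐ[volume] Ω.indicator W := by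
    filter_upwards [hWv, hVeq] with x h1 h2
    by_cases hx : x ∈ Ω
    · rw [← h2, indicator_of_mem hx, indicator_of_mem hx, h1 hx]
    · rw [← h2, indicator_of_notMem hx, indicator_of_notMem hx]
  have hFW : F =ᵐ[volume] Ω.indicator fun x => H x (W x) := by
    filter_upwards [hWv, hFeq, hh] with x h1 h2 h3
    by_cases hx : x ∈ Ω
    · rw [← h2, indicator_of_mem hx, indicator_of_mem hx, h1 hx, h3 hx]
    · rw [← h2, indicator_of_notMem hx, indicator_of_notMem hx]
  have hw' := hw.congr_ae hVW hFW
  have hVi' := (hVi.congr hVW).locallyIntegrable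
  have hFi' := (hFi.congr hFW).locallyIntegrable
  have hin : ∀ g : Euc N → ℝ, EqOn (Ω.indicator g) g Ω := fun g x hx => indicator_of_mem hx g
  have hHc : ContinuousOn (fun x => H x (W x)) Ω :=
    hH.continuousOn.comp (continuousOn_id.prodMk hWc) fun _ hx => ⟨hx, mem_univ _⟩
  have hC1 : ContDiffOn ℝ 1 W Ω := (hw'.contDiffOn_one hΩ.isOpen hVi' (hWc.congr (hin _))
    hFi'.aestronglyMeasurable (hHc.congr (hin _))).1.congr (hin W).symm
  obtain ⟨h2, hlap⟩ := hw'.contDiffOn_two hΩ.isOpen hVi' (hWc.congr (hin _)) hFi'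
    ((hH.comp_graph hC1).congr (hin _))
  have hC2 : ContDiffOn ℝ 2 W Ω := h2.congr (hin W).symm
  have hlap' : ∀ x ∈ Ω, lap W x = - H x (W x) := fun x hx => by
    rw [← indicator_of_mem hx fun x => H x (W x), ← hlap x hx]
    refine lap_congr ?_
    filter_upwards [hΩ.isOpen.mem_nhds hx] with y hy using (hin W hy).symm
  have hW0 : ∀ x ∈ Ω, 0 ≤ W x := ContinuousOn.le_of_ae_le hΩ.isOpen continuousOn_const hWc (by
    filter_upwards [hWv, hvB] with x h1 h2 hx
    rw [h1 hx]
    exact (h2 hx).1)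
  have hH0 : ∀ x ∈ Ω, 0 ≤ H x (W x) :=
    ContinuousOn.le_of_ae_le hΩ.isOpen continuousOn_const hHc (by
      filter_upwards [hWv, hhB, hh] with x h1 h2 h3 hx
      rw [h1 hx, ← h3 hx]
      exact (h2 hx).1)
  have hpos : ∃ x ∈ Ω, 0 < W x := by
    by_contra! hcon
    refine hv0 (Lp.ext ?_)
    refine EventuallyEq.trans ?_ (Lp.coeFn_zero ℝ 2 _).symm
    refine (ae_restrict_iff' hΩ.isOpen.measurableSet).2 ?_
    filter_upwards [hWv] with x h1 hx
    rw [← h1 hx]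
    exact le_antisymm (hcon x hx) (hW0 x hx)
  obtain ⟨x₁, hx₁, hx₁'⟩ := hpos
  refine ⟨W, hC2, pos_of_superharmonic hΩ.isOpen hΩ.conn.isPreconnected
    (fun x hx => hC2.contDiffAt (hΩ.isOpen.mem_nhds hx)) hW0
    (fun x hx => by rw [hlap' x hx]; linarith [hH0 x hx]) hx₁ hx₁',
    fun x hx => by rw [hlap' x hx, neg_neg], ?_⟩
  exact (ae_restrict_iff' hΩ.isOpen.measurableSet).2 hWv

end Classical

section Boundary

variable {N : ℕ} {Ω : Set (Euc N)}

/-- A positive superharmonic barrier, continuous up to the boundary where it vanishes. -/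
structure IsBarrier (Ω : Set (Euc N)) (w : Euc N → ℝ) (c : ℝ) : Prop where
  contDiffAt : ∀ x ∈ Ω, ContDiffAt ℝ 2 w x
  continuousOn : ContinuousOn w (closure Ω)
  pos : ∀ x ∈ Ω, 0 < w x
  eq_zero : ∀ x ∈ frontier Ω, w x = 0
  const_pos : 0 < c
  le_neg_lap : ∀ x ∈ Ω, c * w x ≤ - lap w x

/-- `h` is bounded by multiples of `w`, up to arbitrarily small constants. -/
def BoundarySmall (Ω : Set (Euc N)) (w : Euc N → ℝ) (h : Euc N → ℝ) : Prop :=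
  ∀ η : ℝ, 0 < η → ∃ C : ℝ, 0 ≤ C ∧
    ∀ᵐ x ∂(volume : Measure (Euc N)).restrict Ω, h x ≤ C * w x + η

theorem IsBarrier.memLp {w : Euc N → ℝ} {c : ℝ} (hw : IsBarrier Ω w c) (hΩ : IsDom Ω) :
    MemLp w 2 ((volume : Measure (Euc N)).restrict Ω) := by
  have := hΩ.isFiniteMeasure
  obtain ⟨K, hK⟩ := hΩ.bdd.isCompact_closure.exists_bound_of_continuousOn hw.continuousOn
  refine MemLp.of_bound ((hw.continuousOn.mono subset_closure).aestronglyMeasurable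
    hΩ.isOpen.measurableSet) K ?_
  filter_upwards [ae_restrict_mem hΩ.isOpen.measurableSet] with x hx using hK x (subset_closure hx)

theorem BoundarySmall.greenOp {w : Euc N → ℝ} {c : ℝ} (hw : IsBarrier Ω w c) (hΩ : IsDom Ω)
    {h : L2 Ω} (hh : BoundarySmall Ω w h) : BoundarySmall Ω w (greenOp Ω h) := fun η hη => by
  obtain ⟨C₁, hC₁, hG⟩ := hΩ.exists_greenOp_const
  obtain ⟨C, hC, hhC⟩ := hh (η / (2 * C₁)) (by positivity)
  set wL : L2 Ω := (hw.memLp hΩ).toLp w with hwL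
  have hwe : wL =ᵐ[volume.restrict Ω] w := MemLp.coeFn_toLp _
  have h1 : ∀ᵐ x ∂(volume : Measure (Euc N)).restrict Ω, (h - C • wL) x ≤ η / (2 * C₁) := by
    filter_upwards [hhC, hwe, Lp.coeFn_sub h (C • wL), Lp.coeFn_smul C wL] with x a1 a2 a3 a4
    rw [a3, Pi.sub_apply, a4, Pi.smul_apply, a2, smul_eq_mul]
    linarith
  have h2 := hG _ (by positivity) _ h1
  have h3 : ∀ᵐ x ∂(volume : Measure (Euc N)).restrict Ω,
      _root_.greenOp Ω (C • wL) x ≤ C / c * w x + η / 2 := by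
    refine hΩ.greenOp_le (fun x hx => ((contDiffAt_const.mul (hw.contDiffAt x hx)).add
      contDiffAt_const)) (half_pos hη) (fun x hx => ?_) ?_
    · have := mul_nonneg (div_nonneg hC hw.const_pos.le) (hw.pos x hx).le
      linarith
    · filter_upwards [hwe, Lp.coeFn_smul C wL, ae_restrict_mem hΩ.isOpen.measurableSet]
        with x a1 a2 hx
      rw [a2, Pi.smul_apply, a1, smul_eq_mul,
        lap_add (contDiffAt_const.mul (hw.contDiffAt x hx)) contDiffAt_const,
        lap_const_mul _ (hw.contDiffAt x hx), lap_const]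
      have h4 := mul_le_mul_of_nonneg_left (hw.le_neg_lap x hx) (div_nonneg hC hw.const_pos.le)
      have h5 : C / c * (c * w x) = C * w x := by
        have := hw.const_pos.ne'
        field_simp
      linarith
  refine ⟨C / c, div_nonneg hC hw.const_pos.le, ?_⟩
  have h6 : _root_.greenOp Ω h = _root_.greenOp Ω (h - C • wL) + _root_.greenOp Ω (C • wL) := by
    rw [← map_add, sub_add_cancel]
  filter_upwards [h2, h3, Lp.coeFn_add (_root_.greenOp Ω (h - C • wL))
    (_root_.greenOp Ω (C • wL))] with x a1 a2 a3
  rw [h6, a3, Pi.add_apply]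
  have h7 : C₁ * (η / (2 * C₁)) = η / 2 := by field_simp
  linarith

theorem BoundarySmall.greenOp_pow {w : Euc N → ℝ} {c : ℝ} (hw : IsBarrier Ω w c) (hΩ : IsDom Ω)
    {h : L2 Ω} (hh : BoundarySmall Ω w h) (k : ℕ) :
    BoundarySmall Ω w ((_root_.greenOp Ω ^ k) h) := by
  induction k with
  | zero => simpa using hh
  | succ k ih =>
    rw [pow_succ', mul_apply_eq_comp]
    exact ih.greenOp hw hΩ

theorem IsDom.le_smul_greenOp_pow (hΩ : IsDom Ω) {v h : L2 Ω} (hv : v = greenOp Ω h) {Λ : ℝ}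
    (hΛ : 0 ≤ Λ) (hh : h ≤ Λ • v) (k : ℕ) : v ≤ Λ ^ k • (greenOp Ω ^ k) v := by
  induction k with
  | zero => simp
  | succ k ih =>
    refine ih.trans ?_
    have h1 : v ≤ Λ • greenOp Ω v := by
      rw [← map_smul]
      conv_lhs => rw [hv]
      exact hΩ.greenOp_mono hh
    have h2 : (greenOp Ω ^ k) v ≤ Λ • (greenOp Ω ^ (k + 1)) v := by
      rw [pow_succ, mul_apply_eq_comp, ← map_smul]
      exact hΩ.greenOp_pow_mono k h1
    rw [pow_succ Λ, mul_smul]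
    rw [← Lp.coeFn_le] at h2 ⊢
    filter_upwards [h2, Lp.coeFn_smul (Λ ^ k) ((greenOp Ω ^ k) v),
      Lp.coeFn_smul (Λ ^ k) (Λ • (greenOp Ω ^ (k + 1)) v)] with x a1 a2 a3
    rw [a2, a3]
    exact mul_le_mul_of_nonneg_left a1 (pow_nonneg hΛ k)

theorem IsBarrier.exists_measure_lt {w : Euc N → ℝ} {c : ℝ} (hw : IsBarrier Ω w c)
    (hΩ : IsDom Ω) {η : ℝ} (hη : 0 < η) : ∃ t, 0 < t ∧
      ((volume : Measure (Euc N)).restrict Ω).real (Ω ∩ w ⁻¹' Iio t) < η := by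
  have := hΩ.isFiniteMeasure
  have hopen : ∀ t, IsOpen (Ω ∩ w ⁻¹' Iio t) := fun t =>
    (hw.continuousOn.mono subset_closure).isOpen_inter_preimage hΩ.isOpen isOpen_Iio
  have h1 : Tendsto (fun n : ℕ => ((volume : Measure (Euc N)).restrict Ω)
      (Ω ∩ w ⁻¹' Iio (1 / ((n : ℝ) + 1)))) atTop
      (𝓝 (((volume : Measure (Euc N)).restrict Ω) (⋂ n : ℕ, Ω ∩ w ⁻¹' Iio (1 / ((n : ℝ) + 1))))) := by
    refine tendsto_measure_iInter_atTop (fun n => (hopen _).measurableSet.nullMeasurableSet)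
      (fun m n hmn => inter_subset_inter_right _ (preimage_mono (Iio_subset_Iio ?_)))
      ⟨0, measure_ne_top _ _⟩
    exact one_div_le_one_div_of_le (by positivity) (by exact_mod_cast Nat.succ_le_succ hmn)
  have h2 : ⋂ n : ℕ, Ω ∩ w ⁻¹' Iio (1 / ((n : ℝ) + 1)) = ∅ := by
    refine eq_empty_iff_forall_notMem.2 fun x hx => ?_
    have hx' := mem_iInter.1 hx
    obtain ⟨n, hn⟩ := exists_nat_one_div_lt (hw.pos x (hx' 0).1)
    exact lt_asymm hn (hx' n).2
  rw [h2, measure_empty] at h1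
  obtain ⟨n, hn⟩ := (((ENNReal.tendsto_toReal ENNReal.zero_ne_top).comp h1).eventually
    (gt_mem_nhds hη)).exists
  exact ⟨_, by positivity, hn⟩

theorem IsDom.boundarySmall (hΩ : IsDom Ω) {w : Euc N → ℝ} {c : ℝ} (hw : IsBarrier Ω w c)
    {v h : L2 Ω} (hv : v = greenOp Ω h) {Λ B : ℝ} (hΛ : 0 ≤ Λ) (hh : h ≤ Λ • v) (hB : 0 ≤ B)
    (hvB : ∀ᵐ x ∂(volume : Measure (Euc N)).restrict Ω, 0 ≤ v x ∧ v x ≤ B) :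
    BoundarySmall Ω w v := fun η hη => by
  have := hΩ.isFiniteMeasure
  obtain ⟨k, hk⟩ := hΩ.exists_smoothing_ge
  obtain ⟨C, hC, hkC⟩ := hk k le_rfl
  set D := Λ ^ k * C * B + 1 with hD
  have hD0 : 0 < D := by positivity
  obtain ⟨t, ht, hmeas⟩ := hw.exists_measure_lt hΩ (η := η / (2 * D)) (by positivity)
  set T : Set (Euc N) := Ω ∩ w ⁻¹' Iio t with hT
  have hTo : IsOpen T :=
    (hw.continuousOn.mono subset_closure).isOpen_inter_preimage hΩ.isOpen isOpen_Iio
  have hbm : MemLp (T.indicator v) 2 ((volume : Measure (Euc N)).restrict Ω) :=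
    (Lp.memLp v).indicator hTo.measurableSet
  set b : L2 Ω := hbm.toLp _ with hb
  have hbe : b =ᵐ[volume.restrict Ω] T.indicator v := MemLp.coeFn_toLp _
  have ha : BoundarySmall Ω w (v - b : L2 Ω) := fun η' hη' => by
    refine ⟨B / t, by positivity, ?_⟩
    filter_upwards [hbe, Lp.coeFn_sub v b, hvB, ae_restrict_mem hΩ.isOpen.measurableSet]
      with x a1 a2 a3 hx
    rw [a2, Pi.sub_apply, a1]
    have hwx := hw.pos x hx
    by_cases hxT : x ∈ T
    · rw [indicator_of_mem hxT, sub_self]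
      positivity
    · rw [indicator_of_notMem hxT, sub_zero]
      have h1 : t ≤ w x := by
        by_contra! h
        exact hxT ⟨hx, h⟩
      have h2 : B ≤ B / t * w x := by
        rw [div_mul_eq_mul_div, le_div_iff₀ ht]
        exact mul_le_mul_of_nonneg_left h1 hB
      linarith [a3.2]
  have hb0 : 0 ≤ b := by
    rw [← Lp.coeFn_nonneg]
    filter_upwards [hbe, hvB] with x a1 a2
    rw [a1]
    exact indicator_apply_nonneg fun _ => a2.1
  have hbi : ∫ x in Ω, b x ≤ B * ((volume : Measure (Euc N)).restrict Ω).real T := by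
    have h1 : ∫ x in Ω, T.indicator (fun _ => B) x
        = B * ((volume : Measure (Euc N)).restrict Ω).real T := by
      rw [integral_indicator hTo.measurableSet, setIntegral_const, smul_eq_mul, mul_comm]
    rw [← h1]
    refine integral_mono_ae (hΩ.integrable b)
      ((integrable_const B).indicator hTo.measurableSet) ?_
    filter_upwards [hbe, hvB] with x a1 a2
    rw [a1]
    exact indicator_le_indicator a2.2
  obtain ⟨C', hC', hle⟩ := ha.greenOp_pow hw hΩ k (η / (2 * (Λ ^ k + 1))) (by positivity)
  refine ⟨Λ ^ k * C', by positivity, ?_⟩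
  have hvk := hΩ.le_smul_greenOp_pow hv hΛ hh k
  have hsum : (greenOp Ω ^ k) v = (greenOp Ω ^ k) (v - b) + (greenOp Ω ^ k) b := by
    rw [← map_add, sub_add_cancel]
  rw [hsum, ← Lp.coeFn_le] at hvk
  filter_upwards [hvk, hle, hkC b hb0, Lp.coeFn_smul (Λ ^ k)
    ((greenOp Ω ^ k) (v - b) + (greenOp Ω ^ k) b),
    Lp.coeFn_add ((greenOp Ω ^ k) (v - b)) ((greenOp Ω ^ k) b)] with x a1 a2 a3 a4 a5
  rw [a4, Pi.smul_apply, a5, Pi.add_apply, smul_eq_mul] at a1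
  have hΛk : 0 ≤ Λ ^ k := pow_nonneg hΛ k
  have e1 : (greenOp Ω ^ k) b x ≤ C * (B * (η / (2 * D))) :=
    a3.trans (mul_le_mul_of_nonneg_left (hbi.trans
      (mul_le_mul_of_nonneg_left hmeas.le hB)) hC.le)
  have e2 : Λ ^ k * (C * (B * (η / (2 * D)))) ≤ η / 2 := by
    have : Λ ^ k * (C * (B * (η / (2 * D)))) = (D - 1) * (η / (2 * D)) := by rw [hD]; ring
    rw [this]
    have h3 : D * (η / (2 * D)) = η / 2 := by field_simp
    have h4 : 0 < η / (2 * D) := by positivity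
    linarith
  have e3 : Λ ^ k * (η / (2 * (Λ ^ k + 1))) ≤ η / 2 := by
    have h3 : (Λ ^ k + 1) * (η / (2 * (Λ ^ k + 1))) = η / 2 := by field_simp
    have h4 : 0 < η / (2 * (Λ ^ k + 1)) := by positivity
    linarith
  have e4 := mul_le_mul_of_nonneg_left (add_le_add a2 e1) hΛk
  linarith

theorem continuousOn_closure_indicator (hΩ : IsOpen Ω) {w W : Euc N → ℝ}
    (hw : ContinuousOn w (closure Ω)) (hw0 : ∀ x ∈ frontier Ω, w x = 0) (hW : ContinuousOn W Ω)
    (hWpos : ∀ x ∈ Ω, 0 < W x)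
    (h : ∀ η : ℝ, 0 < η → ∃ C : ℝ, 0 ≤ C ∧ ∀ x ∈ Ω, W x ≤ C * w x + η) :
    ContinuousOn (Ω.indicator W) (closure Ω) := fun x hx => by
  by_cases hxΩ : x ∈ Ω
  · have h1 : ContinuousAt W x := hW.continuousAt (hΩ.mem_nhds hxΩ)
    refine (h1.congr ?_).continuousWithinAt
    filter_upwards [hΩ.mem_nhds hxΩ] with y hy using (indicator_of_mem hy W).symm
  have hxf : x ∈ frontier Ω := ⟨hx, by rwa [hΩ.interior_eq]⟩
  rw [ContinuousWithinAt, indicator_of_notMem hxΩ, Metric.tendsto_nhds]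
  intro η hη
  obtain ⟨C, hC, hle⟩ := h (η / 2) (half_pos hη)
  have h1 : Tendsto (fun y => C * w y) (𝓝[closure Ω] x) (𝓝 0) := by
    have := (hw x hx).tendsto.const_mul C
    rwa [hw0 x hxf, mul_zero] at this
  filter_upwards [h1.eventually (gt_mem_nhds (half_pos hη))] with y hy
  rw [dist_zero_right, Real.norm_eq_abs]
  by_cases hyΩ : y ∈ Ω
  · rw [indicator_of_mem hyΩ, abs_of_pos (hWpos y hyΩ)]
    linarith [hle y hyΩ]
  · rwa [indicator_of_notMem hyΩ, abs_zero]

/-- A bounded nonnegative fixed point of the Green operator formulation is a classical positive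
solution. -/
theorem IsDom.exists_isPosSolution (hΩ : IsDom Ω) {w : Euc N → ℝ} {c : ℝ} (hw : IsBarrier Ω w c)
    {f : Euc N → ℝ → ℝ} (hf : ContDiffOn ℝ 1 (Function.uncurry f) (Ω ×ˢ univ)) {lam : ℝ}
    {v h : L2 Ω} (hv : v = greenOp Ω h)
    (hh : ∀ᵐ x ∂(volume : Measure (Euc N)).restrict Ω, h x = f x (v x) - lam * v x) {Λ B : ℝ}
    (hΛ : 0 ≤ Λ) (hB : 0 ≤ B)
    (hvB : ∀ᵐ x ∂(volume : Measure (Euc N)).restrict Ω, 0 ≤ v x ∧ v x ≤ B)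
    (hhB : ∀ᵐ x ∂(volume : Measure (Euc N)).restrict Ω, 0 ≤ h x ∧ h x ≤ Λ * v x) (hv0 : v ≠ 0) :
    ∃ W : Euc N → ℝ, IsPosSolution Ω f lam W ∧ ∀ x ∈ Ω, W x ≤ B := by
  have hH : ContDiffOn ℝ 1 (Function.uncurry fun x t => f x t - lam * t) (Ω ×ˢ univ) :=
    hf.sub (contDiffOn_const.mul contDiff_snd.contDiffOn)
  obtain ⟨W, hW2, hWpos, hWlap, hWv⟩ := hΩ.exists_classical hv hH hh hB (mul_nonneg hΛ hB) hvB
    (by filter_upwards [hhB, hvB] with x a1 a2 using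
      ⟨a1.1, a1.2.trans (mul_le_mul_of_nonneg_left a2.2 hΛ)⟩) hv0
  have hhΛ : h ≤ Λ • v := by
    rw [← Lp.coeFn_le]
    filter_upwards [hhB, Lp.coeFn_smul Λ v] with x a1 a2
    rw [a2]
    exact a1.2
  have hbs := hΩ.boundarySmall hw hv hΛ hhΛ hB hvB
  have hWc := hW2.continuousOn
  have hle : ∀ η : ℝ, 0 < η → ∃ C : ℝ, 0 ≤ C ∧ ∀ x ∈ Ω, W x ≤ C * w x + η := fun η hη => by
    obtain ⟨C, hC, h1⟩ := hbs η hη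
    refine ⟨C, hC, ContinuousOn.le_of_ae_le hΩ.isOpen hWc
      ((continuousOn_const.mul (hw.continuousOn.mono subset_closure)).add continuousOn_const) ?_⟩
    refine (ae_restrict_iff' hΩ.isOpen.measurableSet).1 ?_
    filter_upwards [h1, hWv] with x a1 a2
    rwa [a2]
  have hin : EqOn (Ω.indicator W) W Ω := fun x hx => indicator_of_mem hx W
  refine ⟨Ω.indicator W, ⟨hW2.congr hin, continuousOn_closure_indicator hΩ.isOpen hw.continuousOn
    hw.eq_zero hWc hWpos hle, fun x hx => by rw [hin hx]; exact hWpos x hx, fun x hx => ?_,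
    fun x hx => ?_⟩, fun x hx => ?_⟩
  · refine indicator_of_notMem (fun hxΩ => ?_) W
    exact hx.2 (by rwa [hΩ.isOpen.interior_eq])
  · have h1 : lap (Ω.indicator W) x = lap W x := lap_congr (by
      filter_upwards [hΩ.isOpen.mem_nhds hx] with y hy using hin hy)
    rw [hin hx, h1, hWlap x hx, sub_add_cancel]
  · rw [hin hx]
    refine ContinuousOn.le_of_ae_le hΩ.isOpen hWc continuousOn_const ?_ x hx
    refine (ae_restrict_iff' hΩ.isOpen.measurableSet).1 ?_
    filter_upwards [hvB, hWv] with x a1 a2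
    rw [a2]
    exact a1.2

end Boundary

section Hilbert

variable {E : Type*} [NormedAddCommGroup E] [InnerProductSpace ℝ E]

theorem exists_norm_eigenvector [CompleteSpace E] {T : E →L[ℝ] E} (hT : IsCompactOperator T)
    (hsym : ∀ x y, inner ℝ (T x) y = inner ℝ x (T y)) (hpos : ∀ x, 0 ≤ inner ℝ (T x) x)
    (hT0 : T ≠ 0) : ∃ e : E, ‖e‖ = 1 ∧ T e = ‖T‖ • e := by
  have hn : ‖T‖ ≠ 0 := norm_ne_zero_iff.2 hT0
  have hnt : Nontrivial E := by
    obtain ⟨x, hx⟩ : ∃ x, T x ≠ 0 := by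
      by_contra! h
      exact hT0 (ContinuousLinearMap.ext h)
    exact ⟨T x, 0, hx⟩
  rcases hT.hasEigenvalue_or_mem_resolventSet hn with h | h
  · obtain ⟨v, hv⟩ := h.exists_hasEigenvector
    have hv1 : T v = ‖T‖ • v := hv.apply_eq_smul
    refine ⟨‖v‖⁻¹ • v, ?_, by rw [map_smul, hv1, smul_comm]⟩
    rw [norm_smul, norm_inv, norm_norm, inv_mul_cancel₀ (norm_ne_zero_iff.2 hv.2)]
  · exfalso
    obtain ⟨ε, hε, hle⟩ := T.rayleighQuotient_le_of_norm_mem_resolventSet h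
    have h1 := T.norm_eq_iSup_rayleighQuotient fun x y => hsym x y
    have h2 : ⨆ x, |T.rayleighQuotient x| ≤ ‖T‖ - ε := ciSup_le fun x => by
      have h3 : 0 ≤ T.rayleighQuotient x := div_nonneg (hpos x) (sq_nonneg _)
      rw [abs_of_nonneg h3]
      exact hle x
    linarith

/-- Removing the top eigenvector of a compact positive operator. -/
def deflate (T : E →L[ℝ] E) (e : E) : E →L[ℝ] E :=
  T - ‖T‖ • (ContinuousLinearMap.toSpanSingleton ℝ e).comp (innerSL ℝ e)

theorem deflate_apply (T : E →L[ℝ] E) (e x : E) :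
    deflate T e x = T x - (‖T‖ * inner ℝ e x) • e := by
  simp [deflate, mul_smul]

theorem norm_deflate_lt [CompleteSpace E] {T : E →L[ℝ] E} (hT : IsCompactOperator T)
    (hsym : ∀ x y, inner ℝ (T x) y = inner ℝ x (T y)) (hpos : ∀ x, 0 ≤ inner ℝ (T x) x)
    (hT0 : T ≠ 0) {e : E} (he : ‖e‖ = 1) (hTe : T e = ‖T‖ • e)
    (hsimple : ∀ x, T x = ‖T‖ • x → inner ℝ e x = 0 → x = 0) : ‖deflate T e‖ < ‖T‖ := by
  have hee : inner ℝ e e = 1 := by rw [real_inner_self_eq_norm_sq, he, one_pow]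
  by_cases h0 : deflate T e = 0
  · rw [h0, norm_zero]
    exact norm_pos_iff.2 hT0
  have hc : IsCompactOperator (deflate T e) := hT.sub ((isCompactOperator_rankOne e e).smul ‖T‖)
  have hTein : ∀ x, inner ℝ e (T x) = ‖T‖ * inner ℝ e x := fun x => by
    rw [← hsym, hTe, real_inner_smul_left]
  have hs : ∀ x y, inner ℝ (deflate T e x) y = inner ℝ x (deflate T e y) := fun x y => by
    rw [deflate_apply, deflate_apply, inner_sub_left, inner_sub_right, real_inner_smul_left,
      real_inner_smul_right, hsym, real_inner_comm e x]
    ring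
  have hp : ∀ x, 0 ≤ inner ℝ (deflate T e x) x := fun x => by
    have h1 := hpos (x - inner ℝ e x • e)
    rw [map_sub, map_smul, hTe, inner_sub_left, inner_sub_right, inner_sub_right,
      real_inner_smul_left, real_inner_smul_left, real_inner_smul_right, real_inner_smul_left,
      real_inner_smul_left, real_inner_smul_right, hee,
      real_inner_comm e (T x), hTein] at h1
    rw [deflate_apply, inner_sub_left, real_inner_smul_left]
    linarith
  obtain ⟨z, hz, hz'⟩ := exists_norm_eigenvector hc hs hp h0
  have hn : ‖deflate T e‖ ≠ 0 := norm_ne_zero_iff.2 h0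
  have hez : inner ℝ e z = 0 := by
    have h1 : inner ℝ e (deflate T e z) = 0 := by
      rw [deflate_apply, inner_sub_right, hTein, real_inner_smul_right, hee]
      ring
    rw [hz', real_inner_smul_right] at h1
    exact (mul_eq_zero.1 h1).resolve_left hn
  have hTz : T z = ‖deflate T e‖ • z := by
    rw [← hz', deflate_apply, hez, mul_zero, zero_smul, sub_zero]
  refine lt_of_le_of_ne ?_ fun h => ?_
  · have h1 := T.le_opNorm z
    rwa [hTz, norm_smul, norm_norm, hz, mul_one, mul_one] at h1
  · have h1 := hsimple z (by rw [hTz, h]) hez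
    rw [h1, norm_zero] at hz
    exact zero_ne_one hz

theorem exists_reduced_resolvent [CompleteSpace E] {T : E →L[ℝ] E} (hT : IsCompactOperator T)
    (hsym : ∀ x y, inner ℝ (T x) y = inner ℝ x (T y)) (hpos : ∀ x, 0 ≤ inner ℝ (T x) x)
    (hT0 : T ≠ 0) {e : E} (he : ‖e‖ = 1) (hTe : T e = ‖T‖ • e)
    (hsimple : ∀ x, T x = ‖T‖ • x → inner ℝ e x = 0 → x = 0) :
    ∃ P : E →L[ℝ] E, ∀ x, inner ℝ e (P x) = 0 ∧
      T (‖T‖⁻¹ • P x + x) = P x + (‖T‖ * inner ℝ e x) • e := by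
  have hee : inner ℝ e e = 1 := by rw [real_inner_self_eq_norm_sq, he, one_pow]
  have hn : 0 < ‖T‖ := norm_pos_iff.2 hT0
  have hlt := norm_deflate_lt hT hsym hpos hT0 he hTe hsimple
  set S := deflate T e with hS
  have hA : ‖‖T‖⁻¹ • S‖ < 1 := by
    rw [norm_smul, norm_inv, norm_norm, inv_mul_lt_iff₀ hn, mul_one]
    exact hlt
  set U := Units.oneSub (‖T‖⁻¹ • S) hA with hU
  set P : E →L[ℝ] E := ((U⁻¹ : (E →L[ℝ] E)ˣ) : E →L[ℝ] E) * S with hP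
  have hkey : ∀ x, P x = S (‖T‖⁻¹ • P x + x) := fun x => by
    have h1 : (U : E →L[ℝ] E) * P = S := by rw [hP, Units.mul_inv_cancel_left]
    have h2 := congrArg (fun L : E →L[ℝ] E => L x) h1
    simp only [hU, Units.val_oneSub, sub_mul, one_mul] at h2
    have h3 : P x - ‖T‖⁻¹ • S (P x) = S x := h2
    rw [map_add, map_smul, ← h3, add_sub_cancel]
  have hSe : ∀ x, inner ℝ e (S x) = 0 := fun x => by
    rw [hS, deflate_apply, inner_sub_right, ← hsym, hTe, real_inner_smul_left,
      real_inner_smul_right, hee]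
    ring
  refine ⟨P, fun x => ?_⟩
  have h0 : inner ℝ e (P x) = 0 := by rw [hkey x, hSe]
  refine ⟨h0, ?_⟩
  have h4 := hkey x
  rw [hS, deflate_apply, inner_add_right, real_inner_smul_right, h0, mul_zero, zero_add] at h4
  conv_rhs => rw [h4]
  rw [sub_add_cancel]

theorem lyapunov_map_bounds {P : E →L[ℝ] E} {e : E} (he : ‖e‖ = 1) {Ψ : E → E} {ℓ : ℝ}
    (hℓ : 0 ≤ ℓ) (hΨ : ∀ x y, ‖Ψ x - Ψ y‖ ≤ ℓ * ‖x - y‖) (hΨ0 : Ψ 0 = 0) {ω ω' : E}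
    (hω : ‖ω‖ ≤ 1) (hω' : ‖ω'‖ ≤ 1) :
    ‖P (Ψ (e + ω) - inner ℝ e (Ψ (e + ω)) • ω)‖ ≤ 4 * (‖P‖ * ℓ) ∧
    ‖P (Ψ (e + ω) - inner ℝ e (Ψ (e + ω)) • ω) - P (Ψ (e + ω') - inner ℝ e (Ψ (e + ω')) • ω')‖
      ≤ 4 * (‖P‖ * ℓ) * ‖ω - ω'‖ := by
  have hin : ∀ x, |inner ℝ e x| ≤ ‖x‖ := fun x => by
    have := abs_real_inner_le_norm e x
    rwa [he, one_mul] at this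
  have hb : ‖Ψ (e + ω)‖ ≤ 2 * ℓ := by
    have h1 := hΨ (e + ω) 0
    rw [hΨ0, sub_zero, sub_zero] at h1
    have h2 : ‖e + ω‖ ≤ 2 := (norm_add_le _ _).trans (by linarith)
    nlinarith
  constructor
  · refine (P.le_opNorm _).trans ?_
    have h1 : ‖Ψ (e + ω) - inner ℝ e (Ψ (e + ω)) • ω‖ ≤ 2 * ℓ + 2 * ℓ * 1 := by
      refine (norm_sub_le _ _).trans (add_le_add hb ?_)
      rw [norm_smul, Real.norm_eq_abs]
      exact mul_le_mul ((hin _).trans hb) hω (norm_nonneg _) (by positivity)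
    nlinarith [norm_nonneg P]
  · rw [← map_sub]
    refine (P.le_opNorm _).trans ?_
    have hd : ‖Ψ (e + ω) - Ψ (e + ω')‖ ≤ ℓ * ‖ω - ω'‖ := by
      have := hΨ (e + ω) (e + ω')
      rwa [add_sub_add_left_eq_sub] at this
    have hsplit : Ψ (e + ω) - inner ℝ e (Ψ (e + ω)) • ω -
        (Ψ (e + ω') - inner ℝ e (Ψ (e + ω')) • ω')
        = (Ψ (e + ω) - Ψ (e + ω')) - (inner ℝ e (Ψ (e + ω)) • (ω - ω')
          + inner ℝ e (Ψ (e + ω) - Ψ (e + ω')) • ω') := by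
      rw [inner_sub_right, sub_smul, smul_sub]
      abel
    have h1 : ‖inner ℝ e (Ψ (e + ω)) • (ω - ω')‖ ≤ 2 * ℓ * ‖ω - ω'‖ := by
      rw [norm_smul, Real.norm_eq_abs]
      exact mul_le_mul_of_nonneg_right ((hin _).trans hb) (norm_nonneg _)
    have h2 : ‖inner ℝ e (Ψ (e + ω) - Ψ (e + ω')) • ω'‖ ≤ ℓ * ‖ω - ω'‖ * 1 := by
      rw [norm_smul, Real.norm_eq_abs]
      exact mul_le_mul ((hin _).trans hd) hω' (norm_nonneg _) (by positivity)
    have h3 : ‖Ψ (e + ω) - inner ℝ e (Ψ (e + ω)) • ω -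
        (Ψ (e + ω') - inner ℝ e (Ψ (e + ω')) • ω')‖ ≤ 4 * (ℓ * ‖ω - ω'‖) := by
      rw [hsplit]
      refine (norm_sub_le _ _).trans ?_
      have := norm_add_le (inner ℝ e (Ψ (e + ω)) • (ω - ω'))
        (inner ℝ e (Ψ (e + ω) - Ψ (e + ω')) • ω')
      linarith
    calc ‖P‖ * _ ≤ ‖P‖ * (4 * (ℓ * ‖ω - ω'‖)) := mul_le_mul_of_nonneg_left h3 (norm_nonneg _)
      _ = 4 * (‖P‖ * ℓ) * ‖ω - ω'‖ := by ring

theorem exists_fixedPoint_closedBall {E : Type*} [NormedAddCommGroup E] [CompleteSpace E]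
    {F : E → E} (hF : ∀ x, ‖x‖ ≤ 1 → ‖F x‖ ≤ 1)
    (hLip : ∀ x y, ‖x‖ ≤ 1 → ‖y‖ ≤ 1 → ‖F x - F y‖ ≤ 1 / 2 * ‖x - y‖) :
    ∃ x, ‖x‖ ≤ 1 ∧ F x = x := by
  have hmaps : MapsTo F (Metric.closedBall (0 : E) 1) (Metric.closedBall 0 1) := fun x hx => by
    rw [mem_closedBall_zero_iff] at hx ⊢
    exact hF x hx
  have hcon : ContractingWith (1 / 2 : NNReal) (hmaps.restrict F _ _) := by
    refine ⟨by norm_num, LipschitzWith.of_dist_le_mul fun x y => ?_⟩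
    have := hLip x y (mem_closedBall_zero_iff.1 x.2) (mem_closedBall_zero_iff.1 y.2)
    rw [← dist_eq_norm, ← dist_eq_norm] at this
    simpa [Subtype.dist_eq] using this
  obtain ⟨x, hx, hfix, -⟩ := hcon.exists_fixedPoint' Metric.isClosed_closedBall.isComplete hmaps
    (Metric.mem_closedBall_self zero_le_one) (edist_ne_top _ _)
  exact ⟨x, mem_closedBall_zero_iff.1 hx, hfix⟩

/-- Lyapunov–Schmidt reduction at the top eigenvalue, for a nonlinearity of small Lipschitz
constant. -/
theorem exists_branch [CompleteSpace E] {T P : E →L[ℝ] E} (hT0 : T ≠ 0) {e : E} (he : ‖e‖ = 1)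
    (hTe : T e = ‖T‖ • e) (hP : ∀ x, inner ℝ e (P x) = 0 ∧
      T (‖T‖⁻¹ • P x + x) = P x + (‖T‖ * inner ℝ e x) • e) {Φ : E → E} {ℓ : ℝ} (hℓ : 0 ≤ ℓ)
    (hΦ : ∀ x y, ‖Φ x - Φ y‖ ≤ ℓ * ‖x - y‖) (hΦ0 : Φ 0 = 0) (hsmall : 4 * (‖P‖ * ℓ) ≤ 1 / 2) :
    ∃ (ω : ℝ → E) (ε : ℝ → ℝ), ContinuousOn ε (Ioi 0) ∧ ∀ s, 0 < s →
      ‖ω s‖ ≤ 1 ∧ inner ℝ e (ω s) = 0 ∧ s * ε s = inner ℝ e (Φ (s • (e + ω s))) ∧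
      s • (e + ω s) = T ((‖T‖⁻¹ - ε s) • s • (e + ω s) + Φ (s • (e + ω s))) := by
  have hn : ‖T‖ ≠ 0 := norm_ne_zero_iff.2 hT0
  set Ψ : ℝ → E → E := fun s z => s⁻¹ • Φ (s • z) with hΨ
  have hΨlip : ∀ s, 0 < s → ∀ x y, ‖Ψ s x - Ψ s y‖ ≤ ℓ * ‖x - y‖ := fun s hs x y => by
    rw [hΨ]
    simp only
    rw [← smul_sub, norm_smul, norm_inv, Real.norm_of_nonneg hs.le, inv_mul_le_iff₀ hs]
    refine (hΦ _ _).trans (le_of_eq ?_)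
    rw [← smul_sub, norm_smul, Real.norm_of_nonneg hs.le]
    ring
  have hΨ0 : ∀ s, Ψ s 0 = 0 := fun s => by simp [hΨ, hΦ0]
  have hΦc : Continuous Φ := (LipschitzWith.of_dist_le_mul (K := ⟨ℓ, hℓ⟩) fun x y => by
    rw [dist_eq_norm, dist_eq_norm]; exact hΦ x y).continuous
  have hΨc : ∀ z, ContinuousOn (fun s => Ψ s z) (Ioi 0) := fun z =>
    (continuousOn_id.inv₀ fun s hs => (ne_of_gt hs)).smul
      (hΦc.comp (continuous_id.smul continuous_const)).continuousOn
  set F : ℝ → E → E := fun s ω => P (Ψ s (e + ω) - inner ℝ e (Ψ s (e + ω)) • ω) with hF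
  have hFlip : ∀ s, 0 < s → ∀ x y, ‖x‖ ≤ 1 → ‖y‖ ≤ 1 → ‖F s x - F s y‖ ≤ 1 / 2 * ‖x - y‖ :=
    fun s hs x y hx hy => (lyapunov_map_bounds he hℓ (hΨlip s hs) (hΨ0 s) hx hy).2.trans
      (mul_le_mul_of_nonneg_right hsmall (norm_nonneg _))
  have hfix : ∀ s, ∃ ω, 0 < s → ‖ω‖ ≤ 1 ∧ F s ω = ω := fun s => by
    by_cases hs : 0 < s
    · obtain ⟨x, h1, h2⟩ := exists_fixedPoint_closedBall (F := F s) (fun x hx =>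
        ((lyapunov_map_bounds he hℓ (hΨlip s hs) (hΨ0 s) hx hx).1.trans hsmall).trans
          (by norm_num)) (hFlip s hs)
      exact ⟨x, fun _ => ⟨h1, h2⟩⟩
    · exact ⟨0, fun h => absurd h hs⟩
  choose ω hω using hfix
  have hFc : ∀ z, ContinuousOn (fun s => F s z) (Ioi 0) := fun z =>
    P.continuous.comp_continuousOn ((hΨc _).sub
      ((continuousOn_const.inner (𝕜 := ℝ) (hΨc _)).smul continuousOn_const))
  have hωc : ContinuousOn ω (Ioi 0) := fun t ht => by
    have h1 : Tendsto (fun s => 2 * ‖F s (ω t) - F t (ω t)‖) (𝓝[Ioi 0] t) (𝓝 0) := by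
      have h2 := ((hFc (ω t)) t ht).tendsto.sub_const (F t (ω t))
      rw [sub_self] at h2
      have h3 := h2.norm.const_mul 2
      rwa [norm_zero, mul_zero] at h3
    rw [ContinuousWithinAt, tendsto_iff_norm_sub_tendsto_zero]
    refine squeeze_zero' (Eventually.of_forall fun s => norm_nonneg _) ?_ h1
    filter_upwards [self_mem_nhdsWithin] with s hs
    have h4 := hFlip s hs (ω s) (ω t) (hω s hs).1 (hω t ht).1
    have h5 : ω s - ω t = (F s (ω s) - F s (ω t)) + (F s (ω t) - F t (ω t)) := by
      rw [sub_add_sub_cancel, (hω s hs).2, (hω t ht).2]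
    have h6 := norm_add_le (F s (ω s) - F s (ω t)) (F s (ω t) - F t (ω t))
    rw [← h5] at h6
    linarith
  refine ⟨ω, fun s => s⁻¹ * inner ℝ e (Φ (s • (e + ω s))), ?_, fun s hs => ?_⟩
  · refine (continuousOn_id.inv₀ fun s hs => (ne_of_gt hs)).mul
      (continuousOn_const.inner (𝕜 := ℝ) (hΦc.comp_continuousOn
        (continuousOn_id.smul (continuousOn_const.add hωc))))
  · obtain ⟨h1, h2⟩ := hω s hs
    set X := Ψ s (e + ω s) - inner ℝ e (Ψ s (e + ω s)) • ω s with hX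
    have h2' : P X = ω s := h2
    obtain ⟨h3, h4⟩ := hP X
    rw [h2'] at h3 h4
    have hs' := hs.ne'
    have hΦΨ : Φ (s • (e + ω s)) = s • Ψ s (e + ω s) := by
      simp only [hΨ]
      rw [smul_smul, mul_inv_cancel₀ hs', one_smul]
    simp only
    obtain ⟨ε, hε⟩ : ∃ ε, s⁻¹ * inner ℝ e (Φ (s • (e + ω s))) = ε := ⟨_, rfl⟩
    rw [hε]
    have hεΨ : inner ℝ e (Ψ s (e + ω s)) = ε := by
      rw [← hε, hΦΨ, real_inner_smul_right e (Ψ s (e + ω s)) s, inv_mul_cancel_left₀ hs']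
    refine ⟨h1, h3, by rw [← hε, mul_inv_cancel_left₀ hs'], ?_⟩
    have hX' : inner ℝ e X = ε := by
      rw [hX, inner_sub_right, real_inner_smul_right e (ω s), h3, mul_zero, sub_zero, hεΨ]
    rw [hX'] at h4
    have h7 : (‖T‖⁻¹ - ε) • s • (e + ω s) + Φ (s • (e + ω s))
        = s • ((‖T‖⁻¹ • ω s + X) + (‖T‖⁻¹ - ε) • e) := by
      rw [hΦΨ, hX, hεΨ]
      module
    rw [h7, map_smul, map_add, h4, map_smul, hTe, smul_smul, add_assoc, ← add_smul]
    have h8 : ‖T‖ * ε + (‖T‖⁻¹ - ε) * ‖T‖ = 1 := by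
      field_simp
      ring
    rw [h8, one_smul, add_comm e]

end Hilbert

section Principal

variable {N : ℕ} {Ω : Set (Euc N)}

theorem L2_inner_nonneg {f g : L2 Ω} (hf : 0 ≤ f) (hg : 0 ≤ g) : 0 ≤ inner ℝ f g := by
  rw [L2_inner]
  rw [← Lp.coeFn_nonneg] at hf hg
  refine integral_nonneg_of_ae ?_
  filter_upwards [hf, hg] with x h1 h2 using mul_nonneg h1 h2

theorem L2_eq_zero_of_inner_eq_zero {e y : L2 Ω}
    (he : ∀ᵐ x ∂(volume : Measure (Euc N)).restrict Ω, 0 < e x) (hy : 0 ≤ y)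
    (h : inner ℝ e y = 0) : y = 0 := by
  rw [L2_inner] at h
  rw [← Lp.coeFn_nonneg] at hy
  have h1 : 0 ≤ᵐ[volume.restrict Ω] fun x => e x * y x := by
    filter_upwards [he, hy] with x a1 a2 using mul_nonneg a1.le a2
  have h2 := (integral_eq_zero_iff_of_nonneg_ae h1
    ((Lp.memLp e).integrable_mul (Lp.memLp y))).1 h
  refine Lp.ext ?_
  filter_upwards [h2, he, Lp.coeFn_zero ℝ 2 ((volume : Measure (Euc N)).restrict Ω)]
    with x a1 a2 a3
  rw [a3]
  exact (mul_eq_zero.1 a1).resolve_left a2.ne'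

theorem IsDom.firstEig_smul_greenOp_of_eigenvector (hΩ : IsDom Ω) {y : L2 Ω}
    (hy : greenOp Ω y = ‖greenOp Ω‖ • y) : greenOp Ω (firstEig Ω • y) = y := by
  rw [map_smul, hy, hΩ.norm_greenOp, smul_smul, mul_inv_cancel₀ hΩ.firstEig_pos.ne', one_smul]

theorem IsDom.eigenvector_eq_pow (hΩ : IsDom Ω) {y : L2 Ω}
    (hy : greenOp Ω y = ‖greenOp Ω‖ • y) (k : ℕ) :
    y = firstEig Ω ^ k • (greenOp Ω ^ k) y := by
  induction k with
  | zero => simp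
  | succ k ih =>
    conv_lhs => rw [ih, ← hΩ.firstEig_smul_greenOp_of_eigenvector hy]
    rw [map_smul, map_smul, smul_smul, pow_succ, pow_succ, mul_apply_eq_comp]

theorem IsDom.eigenvector_pos (hΩ : IsDom Ω) {y : L2 Ω} (hy : greenOp Ω y = ‖greenOp Ω‖ • y)
    (hy0 : 0 ≤ y) (hne : y ≠ 0) : ∀ᵐ x ∂(volume : Measure (Euc N)).restrict Ω, 0 < y x := by
  have hl := hΩ.firstEig_pos
  obtain ⟨k, hk⟩ := hΩ.exists_abs_pow_le
  obtain ⟨C, hC, hkC⟩ := hk k le_rfl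
  have hv := (hΩ.firstEig_smul_greenOp_of_eigenvector hy).symm
  set B := firstEig Ω ^ k * (C * ‖y‖) with hB
  have hB0 : 0 ≤ B := by positivity
  rw [← Lp.coeFn_nonneg] at hy0
  have hb : ∀ᵐ x ∂(volume : Measure (Euc N)).restrict Ω, 0 ≤ y x ∧ y x ≤ B := by
    filter_upwards [hkC y, hy0, Lp.coeFn_smul (firstEig Ω ^ k) ((greenOp Ω ^ k) y)]
      with x a1 a2 a3
    refine ⟨a2, ?_⟩
    rw [← hΩ.eigenvector_eq_pow hy k] at a3
    rw [a3]
    exact mul_le_mul_of_nonneg_left ((le_abs_self _).trans a1) (by positivity)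
  have hs := Lp.coeFn_smul (firstEig Ω) y
  have hH : ContDiffOn ℝ 1 (Function.uncurry fun (_ : Euc N) t => firstEig Ω * t)
      (Ω ×ˢ univ) := contDiffOn_const.mul contDiff_snd.contDiffOn
  obtain ⟨W, -, hW, -, hWy⟩ := hΩ.exists_classical hv hH (by filter_upwards [hs] with x a using a)
    hB0 (mul_nonneg hl.le hB0) hb (by
      filter_upwards [hs, hb] with x a1 a2
      rw [a1]
      exact ⟨mul_nonneg hl.le a2.1, mul_le_mul_of_nonneg_left a2.2 hl.le⟩) hne
  filter_upwards [hWy, ae_restrict_mem hΩ.isOpen.measurableSet] with x a1 hx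
  rw [← a1]
  exact hW x hx

theorem eq_smul_of_inner_le {E : Type*} [NormedAddCommGroup E] [InnerProductSpace ℝ E] {a b : E}
    {m : ℝ} (hm : 0 ≤ m) (h1 : ‖b‖ ≤ m * ‖a‖) (h2 : m * ‖a‖ ^ 2 ≤ inner ℝ b a) : b = m • a := by
  rw [← sub_eq_zero, ← norm_eq_zero, ← sq_eq_zero_iff]
  refine le_antisymm ?_ (sq_nonneg _)
  rw [norm_sub_sq_real, real_inner_smul_right, norm_smul, Real.norm_of_nonneg hm]
  have h3 : ‖b‖ ^ 2 ≤ (m * ‖a‖) ^ 2 := pow_le_pow_left₀ (norm_nonneg _) h1 2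
  nlinarith [mul_le_mul_of_nonneg_left h2 hm]

theorem IsDom.eigenvector_abs (hΩ : IsDom Ω) {y : L2 Ω}
    (hy : greenOp Ω y = ‖greenOp Ω‖ • y) : greenOp Ω |y| = ‖greenOp Ω‖ • |y| := by
  have hle : ‖greenOp Ω‖ • |y| ≤ greenOp Ω |y| := by
    have h1 := hΩ.greenOp_mono (le_abs_self y)
    have h2 := hΩ.greenOp_mono (neg_le_abs y)
    rw [map_neg, hy] at h2
    rw [hy] at h1
    rw [← Lp.coeFn_le] at h1 h2 ⊢
    filter_upwards [h1, h2, Lp.coeFn_smul ‖greenOp Ω‖ y, Lp.coeFn_smul ‖greenOp Ω‖ |y|,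
      Lp.coeFn_neg (‖greenOp Ω‖ • y), Lp.coeFn_abs y] with x a1 a2 a3 a4 a5 a6
    rw [a5, Pi.neg_apply, a3, Pi.smul_apply, smul_eq_mul] at a2
    rw [a3, Pi.smul_apply, smul_eq_mul] at a1
    rw [a4, Pi.smul_apply, a6, smul_eq_mul]
    rcases abs_cases (y x) with h | h <;> rw [h.1] <;> linarith
  have h3 := L2_inner_nonneg (sub_nonneg.2 hle) (abs_nonneg y)
  rw [inner_sub_left, real_inner_smul_left, real_inner_self_eq_norm_sq] at h3
  exact eq_smul_of_inner_le (norm_nonneg _) ((greenOp Ω).le_opNorm _) (by linarith)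

theorem IsDom.eigenvector_eq_zero (hΩ : IsDom Ω) {e y : L2 Ω}
    (he : ∀ᵐ x ∂(volume : Measure (Euc N)).restrict Ω, 0 < e x)
    (hy : greenOp Ω y = ‖greenOp Ω‖ • y) (hey : inner ℝ e y = 0) : y = 0 := by
  have h1 : greenOp Ω (|y| + y) = ‖greenOp Ω‖ • (|y| + y) := by
    rw [map_add, hΩ.eigenvector_abs hy, hy, smul_add]
  have h2 : 0 ≤ |y| + y := by
    have := neg_le_abs y
    rw [neg_le_iff_add_nonneg] at this
    exact this
  by_cases h0 : |y| + y = 0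
  · have h3 : 0 ≤ -y := by
      rw [← eq_neg_iff_add_eq_zero.2 h0]
      exact abs_nonneg y
    have h4 := L2_eq_zero_of_inner_eq_zero he h3 (by rw [inner_neg_right, hey, neg_zero])
    exact neg_eq_zero.1 h4
  · refine L2_eq_zero_of_inner_eq_zero he ?_ hey
    rw [← Lp.coeFn_nonneg]
    filter_upwards [hΩ.eigenvector_pos h1 h2 h0, Lp.coeFn_add |y| y, Lp.coeFn_abs y]
      with x a1 a2 a3
    rw [a2, Pi.add_apply, a3] at a1
    show 0 ≤ y x
    by_contra! h
    rw [abs_of_neg h] at a1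
    linarith

theorem IsDom.greenOp_ne_zero (hΩ : IsDom Ω) : greenOp Ω ≠ 0 := by
  rw [← norm_ne_zero_iff, hΩ.norm_greenOp]
  exact inv_ne_zero hΩ.firstEig_pos.ne'

theorem IsDom.exists_principal (hΩ : IsDom Ω) : ∃ e : L2 Ω, ‖e‖ = 1 ∧
    greenOp Ω e = ‖greenOp Ω‖ • e ∧
    (∀ᵐ x ∂(volume : Measure (Euc N)).restrict Ω, 0 < e x) ∧
    ∃ P : L2 Ω →L[ℝ] L2 Ω, ∀ x, inner ℝ e (P x) = 0 ∧
      greenOp Ω (‖greenOp Ω‖⁻¹ • P x + x) = P x + (‖greenOp Ω‖ * inner ℝ e x) • e := by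
  obtain ⟨y, hy1, hy⟩ := exists_norm_eigenvector hΩ.isCompactOperator_greenOp greenOp_symm
    greenOp_inner_self_nonneg hΩ.greenOp_ne_zero
  have he1 : ‖|y|‖ = 1 := by rw [norm_abs_eq_norm, hy1]
  have hpos := hΩ.eigenvector_pos (hΩ.eigenvector_abs hy) (abs_nonneg y)
    (norm_ne_zero_iff.1 (by rw [he1]; exact one_ne_zero))
  exact ⟨|y|, he1, hΩ.eigenvector_abs hy, hpos, exists_reduced_resolvent
    hΩ.isCompactOperator_greenOp greenOp_symm greenOp_inner_self_nonneg hΩ.greenOp_ne_zero he1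
    (hΩ.eigenvector_abs hy) fun x hx hx0 => hΩ.eigenvector_eq_zero hpos hx hx0⟩

end Principal

section Superlinear

variable {φ : ℝ → ℝ} {a b M : ℝ}

lemma pos_of_superlinear (ha : 2 < a)
    (hφ : ∀ t, t ≠ 0 → 0 < (a - 1) * φ t * t) {t : ℝ} (ht : 0 < t) : 0 < φ t := by
  have h := hφ t ht.ne'
  have h1 : 0 < (a - 1) * φ t := pos_of_mul_pos_left h ht.le
  exact pos_of_mul_pos_right h1 (by linarith)

/-- The lower Ambrosetti–Rabinowitz type inequality forces growth of order `a - 1` at `0`. -/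
lemma le_rpow_of_superlinear (hd : Differentiable ℝ φ)
    (hφ : ∀ t, t ≠ 0 → (a - 1) * φ t * t ≤ deriv φ t * t ^ 2) (hM : φ 1 ≤ M)
    {t : ℝ} (ht : 0 < t) (ht1 : t ≤ 1) : φ t ≤ M * t ^ (a - 1) := by
  have hder : ∀ s : ℝ, 0 < s → HasDerivAt (fun r => φ r * r ^ (-(a - 1)))
      (deriv φ s * s ^ (-(a - 1)) + φ s * (-(a - 1) * s ^ (-(a - 1) - 1))) s := fun s hs =>
    (hd s).hasDerivAt.mul (Real.hasDerivAt_rpow_const (Or.inl hs.ne'))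
  have hmono : MonotoneOn (fun r => φ r * r ^ (-(a - 1))) (Ioi 0) := by
    refine monotoneOn_of_deriv_nonneg (convex_Ioi 0)
      (fun s hs => (hder s hs).continuousAt.continuousWithinAt) ?_ ?_
    · rw [interior_Ioi]
      exact fun s hs => (hder s hs).differentiableAt.differentiableWithinAt
    · rw [interior_Ioi]
      intro s hs
      have hs' : 0 < s := hs
      rw [(hder s hs).deriv, Real.rpow_sub_one hs'.ne']
      have h := hφ s hs'.ne'
      have h2 : (a - 1) * φ s / s ≤ deriv φ s := by
        rw [div_le_iff₀ hs']
        nlinarith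
      have h3 : deriv φ s * s ^ (-(a - 1)) + φ s * (-(a - 1) * (s ^ (-(a - 1)) / s))
          = (deriv φ s - (a - 1) * φ s / s) * s ^ (-(a - 1)) := by
        field_simp
        ring
      rw [h3]
      exact mul_nonneg (by linarith) (Real.rpow_nonneg hs'.le _)
  have h1 := hmono (show t ∈ Ioi (0 : ℝ) from ht) (mem_Ioi.2 zero_lt_one) ht1
  simp only [Real.one_rpow, mul_one] at h1
  rw [Real.rpow_neg ht.le, ← div_eq_mul_inv, div_le_iff₀ (Real.rpow_pos_of_pos ht _)] at h1
  exact h1.trans (mul_le_mul_of_nonneg_right hM (Real.rpow_nonneg ht.le _))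

lemma abs_deriv_le_rpow_of_superlinear (ha : 2 < a) (hab : a ≤ b) (hd : Differentiable ℝ φ)
    (hφ : ∀ t, t ≠ 0 → 0 < (a - 1) * φ t * t ∧ (a - 1) * φ t * t ≤ deriv φ t * t ^ 2 ∧
      deriv φ t * t ^ 2 ≤ (b - 1) * φ t * t) (hM : φ 1 ≤ M)
    {t : ℝ} (ht : 0 < t) (ht1 : t ≤ 1) : |deriv φ t| ≤ (b - 1) * M * t ^ (a - 2) := by
  obtain ⟨h1, h2, h3⟩ := hφ t ht.ne'
  have hpos : 0 ≤ deriv φ t := by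
    by_contra hn
    push Not at hn
    nlinarith [sq_pos_of_pos ht]
  rw [abs_of_nonneg hpos]
  have hle := le_rpow_of_superlinear (a := a) hd (fun t ht => (hφ t ht).2.1) hM ht ht1
  have h4 : deriv φ t * t ≤ (b - 1) * φ t := by
    have : deriv φ t * t * t ≤ (b - 1) * φ t * t := by nlinarith
    exact le_of_mul_le_mul_right this ht
  have h5 : t ^ (a - 1) = t ^ (a - 2) * t := by
    rw [← Real.rpow_add_one ht.ne']
    ring_nf
  rw [h5] at hle
  have h6 : deriv φ t * t ≤ (b - 1) * M * t ^ (a - 2) * t := by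
    refine h4.trans ?_
    have := mul_le_mul_of_nonneg_left hle (show 0 ≤ b - 1 by linarith)
    linarith
  exact le_of_mul_le_mul_right h6 ht

end Superlinear

section Nonlinearity

variable {N : ℕ} {Ω : Set (Euc N)} {f : Euc N → ℝ → ℝ}

lemma differentiable_of_uncurry (hΩ : IsOpen Ω)
    (hf : ContDiffOn ℝ 1 (Function.uncurry f) (Ω ×ˢ (univ : Set ℝ))) {x : Euc N} (hx : x ∈ Ω) :
    Differentiable ℝ (f x) := by
  intro t
  have h1 : ContDiffAt ℝ 1 (Function.uncurry f) (x, t) :=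
    hf.contDiffAt ((hΩ.prod isOpen_univ).mem_nhds ⟨hx, mem_univ t⟩)
  have h2 : DifferentiableAt ℝ (fun s : ℝ => (x, s)) t := by fun_prop
  exact (h1.differentiableAt one_ne_zero).comp t h2

/-- The properties of the nonlinearity that enter the bifurcation argument: positivity on the
positive half line and an arbitrarily small Lipschitz constant near `0`, uniformly in `x`. -/
structure IsSuperlinear (Ω : Set (Euc N)) (f : Euc N → ℝ → ℝ) : Prop where
  zero : ∀ x ∈ Ω, f x 0 = 0
  pos : ∀ᵐ x ∂(volume : Measure (Euc N)).restrict Ω, ∀ t, 0 < t → 0 < f x t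
  lipschitz : ∀ ℓ : ℝ, 0 < ℓ → ∃ δ : ℝ, 0 < δ ∧ δ ≤ 1 ∧
    ∀ᵐ x ∂(volume : Measure (Euc N)).restrict Ω, ∀ s ∈ Icc 0 δ, ∀ t ∈ Icc 0 δ,
      |f x s - f x t| ≤ ℓ * |s - t|

theorem Standing.isSuperlinear {d : Euc N → ℝ} {g : Euc N → ℝ → ℝ} {p : ℝ}
    {u : ℝ → Euc N → ℝ} (H : Standing N Ω f d g p u) : IsSuperlinear Ω f := by
  obtain ⟨a, b, ha, hab, -, har⟩ := H.f_ar
  obtain ⟨M, hM, hfM⟩ := H.f_bdd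
  refine ⟨fun x hx => (H.f_zero x hx).1, ?_, fun ℓ hℓ => ?_⟩
  · filter_upwards [har] with x hx t ht
    exact pos_of_superlinear ha (fun t ht => (hx t ht).1) ht
  · have hlim : Tendsto (fun t : ℝ => (b - 1) * M * t ^ (a - 2)) (𝓝[>] 0) (𝓝 0) := by
      have h1 : Tendsto (fun t : ℝ => t ^ (a - 2)) (𝓝 0) (𝓝 ((0 : ℝ) ^ (a - 2))) :=
        (Real.continuousAt_rpow_const 0 (a - 2) (Or.inr (by linarith))).tendsto
      rw [Real.zero_rpow (by linarith)] at h1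
      simpa using (h1.mono_left nhdsWithin_le_nhds).const_mul ((b - 1) * M)
    obtain ⟨δ, ⟨hδℓ, hδ1⟩, hδ0⟩ := ((hlim.eventually (ge_mem_nhds hℓ)).and
      (((tendsto_id (α := ℝ)).mono_left nhdsWithin_le_nhds).eventually
        (ge_mem_nhds (zero_lt_one' ℝ))) |>.and self_mem_nhdsWithin).exists
    have hδ : 0 < δ := hδ0
    refine ⟨δ, hδ, hδ1, ?_⟩
    filter_upwards [har, ae_restrict_mem H.isOpen.measurableSet] with x hx hxΩ s hs t ht
    have hdf := differentiable_of_uncurry H.isOpen H.f_c1 hxΩ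
    have hbound : ∀ r ∈ Icc 0 δ, ‖deriv (f x) r‖ ≤ ℓ := by
      intro r hr
      rcases hr.1.eq_or_lt with h0 | h0
      · rw [← h0, (H.f_zero x hxΩ).2, norm_zero]
        exact hℓ.le
      · rw [Real.norm_eq_abs]
        refine (abs_deriv_le_rpow_of_superlinear ha hab hdf hx
          (le_of_abs_le (hfM x hxΩ).1.le) h0 (hr.2.trans hδ1)).trans (le_trans ?_ hδℓ)
        have : 0 ≤ (b - 1) * M := mul_nonneg (by linarith) hM.le
        exact mul_le_mul_of_nonneg_left
          (Real.rpow_le_rpow h0.le hr.2 (by linarith)) this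
    have := (convex_Icc 0 δ).norm_image_sub_le_of_norm_deriv_le (fun r _ => hdf r) hbound ht hs
    simpa [Real.norm_eq_abs] using this

lemma IsSuperlinear.nonneg (hf : IsSuperlinear Ω f) :
    ∀ᵐ x ∂(volume : Measure (Euc N)).restrict Ω, x ∈ Ω → ∀ t, 0 ≤ t → 0 ≤ f x t := by
  filter_upwards [hf.pos] with x hx hxΩ t ht
  rcases ht.eq_or_lt with h0 | h0
  · rw [← h0, hf.zero x hxΩ]
  · exact (hx t h0).le

lemma abs_clamp_sub_clamp_le (δ s t : ℝ) :
    |max 0 (min s δ) - max 0 (min t δ)| ≤ |s - t| := by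
  have h1 := abs_max_sub_max_le_max 0 (min s δ) 0 (min t δ)
  have h2 := abs_min_sub_min_le_max s δ t δ
  rw [sub_self, abs_zero, max_eq_right (abs_nonneg (min s δ - min t δ))] at h1
  rw [sub_self, abs_zero, max_eq_left (abs_nonneg (s - t))] at h2
  exact h1.trans h2

lemma clamp_mem_Icc {δ : ℝ} (hδ : 0 < δ) (s : ℝ) : max 0 (min s δ) ∈ Icc 0 δ :=
  ⟨le_max_left _ _, max_le hδ.le (min_le_right _ _)⟩

lemma aemeasurable_comp_uncurry (hΩ : IsOpen Ω)
    (hf : ContinuousOn (Function.uncurry f) (Ω ×ˢ (univ : Set ℝ))) {v : Euc N → ℝ}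
    (hv : AEMeasurable v (volume.restrict Ω)) :
    AEMeasurable (fun x => f x (v x)) (volume.restrict Ω) := by
  classical
  have hms : MeasurableSet (Ω ×ˢ (univ : Set ℝ)) := hΩ.measurableSet.prod MeasurableSet.univ
  have hm : Measurable ((Ω ×ˢ (univ : Set ℝ)).piecewise (Function.uncurry f) (fun _ => (0 : ℝ))) :=
    ContinuousOn.measurable_piecewise hf continuousOn_const hms
  have h2 : AEMeasurable (fun x => (x, v x)) (volume.restrict Ω) := aemeasurable_id.prodMk hv
  refine (hm.comp_aemeasurable h2).congr ?_
  filter_upwards [ae_restrict_mem hΩ.measurableSet] with x hx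
  simp [Set.piecewise, hx, Function.uncurry]

/-- The truncated superposition operator `z ↦ f(·, z ∧ δ ∨ 0)` as a Lipschitz map of `L²`. -/
lemma exists_superposition (hΩ : IsDom Ω)
    (hf : ContinuousOn (Function.uncurry f) (Ω ×ˢ (univ : Set ℝ)))
    (hf0 : ∀ x ∈ Ω, f x 0 = 0) {ℓ δ : ℝ} (hℓ : 0 ≤ ℓ) (hδ : 0 < δ)
    (hlip : ∀ᵐ x ∂(volume : Measure (Euc N)).restrict Ω, ∀ s ∈ Icc 0 δ, ∀ t ∈ Icc 0 δ,
      |f x s - f x t| ≤ ℓ * |s - t|) :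
    ∃ Φ : L2 Ω → L2 Ω,
      (∀ z, (Φ z : Euc N → ℝ) =ᵐ[volume.restrict Ω] fun x => f x (max 0 (min (z x) δ))) ∧
      (∀ y z, ‖Φ y - Φ z‖ ≤ ℓ * ‖y - z‖) ∧ Φ 0 = 0 := by
  have hdiff : ∀ᵐ x ∂(volume : Measure (Euc N)).restrict Ω, ∀ s t : ℝ,
      |f x (max 0 (min s δ)) - f x (max 0 (min t δ))| ≤ ℓ * |s - t| := by
    filter_upwards [hlip] with x hx s t
    exact (hx _ (clamp_mem_Icc hδ s) _ (clamp_mem_Icc hδ t)).trans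
      (mul_le_mul_of_nonneg_left (abs_clamp_sub_clamp_le δ s t) hℓ)
  have hmem : ∀ z : L2 Ω, MemLp (fun x => f x (max 0 (min (z x) δ))) 2 (volume.restrict Ω) := by
    intro z
    have hm : AEMeasurable (fun x => max 0 (min (z x) δ)) (volume.restrict Ω) :=
      aemeasurable_const.max
        ((Lp.aestronglyMeasurable z).aemeasurable.min aemeasurable_const)
    refine MemLp.of_le_mul (c := ℓ) (Lp.memLp z)
      (aemeasurable_comp_uncurry hΩ.isOpen hf hm).aestronglyMeasurable ?_
    filter_upwards [hdiff, ae_restrict_mem hΩ.isOpen.measurableSet] with x hx hxΩ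
    have := hx (z x) 0
    rw [min_eq_left hδ.le, max_self, hf0 x hxΩ, sub_zero, sub_zero] at this
    exact this
  have hΦ : ∀ z : L2 Ω, ((hmem z).toLp _ : Euc N → ℝ) =ᵐ[volume.restrict Ω]
      fun x => f x (max 0 (min (z x) δ)) := fun z => (hmem z).coeFn_toLp
  refine ⟨fun z => (hmem z).toLp _, hΦ, fun y z => ?_, ?_⟩
  · refine Lp.norm_le_mul_norm_of_ae_le_mul ?_
    filter_upwards [hΦ y, hΦ z, hdiff, Lp.coeFn_sub ((hmem y).toLp _) ((hmem z).toLp _),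
      Lp.coeFn_sub y z] with x h1 h2 h3 h4 h5
    rw [h4, h5, Pi.sub_apply, Pi.sub_apply, h1, h2]
    exact h3 (y x) (z x)
  · refine Lp.ext ?_
    filter_upwards [hΦ 0, Lp.coeFn_zero ℝ 2 ((volume : Measure (Euc N)).restrict Ω),
      ae_restrict_mem hΩ.isOpen.measurableSet] with x h1 h2 hxΩ
    rw [h1, h2, Pi.zero_apply, min_eq_left hδ.le, max_self, hf0 x hxΩ]

end Nonlinearity

section SmallSolutions

variable {N : ℕ} {Ω : Set (Euc N)} {f : Euc N → ℝ → ℝ}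

/-- A weak maximum principle below the first eigenvalue. -/
theorem IsDom.nonneg_of_neg_le (hΩ : IsDom Ω) {v h : L2 Ω} (hv : v = greenOp Ω h) {μ : ℝ}
    (hμ : 0 ≤ μ) (hμ1 : μ < firstEig Ω) (hh : -h ≤ μ • (-v ⊔ 0)) : 0 ≤ v := by
  obtain ⟨z, hz⟩ : ∃ z : L2 Ω, z = -v ⊔ 0 := ⟨_, rfl⟩
  have hz0 : 0 ≤ z := hz ▸ le_sup_right
  rw [← hz] at hh
  have hμz : 0 ≤ μ • z := by
    rw [← Lp.coeFn_nonneg] at hz0 ⊢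
    filter_upwards [hz0, Lp.coeFn_smul μ z] with x h1 h2
    rw [h2]
    exact mul_nonneg hμ h1
  have hneg : -v = greenOp Ω (-h) := by rw [map_neg, ← hv]
  have h1 : z ≤ greenOp Ω (μ • z) :=
    hz.le.trans (sup_le (hneg.le.trans (hΩ.greenOp_mono hh)) (hΩ.greenOp_nonneg hμz))
  have h2 : ‖z‖ ≤ ‖greenOp Ω (μ • z)‖ := by
    refine norm_le_norm_of_abs_le_abs ?_
    rw [abs_of_nonneg hz0, abs_of_nonneg (hz0.trans h1)]
    exact h1
  have h3 : ‖z‖ ≤ (firstEig Ω)⁻¹ * (μ * ‖z‖) := by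
    refine h2.trans ?_
    have := (greenOp Ω).le_opNorm (μ • z)
    rwa [hΩ.norm_greenOp, norm_smul, Real.norm_of_nonneg hμ] at this
  have hE := hΩ.firstEig_pos
  rw [inv_mul_eq_div, le_div_iff₀ hE] at h3
  have h4 : ‖z‖ = 0 := by
    by_contra hne
    have : 0 < ‖z‖ := lt_of_le_of_ne (norm_nonneg z) (Ne.symm hne)
    nlinarith
  have h5 : -v ≤ z := hz ▸ le_sup_left
  rw [norm_eq_zero.1 h4] at h5
  exact neg_nonpos.1 h5

/-- The data of a point on the bifurcating branch, for the truncated nonlinearity. -/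
structure IsBranchPoint (Ω : Set (Euc N)) (f : Euc N → ℝ → ℝ) (δ ℓ : ℝ) (e : L2 Ω) (s ε : ℝ)
    (v q : L2 Ω) : Prop where
  pos : 0 < s
  q_eq : ∀ᵐ x ∂(volume : Measure (Euc N)).restrict Ω, q x = f x (max 0 (min (v x) δ))
  norm_q_le : ‖q‖ ≤ ℓ * ‖v‖
  norm_le : ‖v‖ ≤ 2 * s
  inner_eq : inner ℝ e v = s
  mul_eq : s * ε = inner ℝ e q
  eq : v = greenOp Ω ((firstEig Ω - ε) • v + q)

namespace IsBranchPoint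

variable {δ ℓ s ε : ℝ} {e v q : L2 Ω}

theorem q_nonneg (hb : IsBranchPoint Ω f δ ℓ e s ε v q) (hΩ : IsDom Ω) (hf : IsSuperlinear Ω f) :
    0 ≤ q := by
  rw [← Lp.coeFn_nonneg]
  filter_upwards [hb.q_eq, hf.nonneg, ae_restrict_mem hΩ.isOpen.measurableSet] with x h1 h2 hx
  rw [h1]
  exact h2 hx _ (le_max_left _ _)

theorem eps_le (hb : IsBranchPoint Ω f δ ℓ e s ε v q) (he : ‖e‖ = 1) {η : ℝ}
    (hη : ‖q‖ ≤ η * ‖v‖) (hη0 : 0 ≤ η) : ε ≤ 2 * η := by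
  have h1 := real_inner_le_norm e q
  rw [he, one_mul, ← hb.mul_eq] at h1
  have h2 := mul_le_mul_of_nonneg_left hb.norm_le hη0
  exact le_of_mul_le_mul_left (by linarith) hb.pos

theorem eps_pos (hb : IsBranchPoint Ω f δ ℓ e s ε v q) (hΩ : IsDom Ω) (hf : IsSuperlinear Ω f)
    (hδ : 0 < δ) (he : ∀ᵐ x ∂(volume : Measure (Euc N)).restrict Ω, 0 < e x) : 0 < ε := by
  have hq := hb.q_nonneg hΩ hf
  have he0 : 0 ≤ e := by
    rw [← Lp.coeFn_nonneg]
    filter_upwards [he] with x hx using hx.le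
  have h0 : 0 ≤ s * ε := by
    rw [hb.mul_eq]
    exact L2_inner_nonneg he0 hq
  refine lt_of_le_of_ne (nonneg_of_mul_nonneg_right h0 hb.pos) fun hε => ?_
  have h1 : inner ℝ e q = 0 := by rw [← hb.mul_eq, ← hε, mul_zero]
  have h2 : q = 0 := L2_eq_zero_of_inner_eq_zero he hq h1
  have h3 : 0 ≤ -v := by
    rw [← Lp.coeFn_nonneg]
    filter_upwards [hb.q_eq, hf.pos, Lp.coeFn_neg v,
      Lp.coeFn_zero ℝ 2 ((volume : Measure (Euc N)).restrict Ω)] with x a1 a2 a3 a4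
    rw [h2, a4, Pi.zero_apply] at a1
    rw [a3, Pi.neg_apply, Pi.zero_apply, neg_nonneg]
    by_contra! hpos
    exact (a2 _ (lt_max_of_lt_right (lt_min hpos hδ))).ne a1
  have h4 := L2_inner_nonneg he0 h3
  rw [inner_neg_right, hb.inner_eq] at h4
  linarith [hb.pos]

theorem ne_zero (hb : IsBranchPoint Ω f δ ℓ e s ε v q) : v ≠ 0 := by
  intro h
  have h1 := hb.inner_eq
  rw [h, inner_zero_right] at h1
  exact hb.pos.ne h1

theorem nonneg (hb : IsBranchPoint Ω f δ ℓ e s ε v q) (hΩ : IsDom Ω) (hf : IsSuperlinear Ω f)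
    (hε : 0 < ε) (hε1 : ε ≤ firstEig Ω) : 0 ≤ v := by
  refine hΩ.nonneg_of_neg_le hb.eq (sub_nonneg.2 hε1) (sub_lt_self _ hε) ?_
  rw [← Lp.coeFn_le]
  have hq := hb.q_nonneg hΩ hf
  rw [← Lp.coeFn_nonneg] at hq
  filter_upwards [hq, Lp.coeFn_neg ((firstEig Ω - ε) • v + q),
    Lp.coeFn_add ((firstEig Ω - ε) • v) q, Lp.coeFn_smul (firstEig Ω - ε) v,
    Lp.coeFn_smul (firstEig Ω - ε) (-v ⊔ 0), Lp.coeFn_sup (-v) 0, Lp.coeFn_neg v]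
    with x a1 a2 a3 a4 a5 a6 a7
  rw [a2, a5, Pi.neg_apply, a3, Pi.add_apply, a4, Pi.smul_apply, Pi.smul_apply, a6, Pi.sup_apply,
    a7, Pi.neg_apply, smul_eq_mul, smul_eq_mul]
  have h1 := mul_le_mul_of_nonneg_left
    (le_sup_left : -(v x) ≤ -(v x) ⊔ (0 : L2 Ω) x) (sub_nonneg.2 hε1)
  have a1' : 0 ≤ q x := a1
  linarith

/-- Pointwise comparison of the right-hand side with `v`. -/
theorem rhs_le (hb : IsBranchPoint Ω f δ ℓ e s ε v q) (hΩ : IsDom Ω) (hf : IsSuperlinear Ω f)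
    (hδ : 0 < δ) (hℓ : 0 ≤ ℓ)
    (hlip : ∀ᵐ x ∂(volume : Measure (Euc N)).restrict Ω, ∀ s ∈ Icc 0 δ, ∀ t ∈ Icc 0 δ,
      |f x s - f x t| ≤ ℓ * |s - t|) (hε : 0 < ε) (hε1 : ε ≤ firstEig Ω) (hv : 0 ≤ v) :
    ∀ᵐ x ∂(volume : Measure (Euc N)).restrict Ω, 0 ≤ v x ∧
      0 ≤ ((firstEig Ω - ε) • v + q) x ∧
      ((firstEig Ω - ε) • v + q) x ≤ (firstEig Ω + ℓ) * v x := by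
  have hq := hb.q_nonneg hΩ hf
  rw [← Lp.coeFn_nonneg] at hq hv
  filter_upwards [hq, hv, hb.q_eq, hlip, Lp.coeFn_add ((firstEig Ω - ε) • v) q,
    Lp.coeFn_smul (firstEig Ω - ε) v, ae_restrict_mem hΩ.isOpen.measurableSet]
    with x a1 a2 a3 a4 a5 a6 hx
  have b1 : 0 ≤ q x := a1
  have b2 : 0 ≤ v x := a2
  rw [a5, Pi.add_apply, a6, Pi.smul_apply, smul_eq_mul]
  have h1 : q x ≤ ℓ * v x := by
    have hc := clamp_mem_Icc hδ (v x)
    have := a4 _ hc 0 ⟨le_rfl, hδ.le⟩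
    rw [hf.zero x hx, sub_zero, sub_zero, abs_of_nonneg hc.1, ← a3] at this
    refine (le_abs_self _).trans (this.trans (mul_le_mul_of_nonneg_left ?_ hℓ))
    exact max_le b2 (min_le_left _ _)
  have h2 := mul_nonneg (sub_nonneg.2 hε1) b2
  have h3 := mul_nonneg hε.le b2
  exact ⟨b2, by linarith, by linarith⟩

theorem le_mul (hb : IsBranchPoint Ω f δ ℓ e s ε v q) (hΩ : IsDom Ω) {Λ : ℝ} (hΛ : 0 ≤ Λ)
    (hle : ∀ᵐ x ∂(volume : Measure (Euc N)).restrict Ω,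
      ((firstEig Ω - ε) • v + q) x ≤ Λ * v x) {k : ℕ} {C : ℝ} (hC : 0 ≤ C)
    (hk : ∀ h : L2 Ω, ∀ᵐ x ∂(volume : Measure (Euc N)).restrict Ω,
      |(greenOp Ω ^ k) h x| ≤ C * ‖h‖) :
    ∀ᵐ x ∂(volume : Measure (Euc N)).restrict Ω, v x ≤ Λ ^ k * (C * 2) * s := by
  have hh : (firstEig Ω - ε) • v + q ≤ Λ • v := by
    rw [← Lp.coeFn_le]
    filter_upwards [hle, Lp.coeFn_smul Λ v] with x h1 h2
    rw [h2]
    exact h1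
  have h1 := hΩ.le_smul_greenOp_pow hb.eq hΛ hh k
  rw [← Lp.coeFn_le] at h1
  filter_upwards [h1, hk v, Lp.coeFn_smul (Λ ^ k) ((greenOp Ω ^ k) v)] with x a1 a2 a3
  rw [a3, Pi.smul_apply, smul_eq_mul] at a1
  refine a1.trans ?_
  rw [mul_assoc]
  refine mul_le_mul_of_nonneg_left ?_ (pow_nonneg hΛ k)
  have := mul_le_mul_of_nonneg_left hb.norm_le hC
  linarith [le_abs_self ((greenOp Ω ^ k) v x)]

theorem norm_q_le_of_le (hb : IsBranchPoint Ω f δ ℓ e s ε v q) (hΩ : IsDom Ω)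
    (hf : IsSuperlinear Ω f) {η δ' : ℝ} (hδ' : 0 < δ')
    (hlip : ∀ᵐ x ∂(volume : Measure (Euc N)).restrict Ω, ∀ s ∈ Icc 0 δ', ∀ t ∈ Icc 0 δ',
      |f x s - f x t| ≤ η * |s - t|)
    (hv : ∀ᵐ x ∂(volume : Measure (Euc N)).restrict Ω, 0 ≤ v x ∧ v x ≤ min δ δ') :
    ‖q‖ ≤ η * ‖v‖ := by
  refine Lp.norm_le_mul_norm_of_ae_le_mul ?_
  filter_upwards [hlip, hv, hb.q_eq, ae_restrict_mem hΩ.isOpen.measurableSet] with x a1 a2 a3 hx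
  rw [min_eq_left (a2.2.trans (min_le_left _ _)), max_eq_right a2.1] at a3
  have := a1 (v x) ⟨a2.1, a2.2.trans (min_le_right _ _)⟩ 0 ⟨le_rfl, hδ'.le⟩
  rw [hf.zero x hx, sub_zero, sub_zero] at this
  rwa [a3]

theorem exists_isPosSolution (hb : IsBranchPoint Ω f δ ℓ e s ε v q) (hΩ : IsDom Ω)
    {w : Euc N → ℝ} {c : ℝ} (hw : IsBarrier Ω w c)
    (hf : ContDiffOn ℝ 1 (Function.uncurry f) (Ω ×ˢ univ)) {Λ B : ℝ} (hΛ : 0 ≤ Λ) (hB : 0 ≤ B)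
    (hBδ : B ≤ δ)
    (hrhs : ∀ᵐ x ∂(volume : Measure (Euc N)).restrict Ω, 0 ≤ v x ∧
      0 ≤ ((firstEig Ω - ε) • v + q) x ∧ ((firstEig Ω - ε) • v + q) x ≤ Λ * v x)
    (hvB : ∀ᵐ x ∂(volume : Measure (Euc N)).restrict Ω, v x ≤ B) :
    ∃ W : Euc N → ℝ, IsPosSolution Ω f (-firstEig Ω + ε) W ∧ ∀ x ∈ Ω, W x ≤ B := by
  refine hΩ.exists_isPosSolution hw hf hb.eq ?_ hΛ hB
    (hrhs.and hvB |>.mono fun x hx => ⟨hx.1.1, hx.2⟩) (hrhs.mono fun x hx => hx.2) hb.ne_zero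
  filter_upwards [hrhs, hvB, hb.q_eq, Lp.coeFn_add ((firstEig Ω - ε) • v) q,
    Lp.coeFn_smul (firstEig Ω - ε) v] with x a1 a2 a3 a4 a5
  rw [min_eq_left (a2.trans hBδ), max_eq_right a1.1] at a3
  rw [a4, Pi.add_apply, a5, Pi.smul_apply, smul_eq_mul, a3]
  ring

end IsBranchPoint

theorem IsDom.exists_branchPoints (hΩ : IsDom Ω) (hf : IsSuperlinear Ω f)
    (hfc : ContinuousOn (Function.uncurry f) (Ω ×ˢ univ)) :
    ∃ (e : L2 Ω) (δ ℓ : ℝ) (ε : ℝ → ℝ), ‖e‖ = 1 ∧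
      (∀ᵐ x ∂(volume : Measure (Euc N)).restrict Ω, 0 < e x) ∧ 0 < δ ∧ 0 < ℓ ∧
      2 * ℓ ≤ firstEig Ω ∧
      (∀ᵐ x ∂(volume : Measure (Euc N)).restrict Ω, ∀ s ∈ Icc 0 δ, ∀ t ∈ Icc 0 δ,
        |f x s - f x t| ≤ ℓ * |s - t|) ∧
      ContinuousOn ε (Ioi 0) ∧ ∀ s, 0 < s → ∃ v q, IsBranchPoint Ω f δ ℓ e s (ε s) v q := by
  obtain ⟨e, he1, heig, hepos, P, hP⟩ := hΩ.exists_principal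
  have hE := hΩ.firstEig_pos
  obtain ⟨ℓ, hℓ, hℓ1, hℓ2⟩ : ∃ ℓ : ℝ, 0 < ℓ ∧ 2 * ℓ ≤ firstEig Ω ∧ 4 * (‖P‖ * ℓ) ≤ 1 / 2 := by
    refine ⟨min (firstEig Ω / 2) (1 / (8 * (‖P‖ + 1))), by positivity, ?_, ?_⟩
    · linarith [min_le_left (firstEig Ω / 2) (1 / (8 * (‖P‖ + 1)))]
    · have h1 := min_le_right (firstEig Ω / 2) (1 / (8 * (‖P‖ + 1)))
      have h2 := mul_le_mul_of_nonneg_left h1 (norm_nonneg P)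
      have h3 : ‖P‖ * (1 / (8 * (‖P‖ + 1))) ≤ 1 / 8 := by
        rw [mul_one_div, div_le_div_iff₀ (by positivity) (by positivity)]
        linarith
      linarith
  obtain ⟨δ, hδ, -, hlip⟩ := hf.lipschitz ℓ hℓ
  obtain ⟨Φ, hΦ, hΦlip, hΦ0⟩ := exists_superposition hΩ hfc hf.zero hℓ.le hδ hlip
  obtain ⟨ω, ε, hε, hω⟩ := exists_branch hΩ.greenOp_ne_zero he1 heig hP hℓ.le hΦlip hΦ0 hℓ2
  refine ⟨e, δ, ℓ, ε, he1, hepos, hδ, hℓ, hℓ1, hlip, hε, fun s hs => ?_⟩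
  obtain ⟨h1, h2, h3, h4⟩ := hω s hs
  rw [hΩ.norm_greenOp, inv_inv] at h4
  refine ⟨s • (e + ω s), Φ (s • (e + ω s)), hs, hΦ _, ?_, ?_, ?_, h3, h4⟩
  · have := hΦlip (s • (e + ω s)) 0
    rwa [hΦ0, sub_zero, sub_zero] at this
  · rw [norm_smul, Real.norm_of_nonneg hs.le, mul_comm]
    refine mul_le_mul_of_nonneg_right ((norm_add_le _ _).trans ?_) hs.le
    linarith
  · rw [real_inner_smul_right e (e + ω s) s, inner_add_right, h2, real_inner_self_eq_norm_sq, he1]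
    ring

/-- A continuous branch of small positive solutions emanating from the first eigenvalue. -/
theorem IsDom.exists_small_solutions (hΩ : IsDom Ω) {w : Euc N → ℝ} {c : ℝ}
    (hw : IsBarrier Ω w c) (hf : IsSuperlinear Ω f)
    (hfc : ContDiffOn ℝ 1 (Function.uncurry f) (Ω ×ˢ univ)) :
    ∃ (ε : ℝ → ℝ) (C s₀ : ℝ), 0 < C ∧ 0 < s₀ ∧ ContinuousOn ε (Ioi 0) ∧
      Tendsto ε (𝓝[>] 0) (𝓝 0) ∧ ∀ s, 0 < s → s < s₀ → 0 < ε s ∧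
        ∃ W : Euc N → ℝ, IsPosSolution Ω f (-firstEig Ω + ε s) W ∧ ∀ x ∈ Ω, W x ≤ C * s := by
  obtain ⟨e, δ, ℓ, ε, he1, hepos, hδ, hℓ, hℓ1, hlip, hε, hb⟩ :=
    hΩ.exists_branchPoints hf hfc.continuousOn
  obtain ⟨k, hk⟩ := hΩ.exists_abs_pow_le
  obtain ⟨C, hC, hCk⟩ := hk k le_rfl
  have hE := hΩ.firstEig_pos
  have hΛ : 0 < firstEig Ω + ℓ := by linarith
  obtain ⟨K, hK⟩ : ∃ K, K = (firstEig Ω + ℓ) ^ k * (C * 2) := ⟨_, rfl⟩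
  have hK0 : 0 < K := hK ▸ by positivity
  have hmain : ∀ s, 0 < s → ∃ v q, IsBranchPoint Ω f δ ℓ e s (ε s) v q ∧ 0 < ε s ∧
      (∀ᵐ x ∂(volume : Measure (Euc N)).restrict Ω, 0 ≤ v x ∧
        0 ≤ ((firstEig Ω - ε s) • v + q) x ∧
        ((firstEig Ω - ε s) • v + q) x ≤ (firstEig Ω + ℓ) * v x) ∧
      ∀ᵐ x ∂(volume : Measure (Euc N)).restrict Ω, v x ≤ K * s := by
    intro s hs
    obtain ⟨v, q, hvq⟩ := hb s hs
    have hε0 := hvq.eps_pos hΩ hf hδ hepos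
    have hε1 := (hvq.eps_le he1 hvq.norm_q_le hℓ.le).trans hℓ1
    have hv := hvq.nonneg hΩ hf hε0 hε1
    have hr := hvq.rhs_le hΩ hf hδ hℓ.le hlip hε0 hε1 hv
    exact ⟨v, q, hvq, hε0, hr, hK ▸ hvq.le_mul hΩ hΛ.le (hr.mono fun x hx => hx.2.2) hC.le hCk⟩
  refine ⟨ε, K, δ / K, hK0, by positivity, hε, ?_, fun s hs hs0 => ?_⟩
  · rw [Metric.tendsto_nhdsWithin_nhds]
    intro η hη
    obtain ⟨δ', hδ', -, hlip'⟩ := hf.lipschitz (η / 4) (by positivity)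
    refine ⟨min δ δ' / K, by positivity, fun {s} hs hsd => ?_⟩
    have hs' : 0 < s := hs
    rw [Real.dist_0_eq_abs, abs_of_pos hs', lt_div_iff₀ hK0] at hsd
    obtain ⟨v, q, hvq, hε0, hr, hvs⟩ := hmain s hs'
    rw [Real.dist_0_eq_abs, abs_of_pos hε0]
    have hq := hvq.norm_q_le_of_le hΩ hf hδ' hlip'
      (hr.and hvs |>.mono fun x hx => ⟨hx.1.1, hx.2.trans (by linarith)⟩)
    linarith [hvq.eps_le he1 hq (by positivity)]
  · obtain ⟨v, q, hvq, hε0, hr, hvs⟩ := hmain s hs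
    rw [lt_div_iff₀ hK0] at hs0
    exact ⟨hε0, hvq.exists_isPosSolution hΩ hw hfc hΛ.le (by positivity) (by linarith) hr hvs⟩

/-- If positive solutions are unique, they are uniformly small near the bifurcation value
`-λ₁(Ω)`. -/
theorem IsDom.eventually_le (hΩ : IsDom Ω) {w : Euc N → ℝ} {c : ℝ}
    (hw : IsBarrier Ω w c) (hf : IsSuperlinear Ω f)
    (hfc : ContDiffOn ℝ 1 (Function.uncurry f) (Ω ×ˢ univ)) {u : ℝ → Euc N → ℝ}
    (hu : ∀ lam, -firstEig Ω < lam → ∀ v, IsPosSolution Ω f lam v → EqOn v (u lam) (closure Ω))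
    {σ : ℝ} (hσ : 0 < σ) : ∀ᶠ lam in 𝓝[>] (-firstEig Ω), ∀ x ∈ Ω, u lam x ≤ σ := by
  obtain ⟨ε, C, s₀, hC, hs₀, hεc, hε0, hsol⟩ := hΩ.exists_small_solutions hw hf hfc
  obtain ⟨s₁, hs₁, hs₁0, hs₁σ⟩ : ∃ s₁, 0 < s₁ ∧ s₁ < s₀ ∧ C * s₁ ≤ σ := by
    refine ⟨min (s₀ / 2) (σ / C), by positivity, ?_, ?_⟩
    · linarith [min_le_left (s₀ / 2) (σ / C)]
    · have := mul_le_mul_of_nonneg_left (min_le_right (s₀ / 2) (σ / C)) hC.le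
      rwa [mul_div_cancel₀ _ hC.ne'] at this
  have hε1 := (hsol s₁ hs₁ hs₁0).1
  filter_upwards [Ioo_mem_nhdsGT (show -firstEig Ω < -firstEig Ω + ε s₁ by linarith)]
    with lam hlam x hx
  have hpos : 0 < lam + firstEig Ω := by linarith [hlam.1]
  obtain ⟨s₂, ⟨hs₂ε, hs₂1⟩, hs₂⟩ := ((hε0.eventually (gt_mem_nhds hpos)).and
    ((((tendsto_id (α := ℝ)).mono_left nhdsWithin_le_nhds).eventually (gt_mem_nhds hs₁))) |>.and
      self_mem_nhdsWithin).exists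
  have hs₂0 : 0 < s₂ := hs₂
  have hs₂1' : s₂ < s₁ := hs₂1
  obtain ⟨s, ⟨hs2, hs1⟩, hs⟩ := intermediate_value_Icc hs₂1'.le
    (hεc.mono fun r hr => hs₂0.trans_le hr.1)
    (show lam + firstEig Ω ∈ Icc (ε s₂) (ε s₁) from ⟨hs₂ε.le, by linarith [hlam.2]⟩)
  obtain ⟨-, W, hW, hWle⟩ := hsol s (hs₂0.trans_le hs2) (hs1.trans_lt hs₁0)
  have hl : -firstEig Ω + ε s = lam := by linarith
  rw [hl] at hW
  rw [← hu lam hlam.1 W hW (subset_closure hx)]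
  exact (hWle x hx).trans ((mul_le_mul_of_nonneg_left hs1 hC.le).trans hs₁σ)

end SmallSolutions

/-- A `C¹` cut-off of the identity near `0`. -/
theorem exists_cutoff {t : ℝ} (ht : 0 < t) : ∃ η η' : ℝ → ℝ, (∀ r, HasDerivAt η (η' r) r) ∧
    Continuous η' ∧ (∀ r, r ≤ t → η r = 0) ∧ (∀ r, 0 ≤ r → 0 ≤ η r ∧ η r ≤ r) ∧
    (∀ r, 0 ≤ η' r) ∧ ∀ r, 2 * t ≤ r → η' r = 1 := by
  have hmono : ∀ r : ℝ, max (r - 2 * t) 0 ≤ max (r - t) 0 := fun r =>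
    max_le_max (by linarith) le_rfl
  have hle : ∀ r : ℝ, max (r - t) 0 ≤ max (r - 2 * t) 0 + t := fun r =>
    max_le (by linarith [le_max_left (r - 2 * t) 0]) (by linarith [le_max_right (r - 2 * t) 0])
  have h0 : ∀ r : ℝ, 0 ≤ max (r - 2 * t) 0 := fun r => le_max_right _ _
  refine ⟨fun r => (max (r - t) 0 ^ 2 - max (r - 2 * t) 0 ^ 2) / (2 * t),
    fun r => (max (r - t) 0 - max (r - 2 * t) 0) / t, fun r => ?_, by fun_prop, fun r hr => ?_,
    fun r hr => ⟨?_, ?_⟩, fun r => ?_, fun r hr => ?_⟩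
  · have h1 := (hasDerivAt_max_sq (r - t)).scomp r ((hasDerivAt_id r).sub_const t)
    have h2 := (hasDerivAt_max_sq (r - 2 * t)).scomp r ((hasDerivAt_id r).sub_const (2 * t))
    refine ((h1.sub h2).div_const (2 * t)).congr_deriv ?_
    simp only [smul_eq_mul]
    field_simp
  · simp [max_eq_right (show r - t ≤ 0 by linarith), max_eq_right (show r - 2 * t ≤ 0 by linarith)]
  · refine div_nonneg ?_ (by positivity)
    nlinarith [hmono r, h0 r]
  · rw [div_le_iff₀ (by positivity)]
    have h3 : max (r - t) 0 ≤ r := max_le (by linarith) hr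
    nlinarith [hmono r, h0 r, hle r]
  · exact div_nonneg (by linarith [hmono r]) ht.le
  · simp only
    rw [max_eq_left (by linarith), max_eq_left (by linarith), div_eq_one_iff_eq ht.ne']
    ring

/-- A Fatou type bound for integrals of nonnegative functions. -/
theorem integral_le_of_tendsto_ae {α : Type*} [MeasurableSpace α] {μ : Measure α}
    {F : ℕ → α → ℝ} {G : α → ℝ} {C : ℝ} (hF : ∀ n, Integrable (F n) μ)
    (hF0 : ∀ n, 0 ≤ᵐ[μ] F n) (hC : ∀ n, ∫ x, F n x ∂μ ≤ C)
    (hlim : ∀ᵐ x ∂μ, Tendsto (fun n => F n x) atTop (𝓝 (G x))) : ∫ x, G x ∂μ ≤ C := by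
  have hGm : AEStronglyMeasurable G μ :=
    aestronglyMeasurable_of_tendsto_ae atTop (fun n => (hF n).aestronglyMeasurable) hlim
  have hG0 : 0 ≤ᵐ[μ] G := by
    filter_upwards [hlim, ae_all_iff.2 hF0] with x h1 h2
    exact ge_of_tendsto' h1 h2
  have hC0 : 0 ≤ C := (integral_nonneg_of_ae (hF0 0)).trans (hC 0)
  rw [integral_eq_lintegral_of_nonneg_ae hG0 hGm]
  refine ENNReal.toReal_le_of_le_ofReal hC0 ?_
  calc ∫⁻ x, ENNReal.ofReal (G x) ∂μ
      = ∫⁻ x, liminf (fun n => ENNReal.ofReal (F n x)) atTop ∂μ := by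
        refine lintegral_congr_ae ?_
        filter_upwards [hlim] with x hx
        exact ((ENNReal.continuous_ofReal.tendsto _).comp hx).liminf_eq.symm
    _ ≤ liminf (fun n => ∫⁻ x, ENNReal.ofReal (F n x) ∂μ) atTop :=
        lintegral_liminf_le' fun n => (hF n).aemeasurable.ennreal_ofReal
    _ ≤ ENNReal.ofReal C := by
        refine liminf_le_of_le (by isBoundedDefault) fun b hb => ?_
        obtain ⟨n, hn⟩ := hb.exists
        refine hn.trans ?_
        rw [← ofReal_integral_eq_lintegral_ofReal (hF n) (hF0 n)]
        exact ENNReal.ofReal_le_ofReal (hC n)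

section EnergyBound

variable {N : ℕ} {Ω : Set (Euc N)} {u : Euc N → ℝ}

/-- Truncating a function with zero boundary values away from `0` gives a test function. -/
theorem isTest_cutoff (hΩ : IsDom Ω) (hu : ContDiffOn ℝ 2 u Ω) (huc : ContinuousOn u (closure Ω))
    (hu0 : ∀ x ∈ frontier Ω, u x = 0) {t : ℝ} (ht : 0 < t) {η η' : ℝ → ℝ}
    (hη : ∀ r, HasDerivAt η (η' r) r) (hη' : Continuous η') (hηt : ∀ r, r ≤ t → η r = 0) :
    IsTest Ω (Ω.indicator fun x => η (u x)) := by
  have hKc : IsCompact (closure Ω ∩ u ⁻¹' Ici t) :=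
    hΩ.bdd.isCompact_closure.of_isClosed_subset
      (huc.preimage_isClosed_of_isClosed isClosed_closure isClosed_Ici) inter_subset_left
  have hKΩ : closure Ω ∩ u ⁻¹' Ici t ⊆ Ω := by
    rintro x ⟨hx, hxt⟩
    by_contra hxΩ
    have h1 : u x = 0 := hu0 x ⟨hx, by rwa [hΩ.isOpen.interior_eq]⟩
    have h2 : t ≤ u x := hxt
    linarith
  have hzero : ∀ x, x ∉ closure Ω ∩ u ⁻¹' Ici t → Ω.indicator (fun x => η (u x)) x = 0 := by
    intro x hx
    by_cases hxΩ : x ∈ Ω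
    · rw [indicator_of_mem hxΩ]
      refine hηt _ ?_
      by_contra! h
      exact hx ⟨subset_closure hxΩ, h.le⟩
    · exact indicator_of_notMem hxΩ _
  have hsupp : tsupport (Ω.indicator fun x => η (u x)) ⊆ closure Ω ∩ u ⁻¹' Ici t := by
    refine closure_minimal (fun x hx => ?_) hKc.isClosed
    by_contra h
    exact hx (hzero x h)
  have hηc : ContDiff ℝ 1 η := by
    rw [contDiff_one_iff_deriv]
    refine ⟨fun r => (hη r).differentiableAt, ?_⟩
    rwa [show deriv η = η' from funext fun r => (hη r).deriv]
  refine ⟨contDiff_iff_contDiffAt.2 fun x => ?_, HasCompactSupport.of_support_subset_isCompact hKc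
    (subset_closure.trans hsupp), hsupp.trans hKΩ⟩
  by_cases hx : x ∈ Ω
  · have h1 : ContDiffAt ℝ 1 (fun y => η (u y)) x :=
      hηc.contDiffAt.comp x ((hu.contDiffAt (hΩ.isOpen.mem_nhds hx)).of_le (by norm_num))
    refine h1.congr_of_eventuallyEq ?_
    filter_upwards [hΩ.isOpen.mem_nhds hx] with y hy
    exact indicator_of_mem hy _
  · refine (contDiffAt_const (c := (0 : ℝ))).congr_of_eventuallyEq ?_
    filter_upwards [hKc.isClosed.isOpen_compl.mem_nhds fun h => hx (hKΩ h)] with y hy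
    exact hzero y hy

theorem inner_gradient_cutoff (hΩ : IsDom Ω) (hu : ContDiffOn ℝ 2 u Ω) {η η' : ℝ → ℝ}
    (hη : ∀ r, HasDerivAt η (η' r) r) {x : Euc N} (hx : x ∈ Ω) :
    inner ℝ (gradient u x) (gradient (Ω.indicator fun y => η (u y)) x)
      = η' (u x) * ‖fderiv ℝ u x‖ ^ 2 := by
  have h1 : (Ω.indicator fun y => η (u y)) =ᶠ[𝓝 x] fun y => η (u y) := by
    filter_upwards [hΩ.isOpen.mem_nhds hx] with y hy
    exact indicator_of_mem hy _
  have h2 : HasFDerivAt u (fderiv ℝ u x) x :=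
    ((hu.contDiffAt (hΩ.isOpen.mem_nhds hx)).differentiableAt two_ne_zero).hasFDerivAt
  have h3 : fderiv ℝ (Ω.indicator fun y => η (u y)) x = η' (u x) • fderiv ℝ u x := by
    rw [h1.fderiv_eq]
    exact ((hη (u x)).comp_hasFDerivAt x h2).fderiv
  rw [inner_gradient, h3, ← norm_gradient, ← real_inner_self_eq_norm_sq, inner_gradient,
    Finset.mul_sum]
  refine Finset.sum_congr rfl fun i _ => ?_
  rw [_root_.smul_apply, smul_eq_mul]
  ring

theorem IsDom.integral_cutoff_le (hΩ : IsDom Ω) (hu : ContDiffOn ℝ 2 u Ω)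
    (huc : ContinuousOn u (closure Ω)) (hu0 : ∀ x ∈ frontier Ω, u x = 0) {σ K : ℝ} (hK : 0 ≤ K)
    (huσ : ∀ x ∈ Ω, 0 ≤ u x ∧ u x ≤ σ)
    (hlap : ∀ᵐ x ∂(volume : Measure (Euc N)).restrict Ω, -lap u x ≤ K) {t : ℝ} (ht : 0 < t)
    {η η' : ℝ → ℝ} (hη : ∀ r, HasDerivAt η (η' r) r) (hη' : Continuous η')
    (hηt : ∀ r, r ≤ t → η r = 0) (hη0 : ∀ r, 0 ≤ r → 0 ≤ η r ∧ η r ≤ r) :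
    IntegrableOn (fun x => η' (u x) * ‖fderiv ℝ u x‖ ^ 2) Ω ∧
      ∫ x in Ω, η' (u x) * ‖fderiv ℝ u x‖ ^ 2 ≤ K * σ * (volume : Measure (Euc N)).real Ω := by
  have := hΩ.isFiniteMeasure
  have hm := hΩ.isOpen.measurableSet
  have hχ := isTest_cutoff hΩ hu huc hu0 ht hη hη' hηt
  obtain ⟨i1, i2, i3⟩ := hχ.integral_inner_gradient hΩ.isOpen
    fun x hx => hu.contDiffAt (hΩ.isOpen.mem_nhds hx)
  have hin : EqOn (fun x => inner ℝ (gradient u x) (gradient (Ω.indicator fun y => η (u y)) x))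
      (fun x => η' (u x) * ‖fderiv ℝ u x‖ ^ 2) Ω := fun x hx => inner_gradient_cutoff hΩ hu hη hx
  refine ⟨(integrableOn_congr_fun hin hm).1 i1.integrableOn, ?_⟩
  rw [← setIntegral_congr_fun hm hin, setIntegral_eq_integral_of_forall_compl_eq_zero, i3,
    ← integral_neg, ← setIntegral_eq_integral_of_forall_compl_eq_zero (s := Ω)]
  · calc ∫ x in Ω, -(lap u x * Ω.indicator (fun y => η (u y)) x)
        ≤ ∫ _ in Ω, K * σ := by
          refine integral_mono_ae i2.neg.integrableOn (integrable_const _) ?_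
          filter_upwards [hlap, ae_restrict_mem hm] with x h1 hx
          rw [indicator_of_mem hx]
          obtain ⟨h2, h3⟩ := hη0 (u x) (huσ x hx).1
          have h4 := mul_le_mul_of_nonneg_right h1 h2
          have h5 := mul_le_mul_of_nonneg_left (h3.trans (huσ x hx).2) hK
          linarith
      _ = K * σ * (volume : Measure (Euc N)).real Ω := by
          rw [setIntegral_const, smul_eq_mul, mul_comm]
  · intro x hx
    rw [hχ.eq_zero hx, mul_zero, neg_zero]
  · intro x hx
    rw [inner_gradient, hχ.fderiv_eq_zero hx]
    simp

/-- The `H¹` norm of a function with zero boundary values is controlled by its supremum and an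
upper bound for `-Δu`. -/
theorem IsDom.integral_energy_le (hΩ : IsDom Ω) (hu : ContDiffOn ℝ 2 u Ω)
    (huc : ContinuousOn u (closure Ω)) (hu0 : ∀ x ∈ frontier Ω, u x = 0)
    (hpos : ∀ x ∈ Ω, 0 < u x) {σ K : ℝ} (hK : 0 ≤ K) (huσ : ∀ x ∈ Ω, u x ≤ σ)
    (hlap : ∀ᵐ x ∂(volume : Measure (Euc N)).restrict Ω, -lap u x ≤ K) :
    ∫ x in Ω, (‖fderiv ℝ u x‖ ^ 2 + u x ^ 2)
      ≤ (K * σ + σ ^ 2) * (volume : Measure (Euc N)).real Ω := by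
  have := hΩ.isFiniteMeasure
  have hm := hΩ.isOpen.measurableSet
  have huσ' : ∀ x ∈ Ω, 0 ≤ u x ∧ u x ≤ σ := fun x hx => ⟨(hpos x hx).le, huσ x hx⟩
  have hsq : ∀ x ∈ Ω, u x ^ 2 ≤ σ ^ 2 := fun x hx =>
    pow_le_pow_left₀ (huσ' x hx).1 (huσ' x hx).2 2
  have hsqi : IntegrableOn (fun x => u x ^ 2) Ω := by
    refine Integrable.mono' (integrable_const (σ ^ 2))
      ((hu.continuousOn.pow 2).aestronglyMeasurable hm) ?_
    filter_upwards [ae_restrict_mem hm] with x hx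
    rw [Real.norm_of_nonneg (sq_nonneg _)]
    exact hsq x hx
  have hsqle : ∫ x in Ω, u x ^ 2 ≤ σ ^ 2 * (volume : Measure (Euc N)).real Ω := by
    refine (setIntegral_mono_on hsqi (integrable_const (σ ^ 2)) hm hsq).trans ?_
    rw [setIntegral_const, smul_eq_mul, mul_comm]
  have htn : ∀ n : ℕ, (0 : ℝ) < 1 / (n + 1) := fun n => Nat.one_div_pos_of_nat
  choose η η' hη hη' hηt hη0 hη'0 hη'1 using fun n => exists_cutoff (htn n)
  have hcut := fun n => hΩ.integral_cutoff_le hu huc hu0 hK huσ' hlap (htn n) (hη n) (hη' n)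
    (hηt n) (hη0 n)
  refine integral_le_of_tendsto_ae (F := fun n x => η' n (u x) * ‖fderiv ℝ u x‖ ^ 2 + u x ^ 2)
    (fun n => Integrable.fun_add (hcut n).1 hsqi) (fun n => Eventually.of_forall fun x => ?_) (fun n => ?_) ?_
  · exact add_nonneg (mul_nonneg (hη'0 n _) (sq_nonneg _)) (sq_nonneg _)
  · rw [integral_add (hcut n).1 hsqi, add_mul]
    exact add_le_add (hcut n).2 hsqle
  · filter_upwards [ae_restrict_mem hm] with x hx
    refine tendsto_const_nhds.congr' ?_
    have h1 : Tendsto (fun n : ℕ => 2 * (1 / ((n : ℝ) + 1))) atTop (𝓝 (2 * 0)) :=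
      tendsto_one_div_add_atTop_nhds_zero_nat.const_mul 2
    rw [mul_zero] at h1
    filter_upwards [h1.eventually (ge_mem_nhds (hpos x hx))] with n hn
    rw [hη'1 n _ hn, one_mul]

end EnergyBound

section Limit

variable {N : ℕ} {Ω : Set (Euc N)} {f : Euc N → ℝ → ℝ}

theorem IsPosSolution.isBarrier (hΩ : IsDom Ω) (hf : IsSuperlinear Ω f)
    (hfc : ContinuousOn (Function.uncurry f) (Ω ×ˢ univ)) {lam : ℝ} (hlam : lam < 0)
    {w : Euc N → ℝ} (hw : IsPosSolution Ω f lam w) : IsBarrier Ω w (-lam) := by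
  obtain ⟨h1, h2, h3, h4, h5⟩ := hw
  have hfw : ContinuousOn (fun x => f x (w x)) Ω :=
    hfc.comp (continuousOn_id.prodMk h1.continuousOn) fun x hx => ⟨hx, mem_univ _⟩
  have hnn : ∀ x ∈ Ω, 0 ≤ f x (w x) := by
    refine ContinuousOn.le_of_ae_le hΩ.isOpen (f := fun _ => (0 : ℝ)) continuousOn_const hfw ?_
    filter_upwards [(ae_restrict_iff' hΩ.isOpen.measurableSet).1 hf.nonneg] with x hx hxΩ
    exact hx hxΩ hxΩ _ (h3 x hxΩ).le
  exact ⟨fun x hx => h1.contDiffAt (hΩ.isOpen.mem_nhds hx), h2, h3, h4, neg_pos.2 hlam,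
    fun x hx => by linarith [h5 x hx, hnn x hx]⟩

theorem IsPosSolution.integral_energy_le (hΩ : IsDom Ω) (hf : IsSuperlinear Ω f) {lam : ℝ}
    {u : Euc N → ℝ} (hu : IsPosSolution Ω f lam u) {δ σ Λ : ℝ} (hΛ : |lam| ≤ Λ) (hσ : 0 ≤ σ)
    (hσδ : σ ≤ δ)
    (hlip : ∀ᵐ x ∂(volume : Measure (Euc N)).restrict Ω, ∀ s ∈ Icc 0 δ, ∀ t ∈ Icc 0 δ,
      |f x s - f x t| ≤ 1 * |s - t|) (huσ : ∀ x ∈ Ω, u x ≤ σ) :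
    ∫ x in Ω, (‖fderiv ℝ u x‖ ^ 2 + u x ^ 2)
      ≤ (Λ + 2) * σ ^ 2 * (volume : Measure (Euc N)).real Ω := by
  obtain ⟨h1, h2, h3, h4, h5⟩ := hu
  have hΛ0 : 0 ≤ Λ := (abs_nonneg lam).trans hΛ
  have hlap : ∀ᵐ x ∂(volume : Measure (Euc N)).restrict Ω, -lap u x ≤ (Λ + 1) * σ := by
    filter_upwards [hlip, ae_restrict_mem hΩ.isOpen.measurableSet] with x a1 hx
    have b1 := a1 (u x) ⟨(h3 x hx).le, (huσ x hx).trans hσδ⟩ 0 ⟨le_rfl, hσ.trans hσδ⟩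
    rw [hf.zero x hx, sub_zero, sub_zero, one_mul, abs_of_pos (h3 x hx)] at b1
    have b2 : |lam * u x| ≤ Λ * σ := by
      rw [abs_mul, abs_of_pos (h3 x hx)]
      exact mul_le_mul hΛ (huσ x hx) (h3 x hx).le hΛ0
    linarith [h5 x hx, le_abs_self (f x (u x)), neg_abs_le (lam * u x), huσ x hx]
  refine (hΩ.integral_energy_le h1 h2 h4 h3 (by positivity) huσ hlap).trans (le_of_eq ?_)
  ring

end Limit

/-- `u_λ → 0` in `H¹₀(Ω)` as `λ → -λ₁(Ω)⁺`, i.e.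
`∫_Ω (|∇u_λ|² + u_λ²) → 0` as `λ → -λ₁(Ω)` from the right. -/
theorem statement8 {N : ℕ} {Ω : Set (Euc N)} {f : Euc N → ℝ → ℝ} {d : Euc N → ℝ}
    {g : Euc N → ℝ → ℝ} {p : ℝ} {u : ℝ → Euc N → ℝ}
    (H : Standing N Ω f d g p u) :
    Tendsto (fun lam : ℝ => ∫ x in Ω, (‖fderiv ℝ (u lam) x‖ ^ 2 + (u lam x) ^ 2))
      (𝓝[>] (- firstEig Ω)) (𝓝 0) := by
  have hΩ : IsDom Ω := ⟨H.dim, H.isOpen, H.conn, H.bdd⟩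
  have hf := H.isSuperlinear
  have hE := hΩ.firstEig_pos
  have hw := (H.sol (-(firstEig Ω / 2)) (by linarith)).1.isBarrier hΩ hf H.f_c1.continuousOn
    (by linarith)
  obtain ⟨δ, hδ, -, hlip⟩ := hf.lipschitz 1 one_pos
  obtain ⟨V, hV⟩ : ∃ V, V = (volume : Measure (Euc N)).real Ω := ⟨_, rfl⟩
  have hV0 : 0 ≤ V := hV ▸ measureReal_nonneg
  rw [Metric.tendsto_nhds]
  intro η hη
  obtain ⟨σ, hσ, hσδ, hση⟩ : ∃ σ : ℝ, 0 < σ ∧ σ ≤ δ ∧ (firstEig Ω + 1 + 2) * σ ^ 2 * V < η := by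
    have hlim : Tendsto (fun σ : ℝ => (firstEig Ω + 1 + 2) * σ ^ 2 * V) (𝓝[>] 0) (𝓝 0) := by
      have h1 : Continuous fun σ : ℝ => (firstEig Ω + 1 + 2) * σ ^ 2 * V := by fun_prop
      have h2 := (h1.tendsto 0).mono_left (nhdsWithin_le_nhds (s := Ioi 0))
      simpa using h2
    obtain ⟨σ, hσ1, hσ2⟩ := ((hlim.eventually (gt_mem_nhds hη)).and (Ioo_mem_nhdsGT hδ)).exists
    exact ⟨σ, hσ2.1, hσ2.2.le, hσ1⟩
  filter_upwards [hΩ.eventually_le hw hf H.f_c1 (fun lam hlam => (H.sol lam hlam).2) hσ,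
    Ioo_mem_nhdsGT (show -firstEig Ω < -firstEig Ω + 1 by linarith)] with lam hle hlam
  have hlam' : |lam| ≤ firstEig Ω + 1 := abs_le.2 ⟨by linarith [hlam.1], by linarith [hlam.2]⟩
  have hbound := (H.sol lam hlam.1).1.integral_energy_le hΩ hf hlam' hσ.le hσδ hlip hle
  rw [Real.dist_0_eq_abs, abs_of_nonneg (integral_nonneg fun x => by positivity)]
  rw [← hV] at hbound
  exact hbound.trans_lt hση
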